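/- Assume GRH(q), let k ≥ 2 be a fixed integer, and let χ and ν be distinct Dirichlet characters modulo q. Then for every ε > 0, |∫_T^{2T} L(1/2+it, χ)^k · conj(L(1/2+it, ν))^k dt| ≪_{q,k,ε} T(log T)^{k²−2k+2+ε} for all sufficiently large T, where conj denotes complex conjugation. -/

import Mathlib

open Complex Filter MeasureTheory Finset HurwitzZeta
open scoped ArithmeticFunction Real Classical

noncomputable section

/-- The finite set of primes `p ≤ X`. -/
def primesUpTo (X : ℝ) : Finset ℕ :=
  (Finset.range (Nat.floor X + 1)).filter (fun p => p.Prime ∧ (p : ℝ) ≤ X)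

/-- The finite set of naturals `n ≤ X`. -/
def natsUpTo (X : ℝ) : Finset ℕ :=
  (Finset.range (Nat.floor X + 1)).filter (fun n => (n : ℝ) ≤ X)

/-- Truncated Euler product `P_X(s,χ)`, defined via the primitive character `χ*` inducing `χ`:
`P_X(s,χ) = ∏_{p ∣ q} (1 - χ*(p) p^{-s}) · exp(∑_{n ≤ X} χ*(n) Λ(n) / (n^s log n))`. -/
def PX {q : ℕ} (X : ℝ) (χ : DirichletCharacter ℂ q) (s : ℂ) : ℂ :=
  (∏ p ∈ q.primeFactors, (1 - χ.primitiveCharacter ((p : ℕ) : ZMod χ.conductor) * (p : ℂ) ^ (-s))) *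
    Complex.exp (∑ n ∈ natsUpTo X,
      χ.primitiveCharacter ((n : ℕ) : ZMod χ.conductor) * (Λ n : ℂ) / ((n : ℂ) ^ s * (Real.log n : ℂ)))

/-- `𝓟_X^ℓ(s) = ∏_χ P_X(s,χ)^{ℓ_χ}`. -/
def PXl {q : ℕ} (X : ℝ) (ℓ : DirichletCharacter ℂ q → ℕ) (s : ℂ) : ℂ :=
  ∏ χ : DirichletCharacter ℂ q, (PX X χ s) ^ (ℓ χ)

/-- A Dirichlet character as an arithmetic function. -/
def chiArith {q : ℕ} (χ : DirichletCharacter ℂ q) : ArithmeticFunction ℂ :=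
  ⟨fun n => if n = 0 then 0 else χ ((n : ℕ) : ZMod q), by simp⟩

/-- `d_ℓ`, the coefficients of the Dirichlet series of `𝓛^ℓ(s) = ∏_χ L(s,χ)^{ℓ_χ}`,
i.e. the Dirichlet convolution product `∏_χ χ^{*ℓ_χ}`. -/
def dcoef {q : ℕ} (ℓ : DirichletCharacter ℂ q → ℕ) : ArithmeticFunction ℂ :=
  ∏ χ : DirichletCharacter ℂ q, (chiArith χ) ^ (ℓ χ)

/-- `P*_X(s,χ) = ∏_{p ≤ X}(1 − χ(p)p^{−s})^{−1} · ∏_{√X < p ≤ X}(1 + χ(p)²/(2p^{2s}))^{−1}`. -/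
def PstarX {q : ℕ} (X : ℝ) (χ : DirichletCharacter ℂ q) (s : ℂ) : ℂ :=
  ((primesUpTo X).prod (fun p : ℕ => (1 - χ ((p : ℕ) : ZMod q) * (p : ℂ) ^ (-s))⁻¹)) *
    ((primesUpTo X).filter (fun p : ℕ => Real.sqrt X < (p : ℝ))).prod
      (fun p : ℕ => (1 + χ ((p : ℕ) : ZMod q) ^ 2 / (2 * (p : ℂ) ^ (2 * s)))⁻¹)

/-- `𝓟*_X^ℓ(s) = ∏_χ P*_X(s,χ)^{ℓ_χ}`. -/
def PstarXl {q : ℕ} (X : ℝ) (ℓ : DirichletCharacter ℂ q → ℕ) (s : ℂ) : ℂ :=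
  ∏ χ : DirichletCharacter ℂ q, (PstarX X χ s) ^ (ℓ χ)

/-- `Q_X(s,χ) = ∏_{p ≤ √X}(1 − χ(p)p^{−s}) · ∏_{√X < p ≤ X}(1 − χ(p)p^{−s} + χ(p)²/(2p^{2s}))`. -/
def QX {q : ℕ} (X : ℝ) (χ : DirichletCharacter ℂ q) (s : ℂ) : ℂ :=
  (((primesUpTo X).filter (fun p : ℕ => (p : ℝ) ≤ Real.sqrt X)).prod
      (fun p : ℕ => 1 - χ ((p : ℕ) : ZMod q) * (p : ℂ) ^ (-s))) *
    ((primesUpTo X).filter (fun p : ℕ => Real.sqrt X < (p : ℝ))).prod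
      (fun p : ℕ => 1 - χ ((p : ℕ) : ZMod q) * (p : ℂ) ^ (-s)
        + χ ((p : ℕ) : ZMod q) ^ 2 / (2 * (p : ℂ) ^ (2 * s)))

/-- `𝓠_X^ℓ(s) = ∏_χ Q_X(s,χ)^{ℓ_χ}`. -/
def QXl {q : ℕ} (X : ℝ) (ℓ : DirichletCharacter ℂ q → ℕ) (s : ℂ) : ℂ :=
  ∏ χ : DirichletCharacter ℂ q, (QX X χ s) ^ (ℓ χ)

/-- `𝓛^ℓ(s) = ∏_χ L(s,χ)^{ℓ_χ}`. -/
def Ll {q : ℕ} [NeZero q] (ℓ : DirichletCharacter ℂ q → ℕ) (s : ℂ) : ℂ :=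
  ∏ χ : DirichletCharacter ℂ q, (DirichletCharacter.LFunction χ s) ^ (ℓ χ)

/-- GRH for the Dirichlet L-functions modulo `q`: every zero `ρ` of `L(s,χ)` with
`0 < Re ρ < 1` satisfies `Re ρ = 1/2`. -/
def GRHmod (q : ℕ) [NeZero q] : Prop :=
  ∀ χ : DirichletCharacter ℂ q, ∀ ρ : ℂ,
    DirichletCharacter.LFunction χ ρ = 0 → 0 < ρ.re → ρ.re < 1 → ρ.re = 1 / 2

end

theorem exists_exp_eq_on_ball {g : ℂ → ℂ} {c : ℂ} {R : ℝ} (hR : 0 < R)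
    (hg : DifferentiableOn ℂ g (Metric.ball c R)) (hg0 : ∀ z ∈ Metric.ball c R, g z ≠ 0) :
    ∃ F : ℂ → ℂ, F c = 0 ∧ ∀ z ∈ Metric.ball c R,
      HasDerivAt F (deriv g z / g z) z ∧ g z = g c * Complex.exp (F z) := by
  have hd : DifferentiableOn ℂ (fun z => deriv g z / g z) (Metric.ball c R) :=
    (hg.deriv Metric.isOpen_ball).div hg hg0
  obtain ⟨F₀, hF₀⟩ := hd.isExactOn_ball
  refine ⟨fun z => F₀ z - F₀ c, by simp, fun z hz => ⟨(hF₀ z hz).sub_const _, ?_⟩⟩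
  have hconst : ∀ z ∈ Metric.ball c R, HasDerivAt (fun z => g z * Complex.exp (-(F₀ z - F₀ c))) 0 z := by
    intro z hz
    have h1 := (hg.differentiableAt (Metric.isOpen_ball.mem_nhds hz)).hasDerivAt
    have h2 := ((hF₀ z hz).sub_const (F₀ c)).fun_neg.cexp
    have h3 := hg0 z hz
    refine (h1.fun_mul h2).congr_deriv ?_
    field_simp
    ring
  have hcc : c ∈ Metric.ball c R := Metric.mem_ball_self hR
  have := (convex_ball c R).is_const_of_fderivWithin_eq_zero (𝕜 := ℂ)
    (f := fun z => g z * Complex.exp (-(F₀ z - F₀ c)))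
    (fun w hw => (hconst w hw).differentiableAt.differentiableWithinAt)
    (fun w hw => by
      rw [(hconst w hw).hasFDerivAt.hasFDerivWithinAt.fderivWithin
        (Metric.isOpen_ball.uniqueDiffWithinAt hw)]
      ext; simp) hz hcc
  simp only [sub_self, neg_zero, Complex.exp_zero, mul_one] at this
  rw [← this, mul_assoc, ← Complex.exp_add]
  simp

/-- Borel–Carathéodory for a zero-free function on a disc. -/
theorem log_bounds_of_ne_zero_on_ball {g : ℂ → ℂ} {c : ℂ} {r R M : ℝ} (hr : 0 < r) (hrR : r < R)
    (hM : 1 < M) (hg : DifferentiableOn ℂ g (Metric.ball c R))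
    (hg0 : ∀ z ∈ Metric.ball c R, g z ≠ 0)
    (hgM : ∀ z ∈ Metric.ball c R, ‖g z‖ ≤ M * ‖g c‖) {z : ℂ} (hz : z ∈ Metric.closedBall c r) :
    ‖g c‖ * Real.exp (-(2 * r / (R - r) * Real.log M)) ≤ ‖g z‖ ∧
      ‖deriv g z / g z‖ ≤ 4 * (R + r) / (R - r) ^ 2 * Real.log M := by
  have hR : 0 < R := hr.trans hrR
  obtain ⟨F, hFc, hF⟩ := exists_exp_eq_on_ball hR hg hg0
  have hcc : c ∈ Metric.ball c R := Metric.mem_ball_self hR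
  have hlog : 0 < Real.log M := Real.log_pos hM
  have hgc : 0 < ‖g c‖ := norm_pos_iff.2 (hg0 c hcc)
  have key : ∀ w ∈ Metric.ball c R, ‖F w‖ ≤ 2 * Real.log M * ‖w - c‖ / (R - ‖w - c‖) := by
    intro w hw
    have hmem : ∀ v ∈ Metric.ball (0 : ℂ) R, v + c ∈ Metric.ball c R := by
      intro v hv
      simpa [dist_eq_norm] using hv
    have := Complex.borelCaratheodory_zero (f := fun v => F (v + c)) (z := w - c) (R := R)
      (M := Real.log M) hlog ?_ ?_ hR ?_ ?_
    · simpa using this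
    · intro v hv
      have h1 := (hF _ (hmem v hv)).1.differentiableAt
      exact (h1.comp v (by fun_prop : DifferentiableAt ℂ (fun v => v + c) v)).differentiableWithinAt
    · intro v hv
      have h1 := hgM _ (hmem v hv)
      rw [(hF _ (hmem v hv)).2, norm_mul, mul_comm, Complex.norm_exp] at h1
      have h2 := le_of_mul_le_mul_right h1 hgc
      simpa using (Real.le_log_iff_exp_le (by linarith)).2 h2
    · simpa [dist_eq_norm] using hw
    · simpa using hFc
  have hzR : z ∈ Metric.ball c R := Metric.closedBall_subset_ball hrR hz
  have hzr : ‖z - c‖ ≤ r := by simpa [dist_eq_norm] using hz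
  constructor
  · rw [(hF z hzR).2, norm_mul, Complex.norm_exp]
    gcongr
    have h1 := key z hzR
    have h2 : 2 * Real.log M * ‖z - c‖ / (R - ‖z - c‖) ≤ 2 * r / (R - r) * Real.log M := by
      rw [div_mul_eq_mul_div]
      have : 0 < R - r := by linarith
      gcongr ?_ / ?_
      · nlinarith
      · linarith
    have h3 := (abs_le.1 (Complex.abs_re_le_norm (F z))).1
    linarith
  · have hρ : 0 < (R - r) / 2 := by linarith
    rw [← (hF z hzR).1.deriv]
    have hsub : Metric.closedBall z ((R - r) / 2) ⊆ Metric.ball c R := by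
      intro w hw
      rw [Metric.mem_closedBall] at hw hz
      rw [Metric.mem_ball]
      linarith [dist_triangle w z c]
    have := Complex.norm_deriv_le_of_forall_mem_sphere_norm_le (f := F) (c := z)
      (R := (R - r) / 2) (C := 2 * Real.log M * ((R + r) / 2) / ((R - r) / 2)) hρ ?_ ?_
    · refine this.trans (le_of_eq ?_)
      have : R - r ≠ 0 := by linarith
      field_simp
      ring
    · refine DifferentiableOn.diffContOnCl ?_
      rw [closure_ball z hρ.ne']
      exact fun w hw => (hF w (hsub hw)).1.differentiableAt.differentiableWithinAt
    · intro w hw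
      have hw' := hsub (Metric.sphere_subset_closedBall hw)
      refine (key w hw').trans ?_
      have h1 : ‖w - c‖ ≤ (R + r) / 2 := by
        have h3 : ‖w - z‖ = (R - r) / 2 := by simpa [dist_eq_norm] using hw
        calc ‖w - c‖ = ‖(w - z) + (z - c)‖ := by ring_nf
          _ ≤ ‖w - z‖ + ‖z - c‖ := norm_add_le _ _
          _ ≤ (R + r) / 2 := by linarith
      gcongr
      linarith

/-- Zeros in a small disc can be divided out without increasing the ratio `sup |f| / |f c|`. -/
theorem exists_factor_zeros {c : ℂ} {ρ : ℝ} (hρ : 0 < ρ) (n : ℕ) :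
    ∀ (f : ℂ → ℂ) (M : ℝ), M < 2 ^ n → DifferentiableOn ℂ f (Metric.ball c (3 * ρ)) → f c ≠ 0 →
    (∀ z ∈ Metric.ball c (3 * ρ), ‖f z‖ ≤ M * ‖f c‖) →
    ∃ (S : Multiset ℂ) (g : ℂ → ℂ), (∀ a ∈ S, a ∈ Metric.ball c ρ ∧ f a = 0) ∧
      DifferentiableOn ℂ g (Metric.ball c (3 * ρ)) ∧ (∀ z ∈ Metric.ball c ρ, g z ≠ 0) ∧
      (∀ z ∈ Metric.ball c (3 * ρ), ‖g z‖ ≤ M * ‖g c‖) ∧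
      (∀ z ∈ Metric.ball c (3 * ρ), f z = (S.map (fun a => z - a)).prod * g z) := by
  have hcc : c ∈ Metric.ball c (3 * ρ) := Metric.mem_ball_self (by linarith)
  induction n with
  | zero =>
    intro f M hM hf hfc hfM
    have h1 := hfM c hcc
    have : 0 < ‖f c‖ := norm_pos_iff.2 hfc
    simp at hM
    nlinarith
  | succ n ih =>
    intro f M hM hf hfc hfM
    have hfc' : 0 < ‖f c‖ := norm_pos_iff.2 hfc
    have hM1 : 1 ≤ M := by
      by_contra h
      have := hfM c hcc
      nlinarith
    by_cases hz : ∀ z ∈ Metric.ball c ρ, f z ≠ 0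
    · exact ⟨0, f, by simp, hf, hz, hfM, by simp⟩
    push Not at hz
    obtain ⟨a, ha, hfa⟩ := hz
    have ha3 : a ∈ Metric.ball c (3 * ρ) := Metric.ball_subset_ball (by linarith) ha
    set f₁ := dslope f a with hf₁
    have hd₁ : DifferentiableOn ℂ f₁ (Metric.ball c (3 * ρ)) :=
      (Complex.differentiableOn_dslope (Metric.isOpen_ball.mem_nhds ha3)).2 hf
    have hmul : ∀ z, f z = (z - a) * f₁ z := by
      intro z
      have := sub_smul_dslope f a z
      rw [hfa, sub_zero, smul_eq_mul] at this
      exact this.symm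
    have hac : ‖c - a‖ < ρ := by simpa [dist_eq_norm, norm_sub_rev] using ha
    have hca : 0 < ‖c - a‖ := by
      rw [norm_pos_iff, sub_ne_zero]; rintro rfl; exact hfc hfa
    have hf₁c : f₁ c ≠ 0 := by
      intro h; exact hfc (by rw [hmul c, h, mul_zero])
    have hf₁c' : ‖f c‖ ≤ ρ * ‖f₁ c‖ := by
      rw [hmul c, norm_mul]; gcongr
    have hbound : ∀ z ∈ Metric.ball c (3 * ρ), ‖f₁ z‖ ≤ M / 2 * ‖f₁ c‖ := by
      intro z hz
      have hz' : ‖z - c‖ < 3 * ρ := by simpa [dist_eq_norm] using hz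
      have hlim : ∀ᶠ r in nhdsWithin (3 * ρ) (Set.Iio (3 * ρ)), ‖f₁ z‖ ≤ M * ‖f c‖ / (r - ρ) := by
        have h1 : ∀ᶠ r in nhdsWithin (3 * ρ) (Set.Iio (3 * ρ)), max ‖z - c‖ ρ < r :=
          nhdsWithin_le_nhds (lt_mem_nhds (max_lt hz' (by linarith)))
        filter_upwards [h1, self_mem_nhdsWithin] with r hr1 hr2
        have hr2 : r < 3 * ρ := hr2
        have hr3 : ρ < r := (le_max_right _ _).trans_lt hr1
        have hr4 : ‖z - c‖ < r := (le_max_left _ _).trans_lt hr1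
        have hr0 : 0 < r := hρ.trans hr3
        refine Complex.norm_le_of_forall_mem_frontier_norm_le (U := Metric.ball c r)
          Metric.isBounded_ball ?_ ?_ (subset_closure (by simpa [dist_eq_norm] using hr4))
        · refine DifferentiableOn.diffContOnCl ?_
          rw [closure_ball c hr0.ne']
          exact hd₁.mono (Metric.closedBall_subset_ball hr2)
        · intro w hw
          rw [frontier_ball c hr0.ne'] at hw
          have hw1 : ‖w - c‖ = r := by simpa [dist_eq_norm] using hw
          have hw2 := hfM w (by rw [Metric.mem_ball, dist_eq_norm, hw1]; exact hr2)
          have hw3 : r - ρ ≤ ‖w - a‖ := by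
            have : ‖w - c‖ ≤ ‖w - a‖ + ‖c - a‖ := by
              rw [norm_sub_rev c a]
              calc ‖w - c‖ = ‖(w - a) + (a - c)‖ := by ring_nf
                _ ≤ _ := norm_add_le _ _
            linarith
          rw [hmul w, norm_mul] at hw2
          rw [le_div_iff₀ (by linarith)]
          calc ‖f₁ w‖ * (r - ρ) ≤ ‖f₁ w‖ * ‖w - a‖ := by gcongr
            _ ≤ _ := by linarith
      have hcont : Tendsto (fun r => M * ‖f c‖ / (r - ρ)) (nhdsWithin (3 * ρ) (Set.Iio (3 * ρ)))
          (nhds (M * ‖f c‖ / (3 * ρ - ρ))) := by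
        refine Tendsto.mono_left ?_ nhdsWithin_le_nhds
        refine ContinuousAt.tendsto (ContinuousAt.div continuousAt_const (by fun_prop) ?_)
        linarith
      refine (ge_of_tendsto hcont hlim).trans ?_
      rw [div_le_iff₀ (by linarith)]
      nlinarith
    obtain ⟨S, g, hS, hg, hg0, hgM, hfac⟩ := ih f₁ (M / 2) (by
      rw [pow_succ] at hM; linarith) hd₁ hf₁c hbound
    refine ⟨a ::ₘ S, g, ?_, hg, hg0, ?_, ?_⟩
    · intro b hb
      rcases Multiset.mem_cons.1 hb with rfl | hb
      · exact ⟨ha, hfa⟩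
      · exact ⟨(hS b hb).1, by rw [hmul b, (hS b hb).2, mul_zero]⟩
    · intro z hz
      refine (hgM z hz).trans ?_
      gcongr
      linarith
    · intro z hz
      rw [hmul z, hfac z hz]
      simp [mul_assoc]

theorem re_logDeriv_prod_nonneg {a : ℝ} {z : ℂ} (hz : a < z.re) (S : Multiset ℂ)
    (hS : ∀ b ∈ S, b.re ≤ a) :
    ∃ d : ℂ, HasDerivAt (fun w => (S.map (fun b => w - b)).prod) d z ∧
      (S.map (fun b => z - b)).prod ≠ 0 ∧ 0 ≤ (d / (S.map (fun b => z - b)).prod).re := by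
  induction S using Multiset.induction with
  | empty => exact ⟨0, by simpa using hasDerivAt_const z (1 : ℂ), by simp, by simp⟩
  | cons b S ih =>
    obtain ⟨d, hd, h0, hre⟩ := ih fun x hx => hS x (Multiset.mem_cons_of_mem hx)
    have hb : b.re ≤ a := hS b (Multiset.mem_cons_self b S)
    have hzb : z - b ≠ 0 := by
      intro h
      have := congrArg Complex.re h
      simp at this
      linarith
    have h1 : HasDerivAt (fun w : ℂ => w - b) 1 z := (hasDerivAt_id z).sub_const b
    refine ⟨_, by simpa using h1.fun_mul hd,
      by simp only [Multiset.map_cons, Multiset.prod_cons]; exact mul_ne_zero hzb h0, ?_⟩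
    simp only [Multiset.map_cons, Multiset.prod_cons]
    have : ((S.map fun b => z - b).prod + (z - b) * d) / ((z - b) * (S.map fun b => z - b).prod)
        = (z - b)⁻¹ + d / (S.map fun b => z - b).prod := by
      field_simp
    rw [this, Complex.add_re, Complex.inv_re]
    have : 0 ≤ (z - b).re / Complex.normSq (z - b) := by
      apply div_nonneg _ (Complex.normSq_nonneg _)
      simp; linarith
    linarith

/-- To the right of all zeros, the real part of the logarithmic derivative is bounded below. -/
theorem re_logDeriv_ge {f : ℂ → ℂ} {c z : ℂ} {ρ M a : ℝ} (hρ : 0 < ρ) (hM : 1 < M)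
    (hf : DifferentiableOn ℂ f (Metric.ball c (3 * ρ))) (hfc : f c ≠ 0)
    (hfM : ∀ w ∈ Metric.ball c (3 * ρ), ‖f w‖ ≤ M * ‖f c‖)
    (hzero : ∀ w ∈ Metric.ball c ρ, f w = 0 → w.re ≤ a) (hz : z ∈ Metric.closedBall c (3 / 4 * ρ))
    (hza : a < z.re) : -(112 / ρ * Real.log M) ≤ (deriv f z / f z).re := by
  obtain ⟨n, hn⟩ := pow_unbounded_of_one_lt M (one_lt_two)
  obtain ⟨S, g, hS, hg, hg0, hgM, hfac⟩ := exists_factor_zeros hρ n f M hn hf hfc hfM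
  have hsub : Metric.ball c ρ ⊆ Metric.ball c (3 * ρ) := Metric.ball_subset_ball (by linarith)
  have hz1 : z ∈ Metric.ball c ρ := Metric.closedBall_subset_ball (by linarith) hz
  have hz3 := hsub hz1
  have hb := (log_bounds_of_ne_zero_on_ball (by linarith) (by linarith) hM (hg.mono hsub) hg0
    (fun w hw => hgM w (hsub hw)) hz).2
  obtain ⟨d, hd, hP0, hre⟩ := re_logDeriv_prod_nonneg hza S
    (fun b hb => hzero b (hS b hb).1 (hS b hb).2)
  have hgd := (hg.differentiableAt (Metric.isOpen_ball.mem_nhds hz3)).hasDerivAt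
  have hfd : HasDerivAt f (d * g z + (S.map fun b => z - b).prod * deriv g z) z := by
    refine (hd.mul hgd).congr_of_eventuallyEq ?_
    filter_upwards [Metric.isOpen_ball.mem_nhds hz3] with w hw
    exact hfac w hw
  rw [hfd.deriv, hfac z hz3]
  have hgz := hg0 z hz1
  have : (d * g z + (S.map fun b => z - b).prod * deriv g z) / ((S.map fun b => z - b).prod * g z)
      = d / (S.map fun b => z - b).prod + deriv g z / g z := by
    field_simp
  rw [this, Complex.add_re]
  have h1 := (abs_le.1 (Complex.abs_re_le_norm (deriv g z / g z))).1
  have h2 : 4 * (ρ + 3 / 4 * ρ) / (ρ - 3 / 4 * ρ) ^ 2 = 112 / ρ := by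
    field_simp
    ring
  rw [h2] at hb
  linarith

theorem norm_deriv_le_of_re_pos {D : ℂ → ℂ} (hD : DifferentiableOn ℂ D {z | 0 < z.re})
    (hV : ∀ z, 0 < z.re → 0 < (D z).re) {w : ℂ} (hw : 0 < w.re) :
    ‖deriv D w‖ ≤ 2 * (D w).re / w.re := by
  have hopen : IsOpen {z : ℂ | 0 < z.re} := isOpen_lt continuous_const Complex.continuous_re
  have hderiv := (hD.differentiableAt (hopen.mem_nhds hw)).hasDerivAt
  have hVw := hV w hw
  have hmem : ∀ z : ℂ, ‖z‖ < w.re → 0 < (w + z).re := by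
    intro z hz
    have := (abs_le.1 (Complex.abs_re_le_norm z)).1
    simp only [Complex.add_re]
    linarith
  have hbc : ∀ z : ℂ, ‖z‖ < w.re → ‖D (w + z) - D w‖ ≤ 2 * (D w).re * ‖z‖ / (w.re - ‖z‖) := by
    intro z hz
    have := Complex.borelCaratheodory_zero (f := fun v => D w - D (w + v)) (z := z) (R := w.re)
      (M := (D w).re) hVw ?_ ?_ hw ?_ ?_
    · rwa [norm_sub_rev] at this
    · intro v hv
      have hv' : ‖v‖ < w.re := by simpa using hv
      have h1 := hD.differentiableAt (hopen.mem_nhds (hmem v hv'))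
      have h2 := h1.comp v (by fun_prop : DifferentiableAt ℂ (fun v => w + v) v)
      exact ((differentiableAt_const _).sub h2).differentiableWithinAt
    · intro v hv
      have hv' : ‖v‖ < w.re := by simpa using hv
      have := hV _ (hmem v hv')
      simp only [Set.mem_ofPred_eq, Complex.sub_re]
      linarith
    · simpa using hz
    · simp
  have hlim : Tendsto (fun ε : ℝ => 2 * (D w).re / (w.re - ε)) (nhdsWithin 0 (Set.Ioi 0))
      (nhds (2 * (D w).re / (w.re - 0))) := by
    refine Tendsto.mono_left ?_ nhdsWithin_le_nhds
    refine ContinuousAt.tendsto (ContinuousAt.div continuousAt_const (by fun_prop) ?_)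
    linarith
  rw [sub_zero] at hlim
  refine ge_of_tendsto hlim ?_
  filter_upwards [self_mem_nhdsWithin, nhdsWithin_le_nhds (gt_mem_nhds hw)] with ε hε1 hε2
  have hε1 : 0 < ε := hε1
  refine hderiv.le_of_lip' (by apply div_nonneg <;> linarith) ?_
  filter_upwards [Metric.ball_mem_nhds w hε1] with x hx
  have hx' : ‖x - w‖ < ε := by simpa [dist_eq_norm] using hx
  have := hbc (x - w) (hx'.trans hε2)
  rw [add_sub_cancel] at this
  refine this.trans ?_
  rw [div_mul_eq_mul_div]
  gcongr

section Harnack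

variable {D : ℂ → ℂ}

theorem hasDerivAt_re_horizontal (hD : DifferentiableOn ℂ D {z | 0 < z.re}) (t : ℝ) {x : ℝ}
    (hx : 0 < x) : HasDerivAt (fun x : ℝ => (D (x + t * I)).re) (deriv D (x + t * I)).re x := by
  have hopen : IsOpen {z : ℂ | 0 < z.re} := isOpen_lt continuous_const Complex.continuous_re
  have h1 := (hD.differentiableAt (hopen.mem_nhds
    (show 0 < ((x : ℂ) + t * I).re by simpa using hx))).hasDerivAt
  have h2 : HasDerivAt (fun x : ℝ => (x : ℂ) + t * I) 1 x := by
    simpa using (hasDerivAt_id x).ofReal_comp.add_const (t * I)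
  have h3 := (h1.comp x h2)
  exact (Complex.reCLM.hasFDerivAt.comp_hasDerivAt x h3).congr_deriv (by simp)

theorem hasDerivAt_vertical (hD : DifferentiableOn ℂ D {z | 0 < z.re}) {x : ℝ} (hx : 0 < x)
    (t y : ℝ) : HasDerivAt (fun y : ℝ => D (x + (t + y : ℝ) * I))
      (deriv D (x + (t + y : ℝ) * I) * I) y := by
  have hopen : IsOpen {z : ℂ | 0 < z.re} := isOpen_lt continuous_const Complex.continuous_re
  have h1 := (hD.differentiableAt (hopen.mem_nhds
    (show 0 < ((x : ℂ) + (t + y : ℝ) * I).re by simpa using hx))).hasDerivAt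
  have h2 : HasDerivAt (fun y : ℝ => (x : ℂ) + (t + y : ℝ) * I) I y := by
    simpa using ((((hasDerivAt_id y).const_add t).ofReal_comp).mul_const I).const_add (x : ℂ)
  exact h1.comp y h2

theorem hasDerivAt_re_vertical (hD : DifferentiableOn ℂ D {z | 0 < z.re}) {x : ℝ} (hx : 0 < x)
    (t y : ℝ) : HasDerivAt (fun y : ℝ => (D (x + (t + y : ℝ) * I)).re)
      (-(deriv D (x + (t + y : ℝ) * I)).im) y := by
  exact (Complex.reCLM.hasFDerivAt.comp_hasDerivAt y (hasDerivAt_vertical hD hx t y)).congr_deriv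
    (by simp)

variable (hD : DifferentiableOn ℂ D {z | 0 < z.re}) (hV : ∀ z, 0 < z.re → 0 < (D z).re)
include hD hV

theorem re_div_sq_antitone (t : ℝ) :
    AntitoneOn (fun x : ℝ => (D (x + t * I)).re / x ^ 2) (Set.Ioi 0) := by
  have hd : ∀ x : ℝ, 0 < x → HasDerivAt (fun x : ℝ => (D (x + t * I)).re / x ^ 2)
      (((deriv D (x + t * I)).re * x ^ 2 - (D (x + t * I)).re * (2 * x)) / (x ^ 2) ^ 2) x := by
    intro x hx
    have := (hasDerivAt_re_horizontal hD t hx).fun_div ((hasDerivAt_id x).fun_pow 2)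
      (by simpa using hx.ne')
    simpa using this
  refine antitoneOn_of_deriv_nonpos (convex_Ioi 0)
    (fun x hx => (hd x hx).continuousAt.continuousWithinAt) ?_ ?_
  · rw [interior_Ioi]
    exact fun x hx => (hd x hx).differentiableAt.differentiableWithinAt
  · rw [interior_Ioi]
    intro x hx
    have hx : 0 < x := hx
    rw [(hd x hx).deriv]
    refine div_nonpos_of_nonpos_of_nonneg ?_ (by positivity)
    have h1 := norm_deriv_le_of_re_pos hD hV (w := x + t * I) (by simpa using hx)
    have h2 := (Complex.re_le_norm (deriv D (x + t * I))).trans h1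
    have h3 : ((x : ℂ) + t * I).re = x := by simp
    rw [h3, le_div_iff₀ hx] at h2
    nlinarith

theorem re_mul_sq_monotone (t : ℝ) :
    MonotoneOn (fun x : ℝ => (D (x + t * I)).re * x ^ 2) (Set.Ioi 0) := by
  have hd : ∀ x : ℝ, 0 < x → HasDerivAt (fun x : ℝ => (D (x + t * I)).re * x ^ 2)
      ((deriv D (x + t * I)).re * x ^ 2 + (D (x + t * I)).re * (2 * x)) x := by
    intro x hx
    have := (hasDerivAt_re_horizontal hD t hx).fun_mul ((hasDerivAt_id x).fun_pow 2)
    simpa using this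
  refine monotoneOn_of_deriv_nonneg (convex_Ioi 0)
    (fun x hx => (hd x hx).continuousAt.continuousWithinAt) ?_ ?_
  · rw [interior_Ioi]
    exact fun x hx => (hd x hx).differentiableAt.differentiableWithinAt
  · rw [interior_Ioi]
    intro x hx
    have hx : 0 < x := hx
    rw [(hd x hx).deriv]
    have h1 := norm_deriv_le_of_re_pos hD hV (w := x + t * I) (by simpa using hx)
    have h2 := (neg_le_of_abs_le ((Complex.abs_re_le_norm (deriv D (x + t * I))).trans h1))
    have h3 : ((x : ℂ) + t * I).re = x := by simp
    rw [h3] at h2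
    have h4 : 2 * (D (x + t * I)).re / x * x = 2 * (D (x + t * I)).re := by field_simp
    nlinarith

theorem re_vertical_le {x : ℝ} (hx : 0 < x) (t y : ℝ) :
    (D (x + (t + y : ℝ) * I)).re ≤ Real.exp (2 * |y| / x) * (D (x + t * I)).re := by
  have hpos : ∀ y : ℝ, 0 < (D (x + (t + y : ℝ) * I)).re := fun y => hV _ (by simpa using hx)
  have hd : ∀ y : ℝ, HasDerivAt (fun y : ℝ => Real.log (D (x + (t + y : ℝ) * I)).re)
      (-(deriv D (x + (t + y : ℝ) * I)).im / (D (x + (t + y : ℝ) * I)).re) y :=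
    fun y => (hasDerivAt_re_vertical hD hx t y).log (hpos y).ne'
  have hb : ∀ y : ℝ, ‖-(deriv D (x + (t + y : ℝ) * I)).im / (D (x + (t + y : ℝ) * I)).re‖
      ≤ 2 / x := by
    intro y
    rw [Real.norm_eq_abs, abs_div, abs_neg, abs_of_pos (hpos y), div_le_iff₀ (hpos y)]
    refine (Complex.abs_im_le_norm _).trans
      ((norm_deriv_le_of_re_pos hD hV (by simpa using hx)).trans (le_of_eq ?_))
    simp
    ring
  have := convex_univ.norm_image_sub_le_of_norm_hasDerivWithin_le (C := 2 / x)
    (f := fun y : ℝ => Real.log (D (x + (t + y : ℝ) * I)).re)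
    (fun y _ => (hd y).hasDerivWithinAt) (fun y _ => hb y) (Set.mem_univ 0) (Set.mem_univ y)
  have h1 := (le_abs_self _).trans this
  simp only [add_zero, sub_zero, Real.norm_eq_abs] at h1
  have h0 : 0 < (D (x + t * I)).re := by simpa using hpos 0
  rw [← Real.exp_log (hpos y), ← Real.exp_log h0, ← Real.exp_add]
  apply Real.exp_le_exp.2
  have : 2 / x * |y| = 2 * |y| / x := by ring
  linarith

/-- Harnack's inequality in the right half-plane along vertical lines. -/
theorem re_harnack {x : ℝ} (hx : 0 < x) (t y : ℝ) :
    (D (x + (t + y : ℝ) * I)).re ≤ Real.exp 2 * (1 + |y| / x) ^ 4 * (D (x + t * I)).re := by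
  rcases eq_or_ne y 0 with rfl | hy
  · have h0 : 0 < (D (x + t * I)).re := hV _ (by simpa using hx)
    have : (1 : ℝ) ≤ Real.exp 2 := Real.one_le_exp (by norm_num)
    simp only [add_zero, abs_zero, zero_div, one_pow, mul_one]
    nlinarith
  have hy' : 0 < |y| := abs_pos.2 hy
  have hx' : 0 < x + |y| := by positivity
  have hle : x ≤ x + |y| := by linarith
  have h1 := re_mul_sq_monotone hD hV (t + y) (Set.mem_Ioi.2 hx) (Set.mem_Ioi.2 hx') hle
  have h2 := re_vertical_le hD hV hx' t y
  have h3 := re_div_sq_antitone hD hV t (Set.mem_Ioi.2 hx) (Set.mem_Ioi.2 hx') hle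
  simp only at h1 h3
  have h4 : Real.exp (2 * |y| / (x + |y|)) ≤ Real.exp 2 := by
    apply Real.exp_le_exp.2
    rw [div_le_iff₀ hx']
    nlinarith
  have hp : 0 < (D ((x + |y| : ℝ) + t * I)).re := hV _ (by simpa using hx')
  rw [div_le_div_iff₀ (by positivity) (by positivity)] at h3
  have h5 : (1 + |y| / x) ^ 4 = (x + |y|) ^ 4 / x ^ 4 := by
    rw [← div_pow]; congr 1; field_simp
  rw [h5, ← mul_div_assoc, div_mul_eq_mul_div, le_div_iff₀ (by positivity)]
  calc (D (x + (t + y : ℝ) * I)).re * x ^ 4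
      = ((D (x + (t + y : ℝ) * I)).re * x ^ 2) * x ^ 2 := by ring
    _ ≤ ((D ((x + |y| : ℝ) + (t + y : ℝ) * I)).re * (x + |y|) ^ 2) * x ^ 2 := by gcongr
    _ ≤ ((Real.exp 2 * (D ((x + |y| : ℝ) + t * I)).re) * (x + |y|) ^ 2) * x ^ 2 := by
        gcongr
        exact h2.trans (by gcongr)
    _ = Real.exp 2 * (x + |y|) ^ 2 * ((D ((x + |y| : ℝ) + t * I)).re * x ^ 2) := by ring
    _ ≤ Real.exp 2 * (x + |y|) ^ 2 * ((D (x + t * I)).re * (x + |y|) ^ 2) := by gcongr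
    _ = _ := by ring

theorem norm_deriv_vertical_le {x : ℝ} (hx : 0 < x) (t y : ℝ) :
    ‖deriv D (x + (t + y : ℝ) * I)‖
      ≤ 2 / x * (Real.exp 2 * (1 + |y| / x) ^ 4 * (D (x + t * I)).re) := by
  refine (norm_deriv_le_of_re_pos hD hV (by simpa using hx)).trans ?_
  have h1 := re_harnack hD hV hx t y
  have : ((x : ℂ) + (t + y : ℝ) * I).re = x := by simp
  rw [this]
  calc _ = 2 / x * (D (x + (t + y : ℝ) * I)).re := by ring
    _ ≤ _ := by gcongr

theorem norm_vertical_sub_le {x : ℝ} (hx : 0 < x) (t y : ℝ) :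
    ‖D (x + (t + y : ℝ) * I) - D (x + t * I)‖
      ≤ 2 / x * (Real.exp 2 * (1 + |y| / x) ^ 4 * (D (x + t * I)).re) * |y| := by
  have hp : 0 < (D (x + t * I)).re := hV _ (by simpa using hx)
  have := (convex_Icc (-|y|) |y|).norm_image_sub_le_of_norm_hasDerivWithin_le
    (C := 2 / x * (Real.exp 2 * (1 + |y| / x) ^ 4 * (D (x + t * I)).re))
    (f := fun y : ℝ => D (x + (t + y : ℝ) * I)) (x := 0) (y := y)
    (fun u _ => (hasDerivAt_vertical hD hx t u).hasDerivWithinAt)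
    (fun u hu => ?_) (by simp) (by simpa using ⟨neg_abs_le y, le_abs_self y⟩)
  · simpa using this
  · rw [norm_mul, Complex.norm_I, mul_one]
    refine (norm_deriv_vertical_le hD hV hx t u).trans ?_
    have : |u| ≤ |y| := abs_le.2 hu
    gcongr

/-- First-order Taylor estimate along a vertical line for a function whose vertical derivative is
`-Im D`. -/
theorem vertical_taylor {U : ℂ → ℝ} (hU : ∀ x t : ℝ, 0 < x → ∀ y : ℝ,
      HasDerivAt (fun y : ℝ => U (x + (t + y : ℝ) * I)) (-(D (x + (t + y : ℝ) * I)).im) y)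
    {x : ℝ} (hx : 0 < x) (t y : ℝ) :
    |U (x + (t + y : ℝ) * I) - U (x + t * I) + y * (D (x + t * I)).im|
      ≤ 2 / x * (Real.exp 2 * (1 + |y| / x) ^ 4 * (D (x + t * I)).re) * |y| ^ 2 := by
  have hp : 0 < (D (x + t * I)).re := hV _ (by simpa using hx)
  have := (convex_Icc (-|y|) |y|).norm_image_sub_le_of_norm_hasDerivWithin_le
    (C := 2 / x * (Real.exp 2 * (1 + |y| / x) ^ 4 * (D (x + t * I)).re) * |y|)
    (f := fun y : ℝ => U (x + (t + y : ℝ) * I) + y * (D (x + t * I)).im) (x := 0) (y := y)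
    (fun u _ => ((hU x t hx u).add ((hasDerivAt_id u).mul_const _)).hasDerivWithinAt)
    (fun u hu => ?_) (by simp) (by simpa using ⟨neg_abs_le y, le_abs_self y⟩)
  · simp only [add_zero, Real.norm_eq_abs, sub_zero, zero_mul] at this
    calc _ = _ := ?_
      _ ≤ _ := this
      _ = _ := by ring
    congr 1
    ring
  · have hu' : |u| ≤ |y| := abs_le.2 hu
    rw [one_mul, Real.norm_eq_abs, neg_add_eq_sub, ← Complex.sub_im, ← abs_neg, ← Complex.neg_im, neg_sub]
    refine (Complex.abs_im_le_norm _).trans ?_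
    refine (norm_vertical_sub_le hD hV hx t u).trans ?_
    gcongr

/-- Gain from moving off the boundary. -/
theorem boundary_gain {u : ℝ → ℝ} {x t : ℝ} (hx : 0 < x)
    (hu : ∀ y : ℝ, 0 < y → HasDerivAt u (D (y + t * I)).re y)
    (hc : ContinuousWithinAt u (Set.Ici 0) 0) :
    u 0 ≤ u x - x / 3 * (D (x + t * I)).re := by
  set V := (D (x + t * I)).re with hVdef
  have hd : ∀ y : ℝ, 0 < y → HasDerivAt (fun y => u y - V / x ^ 2 * (y ^ 3 / 3))
      ((D (y + t * I)).re - V / x ^ 2 * (y ^ 2)) y := by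
    intro y hy
    have h1 := (((hasDerivAt_id y).fun_pow 3).div_const 3).const_mul (V / x ^ 2)
    refine ((hu y hy).fun_sub h1).congr_deriv ?_
    simp
  have hmono : MonotoneOn (fun y => u y - V / x ^ 2 * (y ^ 3 / 3)) (Set.Icc 0 x) := by
    refine monotoneOn_of_deriv_nonneg (convex_Icc 0 x) ?_ ?_ ?_
    · intro y hy
      rcases hy.1.eq_or_lt with rfl | h0
      · exact (hc.mono Set.Icc_subset_Ici_self).sub (by fun_prop)
      · exact (hd y h0).continuousAt.continuousWithinAt
    · rw [interior_Icc]
      exact fun y hy => (hd y hy.1).differentiableAt.differentiableWithinAt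
    · rw [interior_Icc]
      intro y hy
      rw [(hd y hy.1).deriv]
      have h1 := re_div_sq_antitone hD hV t (Set.mem_Ioi.2 hy.1) (Set.mem_Ioi.2 hx) hy.2.le
      simp only at h1
      have hy0 : 0 < y := hy.1
      rw [le_div_iff₀ (by positivity)] at h1
      linarith
  have := hmono (Set.left_mem_Icc.2 hx.le) (Set.right_mem_Icc.2 hx.le) hx.le
  simp only at this
  have h2 : V / x ^ 2 * (x ^ 3 / 3) = x / 3 * V := by field_simp
  rw [h2] at this
  simpa using this

end Harnack

/-- A smooth even cutoff `φ` supported in `[-1, 1]` with `φ 0 = 1`, together with its (real, rapidly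
decreasing) inverse Fourier transform `h`. -/
structure IsKernelPair (φ h : ℝ → ℝ) : Prop where
  contDiff : ContDiff ℝ 1 φ
  zero : φ 0 = 1
  nonneg : ∀ v, 0 ≤ φ v
  le_one : ∀ v, φ v ≤ 1
  support : ∀ v, 1 ≤ |v| → φ v = 0
  continuous : Continuous h
  even : ∀ y, h (-y) = h y
  decay : ∀ n : ℕ, ∃ C, ∀ y, (1 + |y|) ^ n * |h y| ≤ C
  fourier : ∀ v : ℝ, ∫ y : ℝ, (h y : ℂ) * cexp (-(2 * π * y * v : ℝ) * I) = φ v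

open scoped FourierTransform in
theorem exists_isKernelPair : ∃ φ h : ℝ → ℝ, IsKernelPair φ h := by
  let b : ContDiffBump (0 : ℝ) := ⟨1 / 2, 1, by norm_num, by norm_num⟩
  have hsmooth : ContDiff ℝ ((⊤ : ℕ∞) : WithTop ℕ∞) (fun v : ℝ => (b v : ℂ)) :=
    Complex.ofRealCLM.contDiff.comp b.contDiff
  have hcomp : HasCompactSupport (fun v : ℝ => (b v : ℂ)) :=
    b.hasCompactSupport.comp_left (g := ((↑) : ℝ → ℂ)) Complex.ofReal_zero
  let Φ : SchwartzMap ℝ ℂ := hcomp.toSchwartzMap hsmooth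
  have hΦ : ∀ v, Φ v = b v := fun v => rfl
  let H : SchwartzMap ℝ ℂ := 𝓕⁻ Φ
  have hH : ∀ y : ℝ, H y = ∫ v : ℝ, cexp ((2 * π * (v * y) : ℝ) * I) * (b v : ℂ) := by
    intro y
    have : H y = 𝓕⁻ (Φ : ℝ → ℂ) y := by
      simp only [H, SchwartzMap.fourierInv_coe]
    rw [this, Real.fourierInv_eq']
    simp only [hΦ, smul_eq_mul]
    congr 1
    ext v
    simp only [RCLike.inner_apply, conj_trivial]
    rw [mul_comm y v]
  have hHeven : ∀ y, H (-y) = H y := by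
    intro y
    rw [hH, hH, ← MeasureTheory.integral_neg_eq_self]
    congr 1
    ext v
    rw [b.neg]
    simp
  have hHconj : ∀ y, (starRingEnd ℂ) (H y) = H y := by
    intro y
    conv_rhs => rw [← hHeven]
    rw [hH, hH, ← integral_conj]
    congr 1
    ext v
    rw [map_mul, Complex.conj_ofReal, ← Complex.exp_conj, map_mul, Complex.conj_ofReal,
      Complex.conj_I]
    simp
  have hHre : ∀ y, ((H y).re : ℂ) = H y := fun y => Complex.conj_eq_iff_re.1 (hHconj y)
  refine ⟨b, fun y => (H y).re, b.contDiff, ?_, fun v => b.nonneg, fun v => b.le_one, ?_, ?_, ?_,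
    ?_, ?_⟩
  · exact b.one_of_mem_closedBall (by simp [b])
  · intro v hv
    exact b.zero_of_le_dist (by simpa [b] using hv)
  · exact Complex.continuous_re.comp H.continuous
  · intro y
    simp only [hHeven]
  · intro n
    refine ⟨2 ^ n * ((Finset.Iic (n, 0)).sup fun m => SchwartzMap.seminorm ℂ m.1 m.2) H,
      fun y => ?_⟩
    have := SchwartzMap.one_add_le_sup_seminorm_apply (𝕜 := ℂ) (m := (n, 0)) (k := n) (n := 0)
      le_rfl le_rfl H y
    rw [norm_iteratedFDeriv_zero] at this
    refine le_trans ?_ this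
    exact mul_le_mul_of_nonneg_left (Complex.abs_re_le_norm _) (by positivity)
  · intro v
    have h1 : 𝓕 H = Φ := FourierTransform.fourier_fourierInv_eq Φ
    have h2 : 𝓕 (H : ℝ → ℂ) v = Φ v := by
      rw [← h1, SchwartzMap.fourier_coe]
    rw [Real.fourier_real_eq_integral_exp_smul, hΦ] at h2
    simp only [hHre]
    rw [← h2]
    congr 1
    ext y
    rw [smul_eq_mul, mul_comm]
    congr 2
    push_cast
    ring

namespace IsKernelPair

variable {φ h : ℝ → ℝ} (hK : IsKernelPair φ h)
include hK

theorem integrable_pow_mul (n : ℕ) : Integrable (fun y => (1 + |y|) ^ n * |h y|) := by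
  obtain ⟨C, hC⟩ := hK.decay (n + 2)
  have h1 : Integrable (fun y : ℝ => C * (1 + ‖y‖) ^ (-2 : ℝ)) :=
    (integrable_one_add_norm (by simp)).const_mul C
  refine h1.mono' ?_ (Eventually.of_forall fun y => ?_)
  · have := hK.continuous
    exact (by fun_prop : Continuous fun y => (1 + |y|) ^ n * |h y|).aestronglyMeasurable
  · have hp : 0 < 1 + |y| := by positivity
    rw [Real.norm_eq_abs, abs_of_nonneg (by positivity), Real.norm_eq_abs, Real.rpow_neg hp.le,
      Real.rpow_two, ← div_eq_mul_inv, le_div_iff₀ (by positivity)]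
    calc _ = (1 + |y|) ^ (n + 2) * |h y| := by ring
      _ ≤ C := hC y

theorem integrable_mul {f : ℝ → ℂ} (hf : Continuous f) {C : ℝ} {n : ℕ}
    (hC : ∀ y, ‖f y‖ ≤ C * (1 + |y|) ^ n) : Integrable (fun y => (h y : ℂ) * f y) := by
  refine ((hK.integrable_pow_mul n).const_mul C).mono' ?_ (Eventually.of_forall fun y => ?_)
  · have := hK.continuous
    exact (by fun_prop : Continuous fun y => (h y : ℂ) * f y).aestronglyMeasurable
  · rw [norm_mul, Complex.norm_real, Real.norm_eq_abs]
    calc |h y| * ‖f y‖ ≤ |h y| * (C * (1 + |y|) ^ n) := by gcongr; exact hC y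
      _ = _ := by ring

theorem integrable_mul_real {f : ℝ → ℝ} (hf : Continuous f) {C : ℝ} {n : ℕ}
    (hC : ∀ y, |f y| ≤ C * (1 + |y|) ^ n) : Integrable (fun y => h y * f y) := by
  have := (hK.integrable_mul (f := fun y => (f y : ℂ)) (by fun_prop) (C := C) (n := n)
    (fun y => by simpa using hC y)).re
  simpa using this

theorem abs_integral_mul_le {f : ℝ → ℝ} {C : ℝ} {n : ℕ} (hC : ∀ y, |f y| ≤ C * (1 + |y|) ^ n) :
    |∫ y, h y * f y| ≤ C * ∫ y, (1 + |y|) ^ n * |h y| := by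
  rw [← integral_const_mul, ← Real.norm_eq_abs]
  refine norm_integral_le_of_norm_le ((hK.integrable_pow_mul n).const_mul C)
    (Eventually.of_forall fun y => ?_)
  rw [norm_mul, Real.norm_eq_abs, Real.norm_eq_abs]
  calc |h y| * |f y| ≤ |h y| * (C * (1 + |y|) ^ n) := by gcongr; exact hC y
    _ = _ := by ring

theorem integrable : Integrable h := by
  simpa using hK.integrable_mul_real (f := fun _ => 1) continuous_const (C := 1) (n := 0) (by simp)

theorem integrable_mul_id : Integrable (fun y => h y * y) :=
  hK.integrable_mul_real (f := fun y => y) continuous_id (C := 1) (n := 1)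
    (fun y => by rw [one_mul, pow_one]; linarith)

theorem integral_eq_one : ∫ y, h y = 1 := by
  have := hK.fourier 0
  simp only [mul_zero, Complex.ofReal_zero, neg_zero, zero_mul, Complex.exp_zero, mul_one,
    hK.zero] at this
  rw [integral_complex_ofReal] at this
  exact_mod_cast this

theorem integral_mul_id : ∫ y, h y * y = 0 := by
  have := MeasureTheory.integral_neg_eq_self (fun y => h y * y) volume
  simp only [hK.even, mul_neg, integral_neg] at this
  linarith

/-- Smoothing inequality: the boundary value of `U` is bounded by a smoothed average of `U` inside the
half-plane, where `U` is harmonic with horizontal derivative `Re D > 0`. -/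
theorem exists_smoothing : ∃ A : ℝ, 1 ≤ A ∧ ∀ (D : ℂ → ℂ) (U : ℂ → ℝ) (t κ : ℝ), 0 < κ →
    DifferentiableOn ℂ D {z | 0 < z.re} → (∀ z, 0 < z.re → 0 < (D z).re) →
    (∀ x t : ℝ, 0 < x → ∀ y : ℝ,
      HasDerivAt (fun y : ℝ => U (x + (t + y : ℝ) * I)) (-(D (x + (t + y : ℝ) * I)).im) y) →
    (∀ x : ℝ, 0 < x → HasDerivAt (fun x : ℝ => U (x + t * I)) (D (x + t * I)).re x) →
    ContinuousWithinAt (fun x : ℝ => U (x + t * I)) (Set.Ici 0) 0 →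
    Integrable (fun y => h y * U ((A * κ : ℝ) + (t + κ * y : ℝ) * I)) ∧
    U (t * I) ≤ ∫ y, h y * U ((A * κ : ℝ) + (t + κ * y : ℝ) * I) := by
  set B := ∫ y, (1 + |y|) ^ 6 * |h y| with hB
  have hB0 : 0 ≤ B := integral_nonneg fun y => by positivity
  refine ⟨1 + 6 * Real.exp 2 * B, by nlinarith [Real.exp_pos 2, mul_nonneg (Real.exp_pos 2).le hB0],
    ?_⟩
  set A := 1 + 6 * Real.exp 2 * B with hA
  have hA1 : 1 ≤ A := by nlinarith [Real.exp_pos 2, mul_nonneg (Real.exp_pos 2).le hB0]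
  intro D U t κ hκ hD hV hUv hUh hUc
  set x := A * κ with hx
  have hxpos : 0 < x := by positivity
  have hκx : κ ≤ x := by nlinarith
  set V := (D (x + t * I)).re with hVdef
  have hV0 : 0 < V := hV _ (by simpa using hxpos)
  set E : ℝ → ℝ := fun y =>
    U (x + (t + κ * y : ℝ) * I) - U (x + t * I) + κ * y * (D (x + t * I)).im with hE
  have hEb : ∀ y, |E y| ≤ 2 * κ ^ 2 / x * Real.exp 2 * V * (1 + |y|) ^ 6 := by
    intro y
    refine (vertical_taylor hD hV hUv hxpos t (κ * y)).trans ?_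
    rw [abs_mul, abs_of_pos hκ]
    have h1 : κ * |y| / x ≤ |y| := by
      rw [div_le_iff₀ hxpos]
      nlinarith [abs_nonneg y]
    have h2 : |y| ≤ 1 + |y| := by linarith
    calc 2 / x * (Real.exp 2 * (1 + κ * |y| / x) ^ 4 * V) * (κ * |y|) ^ 2
        ≤ 2 / x * (Real.exp 2 * (1 + |y|) ^ 4 * V) * (κ * (1 + |y|)) ^ 2 := by gcongr
      _ = _ := by ring
  have hUcont : Continuous fun y : ℝ => U (x + (t + κ * y : ℝ) * I) := by
    have h1 : Continuous fun y : ℝ => U (x + (t + y : ℝ) * I) :=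
      continuous_iff_continuousAt.2 fun y => (hUv x t hxpos y).continuousAt
    exact h1.comp (continuous_const.mul continuous_id)
  have hEcont : Continuous E := by
    exact (hUcont.sub continuous_const).add (by fun_prop)
  have hEint := hK.integrable_mul_real hEcont hEb
  have hEI := (abs_le.1 (hK.abs_integral_mul_le hEb)).1
  have heq : (fun y => h y * U (x + (t + κ * y : ℝ) * I))
      = fun y => h y * E y + (h y * U (x + t * I) - κ * (D (x + t * I)).im * (h y * y)) := by
    ext y
    simp only [hE]
    ring
  have hi1 := hK.integrable.mul_const (U (x + t * I))
  have hi2 := hK.integrable_mul_id.const_mul (κ * (D (x + t * I)).im)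
  have hi3 : Integrable (fun y => h y * U (x + t * I) - κ * (D (x + t * I)).im * (h y * y)) :=
    hi1.sub hi2
  rw [heq]
  refine ⟨hEint.add hi3, ?_⟩
  rw [integral_add hEint hi3, integral_sub hi1 hi2, integral_mul_const,
    integral_const_mul, hK.integral_eq_one, hK.integral_mul_id]
  have hgain := boundary_gain hD hV hxpos hUh hUc
  simp only [Complex.ofReal_zero, zero_add] at hgain
  have hfin : 2 * κ ^ 2 / x * Real.exp 2 * V * B ≤ x / 3 * V := by
    have h1 : 6 * Real.exp 2 * B ≤ A * A := by nlinarith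
    have h2 : 2 * κ ^ 2 / x * Real.exp 2 * V * B = (6 * Real.exp 2 * B) * (κ ^ 2 / (3 * x) * V) := by
      field_simp
      ring
    have h3 : x / 3 * V = (A * A) * (κ ^ 2 / (3 * x) * V) := by
      rw [hx]
      field_simp
    rw [h2, h3]
    gcongr
  rw [← hB] at hEI
  linarith

end IsKernelPair

/-- Under quadratic growth, a lower bound far to the right and no zeros with `Re s > 1/2`, the
logarithmic derivative has real part bounded below by a multiple of a logarithm. -/
theorem exists_re_logDeriv_add_pos {f : ℂ → ℂ} (hf : Differentiable ℂ f) {C c : ℝ} (hC : 1 ≤ C)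
    (hc : 0 < c) (hc1 : c ≤ 1) (hup : ∀ s : ℂ, 1 / 8 ≤ s.re → ‖f s‖ ≤ C * (‖s‖ + 10) ^ 2)
    (hlow : ∀ s : ℂ, 2 ≤ s.re → c ≤ ‖f s‖) (hne : ∀ s : ℂ, 1 / 2 < s.re → f s ≠ 0) :
    ∃ C₀ : ℝ, 0 < C₀ ∧ ∀ w : ℂ, 0 < w.re →
      0 < (deriv f (1 / 2 + w) / f (1 / 2 + w)).re + C₀ * Real.log ‖w + 10‖ := by
  set K := Real.log (4 * C / c) + 2 with hK
  have hCc : 1 < 4 * C / c := by rw [lt_div_iff₀ hc]; linarith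
  have hK2 : 2 < K := by have := Real.log_pos hCc; linarith
  have hlogN : ∀ s : ℂ, 1 ≤ Real.log (‖s‖ + 10) := by
    intro s
    rw [Real.le_log_iff_exp_le (by positivity)]
    have := Real.exp_one_lt_d9
    have := norm_nonneg s
    linarith
  set M : ℂ → ℝ := fun s => 4 * C / c * (‖s‖ + 10) ^ 2 with hM
  have hM1 : ∀ s, 1 < M s := by
    intro s
    have h1 : 1 ≤ (‖s‖ + 10) ^ 2 := by nlinarith [norm_nonneg s]
    simp only [hM]
    nlinarith
  have hlogM : ∀ s, Real.log (M s) ≤ K * Real.log (‖s‖ + 10) := by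
    intro s
    simp only [hM]
    rw [Real.log_mul (by linarith) (by positivity), Real.log_pow]
    have := hlogN s
    have := Real.log_pos hCc
    push_cast
    nlinarith
  have hnear : ∀ s z : ℂ, ‖z - s‖ ≤ 10 → 1 / 8 ≤ z.re → ‖f z‖ ≤ M s * c := by
    intro s z hz hz8
    refine (hup z hz8).trans ?_
    have h1 : ‖z‖ ≤ ‖z - s‖ + ‖s‖ := by
      calc ‖z‖ = ‖(z - s) + s‖ := by ring_nf
        _ ≤ _ := norm_add_le _ _
    have h2 : ‖z‖ + 10 ≤ 2 * (‖s‖ + 10) := by linarith [norm_nonneg s]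
    calc C * (‖z‖ + 10) ^ 2 ≤ C * (2 * (‖s‖ + 10)) ^ 2 := by gcongr
      _ = M s * c := by simp only [hM]; field_simp; ring
  have hright : ∀ u s : ℂ, ‖s - u‖ ≤ 1 → 9 / 16 ≤ s.re →
      c * Real.exp (-(46 * Real.log (M u))) ≤ ‖f s‖ ∧
      ‖deriv f s / f s‖ ≤ 3008 * Real.log (M u) := by
    intro u s hu hs
    set c₀ : ℂ := (max s.re 2 : ℝ) + s.im * I with hc₀
    have hsc : s - c₀ = ((s.re - max s.re 2 : ℝ) : ℂ) := by
      apply Complex.ext <;> simp [hc₀]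
    have hsc' : ‖s - c₀‖ ≤ 23 / 16 := by
      rw [hsc, Complex.norm_real, Real.norm_eq_abs, abs_le]
      constructor
      · rcases max_cases s.re 2 with h | h <;> linarith
      · linarith [le_max_left s.re 2]
    have hc₀re : 2 ≤ c₀.re := by simp [hc₀]
    have hball : ∀ z ∈ Metric.ball c₀ (3 / 2), 1 / 2 < z.re ∧ ‖z - u‖ ≤ 10 := by
      intro z hz
      have hz' : ‖z - c₀‖ < 3 / 2 := by simpa [dist_eq_norm] using hz
      constructor
      · have := (abs_le.1 (Complex.abs_re_le_norm (z - c₀))).1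
        simp only [Complex.sub_re] at this
        linarith
      · calc ‖z - u‖ = ‖(z - c₀) - (s - c₀) + (s - u)‖ := by ring_nf
          _ ≤ ‖z - c₀‖ + ‖s - c₀‖ + ‖s - u‖ :=
            (norm_add_le _ _).trans (by gcongr; exact norm_sub_le _ _)
          _ ≤ 10 := by linarith
    have := log_bounds_of_ne_zero_on_ball (g := f) (c := c₀) (r := 23 / 16) (R := 3 / 2)
      (M := M u) (by norm_num) (by norm_num) (hM1 u) hf.differentiableOn
      (fun z hz => hne z (hball z hz).1)
      (fun z hz => (hnear u z (hball z hz).2 (by linarith [(hball z hz).1])).trans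
        (mul_le_mul_of_nonneg_left (hlow _ hc₀re) (by linarith [hM1 u])))
      (z := s) (by simpa [dist_eq_norm] using hsc')
    refine ⟨?_, ?_⟩
    · refine le_trans ?_ this.1
      norm_num
      gcongr
      exact hlow _ hc₀re
    · refine this.2.trans (le_of_eq ?_)
      norm_num
  have hleft : ∀ s : ℂ, 1 / 2 < s.re → s.re ≤ 9 / 16 →
      -(112 / (1 / 8) * (47 * Real.log (M s))) ≤ (deriv f s / f s).re := by
    intro s hs hs'
    set c₀ : ℂ := (9 / 16 : ℝ) + s.im * I with hc₀
    have hc₀re : c₀.re = 9 / 16 := by simp [hc₀]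
    have hsc : s - c₀ = ((s.re - 9 / 16 : ℝ) : ℂ) := by
      apply Complex.ext <;> simp [hc₀]
    have hsc' : ‖s - c₀‖ ≤ 3 / 4 * (1 / 8) := by
      rw [hsc, Complex.norm_real, Real.norm_eq_abs, abs_le]
      constructor <;> linarith
    have hlow' := (hright s c₀ (by rw [norm_sub_rev]; linarith) hc₀re.ge).1
    have hMpos : 0 < M s := by linarith [hM1 s]
    have hpow : M s * c = M s ^ 47 * (c * Real.exp (-(46 * Real.log (M s)))) := by
      rw [Real.exp_neg, mul_comm 46, Real.exp_mul, Real.exp_log hMpos]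
      have : M s ^ (46 : ℝ) = M s ^ 46 := by exact_mod_cast Real.rpow_natCast (M s) 46
      rw [this]
      field_simp
    have hlp : 47 * Real.log (M s) = Real.log (M s ^ 47) := by
      rw [Real.log_pow]; norm_num
    rw [hlp]
    refine re_logDeriv_ge (c := c₀) (a := 1 / 2) (by norm_num)
      (one_lt_pow₀ (hM1 s) (by norm_num)) hf.differentiableOn (hne _ (by rw [hc₀re]; norm_num))
      ?_ ?_ (by simpa [dist_eq_norm] using hsc') hs
    · intro z hz
      have hz' : ‖z - c₀‖ < 3 * (1 / 8) := by simpa [dist_eq_norm] using hz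
      have h1 := (abs_le.1 (Complex.abs_re_le_norm (z - c₀))).1
      simp only [Complex.sub_re] at h1
      refine (hnear s z ?_ (by linarith)).trans ?_
      · calc ‖z - s‖ = ‖(z - c₀) - (s - c₀)‖ := by ring_nf
          _ ≤ ‖z - c₀‖ + ‖s - c₀‖ := norm_sub_le _ _
          _ ≤ 10 := by linarith
      · rw [hpow]
        gcongr
    · intro z _ hz0
      by_contra h
      exact hne z (by linarith) hz0
  refine ⟨2 * (896 * 47 * K) + 1, by positivity, fun w hw => ?_⟩
  set s : ℂ := 1 / 2 + w with hs
  have hsre : s.re = 1 / 2 + w.re := by simp [hs]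
  have hw10 : 10 ≤ ‖w + 10‖ := by
    refine le_trans ?_ (Complex.re_le_norm _)
    simp
    exact hw.le
  have hlog10 : 0 < Real.log ‖w + 10‖ := Real.log_pos (by linarith)
  have hww : ‖w‖ ≤ ‖w + 10‖ := by
    rw [Complex.norm_eq_sqrt_sq_add_sq, Complex.norm_eq_sqrt_sq_add_sq]
    apply Real.sqrt_le_sqrt
    simp
    nlinarith
  have hNw : Real.log (‖s‖ + 10) ≤ 2 * Real.log ‖w + 10‖ := by
    rw [← Nat.cast_two, ← Real.log_pow]
    apply Real.log_le_log (by positivity)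
    have : ‖s‖ ≤ 1 / 2 + ‖w‖ := by
      refine (norm_add_le _ _).trans ?_
      norm_num
    nlinarith
  have hbound : -(896 * 47 * Real.log (M s)) ≤ (deriv f s / f s).re := by
    rcases le_total s.re (9 / 16) with h | h
    · refine le_trans (le_of_eq ?_) (hleft s (by linarith) h)
      ring
    · have h1 := (hright s s (by simp) h).2
      have h2 := (abs_le.1 (Complex.abs_re_le_norm (deriv f s / f s))).1
      have := Real.log_pos (hM1 s)
      linarith
  have h3 := hlogM s
  have h4 : 896 * 47 * Real.log (M s) ≤ 2 * (896 * 47 * K) * Real.log ‖w + 10‖ := by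
    calc 896 * 47 * Real.log (M s) ≤ 896 * 47 * (K * (2 * Real.log ‖w + 10‖)) := by
          gcongr
          exact h3.trans (by gcongr)
      _ = _ := by ring
  linarith

/-- The entire function `(s - 1)^δ L(s, χ)` with `δ = 1` for the trivial character and `δ = 0`
otherwise. -/
noncomputable def regL {q : ℕ} [NeZero q] (χ : DirichletCharacter ℂ q) (s : ℂ) : ℂ :=
  if χ = 1 then DirichletCharacter.LFunctionTrivChar₁ q s else DirichletCharacter.LFunction χ s

section RegL

variable {q : ℕ} [NeZero q] (χ : DirichletCharacter ℂ q)

theorem regL_differentiable : Differentiable ℂ (regL χ) := by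
  unfold regL
  split_ifs with h
  · exact DirichletCharacter.differentiable_LFunctionTrivChar₁ q
  · exact DirichletCharacter.differentiable_LFunction h

theorem regL_eq {s : ℂ} (hs : s ≠ 1) :
    regL χ s = (if χ = 1 then s - 1 else 1) * DirichletCharacter.LFunction χ s := by
  unfold regL
  split_ifs with h
  · subst h
    simp [DirichletCharacter.LFunctionTrivChar₁, Function.update_of_ne hs,
      DirichletCharacter.LFunctionTrivChar]
  · simp

/-- The mean value of `χ` over a period. -/
noncomputable def charMean : ℂ := (∑ k ∈ range q, χ (k : ZMod q)) / q

omit [NeZero q] in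
theorem sum_period (n : ℕ) :
    ∑ k ∈ range q, χ ((n + k : ℕ) : ZMod q) = ∑ k ∈ range q, χ (k : ZMod q) := by
  induction n with
  | zero => simp
  | succ n ih =>
    rw [← ih]
    have h1 := Finset.sum_range_succ (fun k => χ ((n + k : ℕ) : ZMod q)) q
    have h2 := Finset.sum_range_succ' (fun k => χ ((n + k : ℕ) : ZMod q)) q
    have h3 : χ ((n + q : ℕ) : ZMod q) = χ ((n + 0 : ℕ) : ZMod q) := by simp
    rw [h1, h3] at h2
    rw [add_right_cancel h2]
    refine Finset.sum_congr rfl fun k _ => ?_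
    congr 2
    ring

theorem charMean_eq_zero (h : χ ≠ 1) : charMean χ = 0 := by
  have h1 : ∑ k ∈ range q, χ (k : ZMod q) = ∑ a : ZMod q, χ a := by
    refine Finset.sum_nbij' (fun k => (k : ZMod q)) ZMod.val (by simp) ?_ ?_ (by simp) (by simp)
    · intro a _
      simpa using ZMod.val_lt a
    · intro k hk
      exact ZMod.val_cast_of_lt (by simpa using hk)
  rw [charMean, h1, MulChar.sum_eq_zero_of_ne_one h, zero_div]

theorem norm_charMean_le : ‖charMean χ‖ ≤ 1 := by
  have hq : (0 : ℝ) < q := by exact_mod_cast Nat.pos_of_ne_zero (NeZero.ne q)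
  rw [charMean, norm_div, Complex.norm_natCast, div_le_one hq]
  refine (norm_sum_le _ _).trans ?_
  refine (Finset.sum_le_sum fun k _ => χ.norm_le_one _).trans ?_
  simp

theorem norm_sum_sub_charMean_le (n : ℕ) :
    ‖∑ k ∈ Icc 1 n, χ (k : ZMod q) - charMean χ * n‖ ≤ 2 * q := by
  induction n using Nat.strong_induction_on with
  | _ n ih =>
    rcases lt_or_ge n q with h | h
    · have h1 : ‖∑ k ∈ Icc 1 n, χ (k : ZMod q)‖ ≤ n := by
        refine (norm_sum_le _ _).trans ((Finset.sum_le_sum fun k _ => χ.norm_le_one _).trans ?_)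
        simp
      have h2 : ‖charMean χ * n‖ ≤ n := by
        rw [norm_mul, Complex.norm_natCast]
        exact mul_le_of_le_one_left (by positivity) (norm_charMean_le χ)
      have h3 : (n : ℝ) ≤ q := by exact_mod_cast h.le
      exact (norm_sub_le _ _).trans (by linarith)
    · obtain ⟨m, rfl⟩ := Nat.exists_eq_add_of_le' h
      have hq : q ≠ 0 := NeZero.ne q
      have h1 := ih m (by omega)
      have h2 : ∑ k ∈ Icc 1 (m + q), χ (k : ZMod q)
          = ∑ k ∈ Icc 1 m, χ (k : ZMod q) + charMean χ * q := by
        have e : ∀ n : ℕ, ∑ k ∈ Icc 1 n, χ (k : ZMod q)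
            = ∑ k ∈ range n, χ ((1 + k : ℕ) : ZMod q) := by
          intro n
          induction n with
          | zero => simp
          | succ n ih => rw [Finset.sum_Icc_succ_top (by omega), ih, Finset.sum_range_succ, add_comm n]
        rw [e, e, Finset.sum_range_add]
        congr 1
        rw [charMean, div_mul_cancel₀ _ (by exact_mod_cast hq), ← sum_period χ (1 + m)]
        simp only [add_assoc]
      rw [h2]
      refine le_trans (le_of_eq ?_) h1
      congr 1
      push_cast
      ring

/-- The bounded remainder in the summatory function of `χ`. -/
noncomputable def charRem (t : ℝ) : ℂ := ∑ k ∈ Icc 1 ⌊t⌋₊, χ (k : ZMod q) - charMean χ * t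

theorem norm_charRem_le {t : ℝ} (ht : 0 ≤ t) : ‖charRem χ t‖ ≤ 2 * q + 1 := by
  have h1 : charRem χ t = (∑ k ∈ Icc 1 ⌊t⌋₊, χ (k : ZMod q) - charMean χ * ⌊t⌋₊)
      + charMean χ * ((⌊t⌋₊ - t : ℝ) : ℂ) := by
    rw [charRem]; push_cast; ring
  rw [h1]
  refine (norm_add_le _ _).trans (add_le_add (norm_sum_sub_charMean_le χ _) ?_)
  rw [norm_mul, Complex.norm_real, Real.norm_eq_abs]
  refine mul_le_one₀ (norm_charMean_le χ) (abs_nonneg _) ?_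
  rw [abs_le]
  constructor <;> linarith [Nat.floor_le ht, Nat.lt_floor_add_one t]

omit [NeZero q] in
theorem measurable_charRem : Measurable (charRem χ) := by
  unfold charRem
  have h1 : Measurable fun t : ℝ => ∑ k ∈ Icc 1 ⌊t⌋₊, χ (k : ZMod q) :=
    (measurable_from_top (f := fun n : ℕ => ∑ k ∈ Icc 1 n, χ (k : ZMod q))).comp Nat.measurable_floor
  exact h1.sub (by fun_prop)

/-- `∫_1^∞ R(t) t^{-s-1} dt` where `R` is the remainder in the summatory function of `χ`. -/
noncomputable def charInt (s : ℂ) : ℂ := ∫ t : ℝ in Set.Ioi 1, charRem χ t * (t : ℂ) ^ (-(s + 1))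

theorem integrableOn_charRem {s : ℂ} (hs : 0 < s.re) :
    IntegrableOn (fun t : ℝ => charRem χ t * (t : ℂ) ^ (-(s + 1))) (Set.Ioi 1) := by
  have h1 : IntegrableOn (fun t : ℝ => (t : ℂ) ^ (-(s + 1))) (Set.Ioi 1) :=
    integrableOn_Ioi_cpow_of_lt (by simp; linarith) one_pos
  refine Integrable.bdd_mul (c := 2 * q + 1) h1 (measurable_charRem χ).aestronglyMeasurable ?_
  filter_upwards [ae_restrict_mem measurableSet_Ioi] with t ht
  exact norm_charRem_le χ (by have : (1 : ℝ) < t := ht; linarith)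

theorem norm_charInt_le {s : ℂ} (hs : 0 < s.re) : ‖charInt χ s‖ ≤ (2 * q + 1) / s.re := by
  have h1 : IntegrableOn (fun t : ℝ => (2 * q + 1) * t ^ (-(s.re + 1))) (Set.Ioi 1) :=
    (integrableOn_Ioi_rpow_of_lt (by linarith) one_pos).const_mul _
  have := norm_integral_le_of_norm_le h1 (f := fun t : ℝ => charRem χ t * (t : ℂ) ^ (-(s + 1))) ?_
  · refine this.trans (le_of_eq ?_)
    rw [integral_const_mul, integral_Ioi_rpow_of_lt (by linarith) one_pos]
    simp only [Real.one_rpow]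
    have : -(s.re + 1) + 1 = - s.re := by ring
    rw [this]
    field_simp
  · filter_upwards [ae_restrict_mem measurableSet_Ioi] with t ht
    have ht : (1 : ℝ) < t := ht
    rw [norm_mul, Complex.norm_cpow_eq_rpow_re_of_pos (by linarith)]
    simp only [Complex.neg_re, Complex.add_re, Complex.one_re]
    gcongr
    exact norm_charRem_le χ (by linarith)

theorem charInt_differentiableAt {s : ℂ} (hs : 0 < s.re) : DifferentiableAt ℂ (charInt χ) s := by
  set g : ℝ → ℂ := (Set.Ioi (1 : ℝ)).indicator (charRem χ) with hg
  have hgm : Measurable g := (measurable_charRem χ).indicator measurableSet_Ioi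
  have hgb : ∀ t, ‖g t‖ ≤ 2 * q + 1 := by
    intro t
    by_cases h : t ∈ Set.Ioi (1 : ℝ)
    · rw [hg, Set.indicator_of_mem h]
      exact norm_charRem_le χ (by have : (1 : ℝ) < t := h; linarith)
    · rw [hg, Set.indicator_of_notMem h, norm_zero]
      positivity
  have heq : charInt χ = fun s => mellin g (-s) := by
    ext s
    rw [charInt, mellin]
    have : (fun t : ℝ => (t : ℂ) ^ (-s - 1) • g t)
        = (Set.Ioi (1 : ℝ)).indicator fun t : ℝ => charRem χ t * (t : ℂ) ^ (-(s + 1)) := by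
      ext t
      by_cases h : t ∈ Set.Ioi (1 : ℝ)
      · rw [hg, Set.indicator_of_mem h, Set.indicator_of_mem h, smul_eq_mul, mul_comm]
        congr 2
        ring
      · rw [hg, Set.indicator_of_notMem h, Set.indicator_of_notMem h, smul_zero]
    rw [this, setIntegral_indicator measurableSet_Ioi]
    congr 2
    ext t
    simp only [Set.mem_inter_iff, Set.mem_Ioi]
    constructor
    · intro h; exact ⟨by linarith, h⟩
    · exact fun h => h.2
  rw [heq]
  have hd : DifferentiableAt ℂ (mellin g) (-s) := by
    refine mellin_differentiableAt_of_isBigO_rpow (a := 0) (b := (-s).re - 1) ?_ ?_ (by simpa) ?_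
      (by linarith)
    · refine LocallyIntegrable.locallyIntegrableOn ?_ _
      refine (locallyIntegrable_const ((2 * q + 1 : ℝ))).mono hgm.aestronglyMeasurable
        (Eventually.of_forall fun t => ?_)
      rw [Real.norm_of_nonneg (by positivity)]
      exact hgb t
    · refine Asymptotics.IsBigO.of_bound (2 * q + 1) (Eventually.of_forall fun t => ?_)
      simpa using hgb t
    · refine Asymptotics.IsBigO.of_bound 1 ?_
      filter_upwards [nhdsWithin_le_nhds (gt_mem_nhds one_pos)] with t ht
      rw [hg, Set.indicator_of_notMem (by simp; linarith), norm_zero]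
      positivity
  exact hd.comp s differentiableAt_id.neg

theorem LSeries_eq_charInt {s : ℂ} (hs : 1 < s.re) :
    DirichletCharacter.LFunction χ s = s * (charInt χ s + charMean χ / (s - 1)) := by
  rw [DirichletCharacter.LFunction_eq_LSeries χ hs,
    LSeries_eq_mul_integral (fun n => χ (n : ZMod q)) zero_le_one hs
      (χ.LSeriesSummable_of_one_lt_re hs) ?_]
  · congr 1
    have h2 : IntegrableOn (fun t : ℝ => charMean χ * (t : ℂ) ^ (-s)) (Set.Ioi 1) :=
      (integrableOn_Ioi_cpow_of_lt (by simp; linarith) one_pos).const_mul _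
    have h3 : charMean χ / (s - 1) = ∫ t : ℝ in Set.Ioi 1, charMean χ * (t : ℂ) ^ (-s) := by
      rw [integral_const_mul, integral_Ioi_cpow_of_lt (by simp; linarith) one_pos]
      simp only [Complex.ofReal_one, Complex.one_cpow]
      have : -s + 1 = -(s - 1) := by ring
      rw [this, neg_div_neg_eq, mul_one_div]
    rw [h3, charInt, ← integral_add (integrableOn_charRem χ (by linarith)) h2]
    refine setIntegral_congr_fun measurableSet_Ioi fun t ht => ?_
    have ht : (1 : ℝ) < t := ht
    have ht0 : (t : ℂ) ≠ 0 := by exact_mod_cast (by linarith : t ≠ 0)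
    have : (t : ℂ) ^ (-s) = t * (t : ℂ) ^ (-(s + 1)) := by
      rw [show -s = 1 + -(s + 1) by ring, Complex.cpow_add _ _ ht0, Complex.cpow_one]
    simp only [this, charRem]
    ring
  · refine Asymptotics.IsBigO.of_bound 1 (Eventually.of_forall fun n => ?_)
    simp only [Real.rpow_one, one_mul]
    refine (norm_sum_le _ _).trans ((Finset.sum_le_sum fun k _ => χ.norm_le_one _).trans ?_)
    simp

theorem regL_eq_charInt {s : ℂ} (hs : 0 < s.re) :
    regL χ s = s * ((if χ = 1 then s - 1 else 1) * charInt χ s + charMean χ) := by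
  have hopen : IsOpen {z : ℂ | 0 < z.re} := isOpen_lt continuous_const Complex.continuous_re
  have hpre : IsPreconnected {z : ℂ | 0 < z.re} := (convex_halfSpace_re_gt 0).isPreconnected
  have hA : AnalyticOnNhd ℂ (regL χ) {z : ℂ | 0 < z.re} :=
    (regL_differentiable χ).differentiableOn.analyticOnNhd hopen
  have hB : AnalyticOnNhd ℂ (fun s => s * ((if χ = 1 then s - 1 else 1) * charInt χ s + charMean χ))
      {z : ℂ | 0 < z.re} := by
    refine DifferentiableOn.analyticOnNhd (fun z hz => DifferentiableAt.differentiableWithinAt ?_)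
      hopen
    have := charInt_differentiableAt χ hz
    split_ifs <;> fun_prop
  refine hA.eqOn_of_preconnected_of_eventuallyEq hB hpre (z₀ := 2) (by simp) ?_ hs
  have : {z : ℂ | 1 < z.re} ∈ nhds (2 : ℂ) :=
    (isOpen_lt continuous_const Complex.continuous_re).mem_nhds (by simp)
  filter_upwards [this] with z hz
  have hz : 1 < z.re := hz
  have hz1 : z ≠ 1 := by rintro rfl; simp at hz
  rw [regL_eq χ hz1, LSeries_eq_charInt χ hz]
  split_ifs with h
  · have : z - 1 ≠ 0 := sub_ne_zero.2 hz1
    field_simp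
  · rw [charMean_eq_zero χ h]
    simp

theorem norm_regL_le {s : ℂ} (hs : 1 / 8 ≤ s.re) :
    ‖regL χ s‖ ≤ (8 * (2 * q + 1) + 1) * (‖s‖ + 10) ^ 2 := by
  rw [regL_eq_charInt χ (by linarith), norm_mul]
  have h1 : ‖charInt χ s‖ ≤ 8 * (2 * q + 1) := by
    refine (norm_charInt_le χ (by linarith)).trans ?_
    rw [div_le_iff₀ (by linarith)]
    have : (0 : ℝ) ≤ 2 * q + 1 := by positivity
    nlinarith
  have h2 : ‖if χ = 1 then s - 1 else 1‖ ≤ ‖s‖ + 1 := by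
    split_ifs
    · exact (norm_sub_le _ _).trans (by simp)
    · simp
  have h3 := norm_nonneg s
  calc ‖s‖ * ‖(if χ = 1 then s - 1 else 1) * charInt χ s + charMean χ‖
      ≤ (‖s‖ + 10) * ((‖s‖ + 1) * (8 * (2 * q + 1)) + 1) := by
        gcongr
        · linarith
        · refine (norm_add_le _ _).trans (add_le_add ?_ (norm_charMean_le χ))
          rw [norm_mul]
          gcongr
    _ ≤ (‖s‖ + 10) * ((‖s‖ + 10) * (8 * (2 * q + 1)) + (‖s‖ + 10) * 1) := by
        gcongr <;> linarith
    _ = _ := by ring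

theorem exists_LFunction_bounds : ∃ B : ℝ, 1 ≤ B ∧ ∀ (χ : DirichletCharacter ℂ q) (s : ℂ),
    2 ≤ s.re → ‖DirichletCharacter.LFunction χ s‖ ≤ B ∧
      B⁻¹ ≤ ‖DirichletCharacter.LFunction χ s‖ := by
  set B := ∑' n : ℕ, 1 / (n : ℝ) ^ 2 with hB
  have hsum : Summable fun n : ℕ => 1 / (n : ℝ) ^ 2 := Real.summable_one_div_nat_pow.2 (by norm_num)
  have hB1 : 1 ≤ B := by
    have := hsum.le_tsum 1 (fun n _ => by positivity)
    simpa [hB] using this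
  have hbound : ∀ (f : ℕ → ℂ), (∀ n, ‖f n‖ ≤ 1) → ∀ s : ℂ, 2 ≤ s.re → ‖LSeries f s‖ ≤ B := by
    intro f hf s hs
    refine tsum_of_norm_bounded hsum.hasSum fun n => ?_
    rw [LSeries.norm_term_eq]
    split_ifs with h
    · positivity
    · have hn : (1 : ℝ) ≤ n := by exact_mod_cast Nat.one_le_iff_ne_zero.2 h
      have : (n : ℝ) ^ 2 ≤ (n : ℝ) ^ s.re := by
        rw [← Real.rpow_natCast]
        exact Real.rpow_le_rpow_of_exponent_le hn (by exact_mod_cast hs)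
      gcongr
      exact hf n
  refine ⟨B, hB1, fun χ s hs => ?_⟩
  rw [DirichletCharacter.LFunction_eq_LSeries χ (by linarith)]
  have h1 := hbound (fun n : ℕ => χ (n : ZMod q)) (fun n => χ.norm_le_one _) s hs
  refine ⟨h1, ?_⟩
  have h2 := DirichletCharacter.LSeries.mul_mu_eq_one χ (s := s) (by linarith)
  have h3 := hbound ((fun n : ℕ => χ (n : ZMod q)) * fun n : ℕ => ((ArithmeticFunction.moebius n : ℤ) : ℂ))
    (fun n => by
      rw [Pi.mul_apply, norm_mul]
      refine mul_le_one₀ (χ.norm_le_one _) (norm_nonneg _) ?_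
      rw [Complex.norm_intCast]
      exact_mod_cast ArithmeticFunction.abs_moebius_le_one) s hs
  have h4 := congrArg norm h2
  rw [norm_mul, norm_one] at h4
  have h5 : 1 ≤ ‖LSeries (fun n => χ (n : ZMod q)) s‖ * B := by
    rw [← h4]; gcongr
  rwa [inv_le_iff_one_le_mul₀ (by linarith)]

theorem regL_ne_zero (hGRH : GRHmod q) {s : ℂ} (hs : 1 / 2 < s.re) : regL χ s ≠ 0 := by
  by_cases h1 : s = 1
  · subst h1
    unfold regL
    split_ifs with h
    · exact DirichletCharacter.LFunctionTrivChar₁_apply_one_ne_zero q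
    · exact DirichletCharacter.LFunction_ne_zero_of_one_le_re χ (Or.inl h) (by simp)
  · rw [regL_eq χ h1]
    refine mul_ne_zero ?_ ?_
    · split_ifs
      · exact sub_ne_zero.2 h1
      · exact one_ne_zero
    · intro h0
      rcases lt_or_ge s.re 1 with h | h
      · have := hGRH χ s h0 (by linarith) h
        linarith
      · exact DirichletCharacter.LFunction_ne_zero_of_one_le_re χ (Or.inr h1) h h0

theorem exists_re_logDeriv_regL_pos (hGRH : GRHmod q) : ∃ C₀ : ℝ, 0 < C₀ ∧ ∀ w : ℂ, 0 < w.re →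
    0 < (deriv (regL χ) (1 / 2 + w) / regL χ (1 / 2 + w)).re + C₀ * Real.log ‖w + 10‖ := by
  obtain ⟨B, hB1, hB⟩ := exists_LFunction_bounds (q := q)
  refine exists_re_logDeriv_add_pos (regL_differentiable χ) (C := 8 * (2 * q + 1) + 1) (c := B⁻¹)
    (by have : (0 : ℝ) ≤ q := by positivity
        linarith)
    (by positivity) (inv_le_one_of_one_le₀ hB1) (fun s hs => norm_regL_le χ hs) (fun s hs => ?_)
    (fun s hs => regL_ne_zero χ hGRH hs)
  have hs1 : s ≠ 1 := by rintro rfl; norm_num at hs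
  rw [regL_eq χ hs1, norm_mul]
  refine (hB χ s hs).2.trans (le_mul_of_one_le_left (norm_nonneg _) ?_)
  split_ifs
  · have := Complex.re_le_norm (s - 1)
    simp at this
    linarith
  · simp

end RegL

section VerticalAverage

theorem exists_vertical_growth {D : ℂ → ℂ} (hD : DifferentiableOn ℂ D {z | 0 < z.re})
    (hV : ∀ z, 0 < z.re → 0 < (D z).re) {κ : ℝ} (hκ : 0 < κ) {w : ℂ} (hw : 0 < w.re) :
    ∃ C : ℝ, 0 ≤ C ∧ ∀ z ∈ Metric.ball w (w.re / 2), 0 < z.re ∧ ∀ y : ℝ,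
      ‖deriv D (z.re + (z.im + κ * y : ℝ) * I)‖ ≤ C * (1 + |y|) ^ 5 ∧
      ‖D (z.re + (z.im + κ * y : ℝ) * I)‖ ≤ C * (1 + |y|) ^ 5 := by
  have hre : ∀ z ∈ Metric.closedBall w (w.re / 2), w.re / 2 ≤ z.re := by
    intro z hz
    have h1 := (Complex.abs_re_le_norm (z - w)).trans (by simpa [dist_eq_norm] using hz)
    have h2 := (abs_le.1 h1).1
    simp only [Complex.sub_re] at h2
    linarith
  obtain ⟨M, hM⟩ := (isCompact_closedBall w (w.re / 2)).exists_bound_of_continuousOn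
    (hD.continuousOn.mono fun z hz => show 0 < z.re by linarith [hre z hz])
  have hM0 : 0 ≤ M := (norm_nonneg _).trans (hM w (Metric.mem_closedBall_self (by linarith)))
  set K := 2 / (w.re / 2) * (Real.exp 2 * (1 + κ / (w.re / 2)) ^ 4 * M) with hK
  have hK0 : 0 ≤ K := by positivity
  refine ⟨K * (1 + κ) + M, by positivity, fun z hz => ?_⟩
  have hz' := Metric.ball_subset_closedBall hz
  have hx : w.re / 2 ≤ z.re := hre z hz'
  have hx0 : 0 < z.re := by linarith
  refine ⟨hx0, fun y => ?_⟩
  have hzz : (z.re : ℂ) + z.im * I = z := Complex.re_add_im z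
  have hre0 := hV z hx0
  have hreM : (D z).re ≤ M := (Complex.re_le_norm _).trans (hM z hz')
  have hb : 2 / z.re * (Real.exp 2 * (1 + |κ * y| / z.re) ^ 4 * (D (z.re + z.im * I)).re)
      ≤ K * (1 + |y|) ^ 4 := by
    rw [hzz, abs_mul, abs_of_pos hκ]
    have h1 : 1 + κ * |y| / z.re ≤ (1 + κ / (w.re / 2)) * (1 + |y|) := by
      have : κ * |y| / z.re ≤ κ * |y| / (w.re / 2) := by gcongr
      have h2 : κ * |y| / (w.re / 2) = κ / (w.re / 2) * |y| := by ring
      have h3 : 0 ≤ κ / (w.re / 2) := by positivity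
      nlinarith [abs_nonneg y]
    calc 2 / z.re * (Real.exp 2 * (1 + κ * |y| / z.re) ^ 4 * (D z).re)
        ≤ 2 / (w.re / 2) * (Real.exp 2 * ((1 + κ / (w.re / 2)) * (1 + |y|)) ^ 4 * M) := by
          gcongr
      _ = _ := by rw [hK]; ring
  have hy1 : 1 ≤ 1 + |y| := by linarith [abs_nonneg y]
  have h45 : (1 + |y|) ^ 4 ≤ (1 + |y|) ^ 5 := pow_le_pow_right₀ hy1 (by norm_num)
  have h5 : 1 ≤ (1 + |y|) ^ 5 := one_le_pow₀ hy1
  constructor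
  · refine (norm_deriv_vertical_le hD hV hx0 z.im (κ * y)).trans (hb.trans ?_)
    gcongr
    nlinarith
  · have h1 := (norm_vertical_sub_le hD hV hx0 z.im (κ * y)).trans
      (mul_le_mul_of_nonneg_right hb (abs_nonneg _))
    rw [hzz, abs_mul, abs_of_pos hκ] at h1
    have h2 := norm_le_norm_add_norm_sub' (D (z.re + (z.im + κ * y : ℝ) * I)) (D z)
    have h3 : K * (1 + |y|) ^ 4 * (κ * |y|) ≤ K * κ * (1 + |y|) ^ 5 := by
      calc _ = K * κ * ((1 + |y|) ^ 4 * |y|) := by ring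
        _ ≤ K * κ * ((1 + |y|) ^ 4 * (1 + |y|)) := by gcongr; linarith
        _ = _ := by ring
    have h4 : M ≤ M * (1 + |y|) ^ 5 := le_mul_of_one_le_right hM0 h5
    have h6 : 0 ≤ K * (1 + |y|) ^ 5 := by positivity
    have h7 := hM z hz'
    linarith

namespace IsKernelPair

variable {φ h : ℝ → ℝ} (hK : IsKernelPair φ h) {D : ℂ → ℂ}
  (hD : DifferentiableOn ℂ D {z | 0 < z.re}) (hV : ∀ z, 0 < z.re → 0 < (D z).re)
  {κ : ℝ} (hκ : 0 < κ)

include hD in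
theorem continuous_vertical {x : ℝ} (hx : 0 < x) (t : ℝ) :
    Continuous fun y : ℝ => D (x + (t + κ * y : ℝ) * I) := by
  have h1 : Continuous fun y : ℝ => D (x + (t + y : ℝ) * I) :=
    continuous_iff_continuousAt.2 fun y => (hasDerivAt_vertical hD hx t y).continuousAt
  exact h1.comp (continuous_const.mul continuous_id)

include hK hD hV hκ

theorem integrable_vertical {w : ℂ} (hw : 0 < w.re) :
    Integrable fun y => (h y : ℂ) * D (w.re + (w.im + κ * y : ℝ) * I) := by
  obtain ⟨C, hC0, hC⟩ := exists_vertical_growth hD hV hκ hw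
  exact hK.integrable_mul (continuous_vertical hD hw _)
    (fun y => ((hC w (Metric.mem_ball_self (by linarith))).2 y).2)

theorem differentiableOn_average :
    DifferentiableOn ℂ (fun w : ℂ => ∫ y, (h y : ℂ) * D (w.re + (w.im + κ * y : ℝ) * I))
      {z | 0 < z.re} := by
  intro w hw
  have hw : 0 < w.re := hw
  have hopen : IsOpen {z : ℂ | 0 < z.re} := isOpen_lt continuous_const Complex.continuous_re
  obtain ⟨C, hC0, hC⟩ := exists_vertical_growth hD hV hκ hw
  have hdD : DifferentiableOn ℂ (deriv D) {z | 0 < z.re} := hD.deriv hopen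
  have hball : Metric.ball w (w.re / 2) ∈ nhds w := Metric.ball_mem_nhds w (by linarith)
  have hhc := hK.continuous
  refine DifferentiableAt.differentiableWithinAt (HasDerivAt.differentiableAt
    (hasDerivAt_integral_of_dominated_loc_of_deriv_le
      (F := fun (w : ℂ) y => (h y : ℂ) * D (w.re + (w.im + κ * y : ℝ) * I))
      (F' := fun (w : ℂ) y => (h y : ℂ) * deriv D (w.re + (w.im + κ * y : ℝ) * I))
      (bound := fun y => C * ((1 + |y|) ^ 5 * |h y|)) hball ?_
      (hK.integrable_vertical hD hV hκ hw) ?_ ?_ ((hK.integrable_pow_mul 5).const_mul C) ?_).2)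
  · filter_upwards [hball] with z hz
    have := continuous_vertical (κ := κ) hD (hC z hz).1 z.im
    exact ((Complex.continuous_ofReal.comp hhc).mul this).aestronglyMeasurable
  · have := continuous_vertical (κ := κ) hdD hw w.im
    exact ((Complex.continuous_ofReal.comp hhc).mul this).aestronglyMeasurable
  · refine Eventually.of_forall fun y z hz => ?_
    rw [norm_mul, Complex.norm_real, Real.norm_eq_abs]
    calc _ ≤ |h y| * (C * (1 + |y|) ^ 5) := by gcongr; exact ((hC z hz).2 y).1
      _ = _ := by ring
  · refine Eventually.of_forall fun y z hz => ?_
    have e : ∀ z : ℂ, (z.re : ℂ) + (z.im + κ * y : ℝ) * I = z + (κ * y : ℝ) * I := by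
      intro z
      conv_rhs => rw [← Complex.re_add_im z]
      push_cast
      ring
    simp only [e]
    have h1 : 0 < (z + (κ * y : ℝ) * I).re := by simpa using (hC z hz).1
    exact ((hD.differentiableAt (hopen.mem_nhds h1)).hasDerivAt.comp_add_const z _).const_mul _

variable {U : ℂ → ℝ} (hUv : ∀ x t : ℝ, 0 < x → ∀ y : ℝ,
  HasDerivAt (fun y : ℝ => U (x + (t + y : ℝ) * I)) (-(D (x + (t + y : ℝ) * I)).im) y)
  (hUh : ∀ t x : ℝ, 0 < x → HasDerivAt (fun x : ℝ => U (x + t * I)) (D (x + t * I)).re x)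
include hUv

theorem integrable_potential {x : ℝ} (hx : 0 < x) (t : ℝ) :
    Integrable fun y => h y * U (x + (t + κ * y : ℝ) * I) := by
  obtain ⟨C, hC0, hC⟩ := exists_vertical_growth hD hV hκ (w := x + t * I) (by simpa using hx)
  have hC := (hC (x + t * I) (Metric.mem_ball_self (by simpa using hx))).2
  simp only [Complex.add_re, Complex.ofReal_re, Complex.mul_re, Complex.I_re, mul_zero,
    Complex.ofReal_im, Complex.I_im, mul_one, sub_self, add_zero, Complex.add_im, Complex.mul_im,
    zero_add] at hC
  have hcont : Continuous fun y : ℝ => U (x + (t + κ * y : ℝ) * I) := by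
    have h1 : Continuous fun y : ℝ => U (x + (t + y : ℝ) * I) :=
      continuous_iff_continuousAt.2 fun y => (hUv x t hx y).continuousAt
    exact h1.comp (continuous_const.mul continuous_id)
  refine hK.integrable_mul_real hcont (C := |U (x + t * I)| + C * κ) (n := 6) fun y => ?_
  have hd : ∀ y : ℝ, HasDerivAt (fun y : ℝ => U (x + (t + κ * y : ℝ) * I))
      (-(D (x + (t + κ * y : ℝ) * I)).im * κ) y := fun y =>
    HasDerivAt.comp y (hUv x t hx (κ * y)) (by simpa using (hasDerivAt_id y).const_mul κ)
  have h1 := (convex_Icc (-|y|) |y|).norm_image_sub_le_of_norm_hasDerivWithin_le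
    (C := C * (1 + |y|) ^ 5 * κ) (f := fun y : ℝ => U (x + (t + κ * y : ℝ) * I)) (x := 0) (y := y)
    (fun v _ => (hd v).hasDerivWithinAt) (fun v hv => by
      rw [norm_mul, norm_neg, Real.norm_eq_abs, Real.norm_of_nonneg hκ.le]
      have : |v| ≤ |y| := abs_le.2 hv
      gcongr
      refine (Complex.abs_im_le_norm _).trans ((hC v).2.trans ?_)
      gcongr) (by simp) (abs_le.1 le_rfl)
  simp only [mul_zero, add_zero, sub_zero, Real.norm_eq_abs] at h1
  have h2 := abs_sub_abs_le_abs_sub (U (x + (t + κ * y : ℝ) * I)) (U (x + t * I))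
  have hy1 : 1 ≤ 1 + |y| := by linarith [abs_nonneg y]
  have h3 : |U (x + t * I)| ≤ |U (x + t * I)| * (1 + |y|) ^ 6 :=
    le_mul_of_one_le_right (abs_nonneg _) (one_le_pow₀ hy1)
  have h4 : C * (1 + |y|) ^ 5 * κ * |y| ≤ C * κ * (1 + |y|) ^ 6 := by
    calc _ ≤ C * (1 + |y|) ^ 5 * κ * (1 + |y|) := by gcongr; linarith
      _ = _ := by ring
  linarith

include hUh

theorem hasDerivAt_average_potential {x : ℝ} (hx : 0 < x) (t : ℝ) :
    HasDerivAt (fun x : ℝ => ∫ y, h y * U (x + (t + κ * y : ℝ) * I))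
      (∫ y, (h y : ℂ) * D (x + (t + κ * y : ℝ) * I)).re x := by
  have h_int := hK.integrable_vertical hD hV hκ (w := x + t * I) (by simpa using hx)
  obtain ⟨C, hC0, hC⟩ := exists_vertical_growth hD hV hκ (w := x + t * I) (by simpa using hx)
  simp only [Complex.add_re, Complex.ofReal_re, Complex.mul_re, Complex.I_re, mul_zero,
    Complex.ofReal_im, Complex.I_im, mul_one, sub_self, add_zero, Complex.add_im, Complex.mul_im,
    zero_add] at hC h_int
  have hball : Metric.ball x (x / 2) ∈ nhds x := Metric.ball_mem_nhds x (by linarith)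
  have hmem : ∀ z ∈ Metric.ball x (x / 2), 0 < z ∧ ∀ y : ℝ,
      ‖D (z + (t + κ * y : ℝ) * I)‖ ≤ C * (1 + |y|) ^ 5 := by
    intro z hz
    have h1 := hC (z + t * I) (by
      simpa [dist_eq_norm, ← Complex.ofReal_sub, Complex.norm_real] using hz)
    simp at h1
    refine ⟨h1.1, fun y => ?_⟩
    simpa using (h1.2 y).2
  have hhc := hK.continuous
  have hre : (∫ y, (h y : ℂ) * D (x + (t + κ * y : ℝ) * I)).re
      = ∫ y, h y * (D (x + (t + κ * y : ℝ) * I)).re := by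
    have := reCLM.integral_comp_comm h_int
    simp only [Complex.reCLM_apply, Complex.re_ofReal_mul] at this
    exact this.symm
  rw [hre]
  refine (hasDerivAt_integral_of_dominated_loc_of_deriv_le
      (F := fun (x : ℝ) y => h y * U (x + (t + κ * y : ℝ) * I))
      (F' := fun (x : ℝ) y => h y * (D (x + (t + κ * y : ℝ) * I)).re)
      (bound := fun y => C * ((1 + |y|) ^ 5 * |h y|)) hball ?_
      (hK.integrable_potential hD hV hκ hUv hx t) ?_ ?_ ((hK.integrable_pow_mul 5).const_mul C) ?_).2
  · filter_upwards [hball] with z hz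
    exact (hK.integrable_potential hD hV hκ hUv (hmem z hz).1 t).aestronglyMeasurable
  · have := continuous_vertical (κ := κ) hD hx t
    exact (hhc.mul (Complex.continuous_re.comp this)).aestronglyMeasurable
  · refine Eventually.of_forall fun y z hz => ?_
    rw [norm_mul, Real.norm_eq_abs, Real.norm_eq_abs]
    calc _ ≤ |h y| * (C * (1 + |y|) ^ 5) := by
          gcongr
          exact (Complex.abs_re_le_norm _).trans ((hmem z hz).2 y)
      _ = _ := by ring
  · exact Eventually.of_forall fun y z hz => (hUh _ z (hmem z hz).1).const_mul _

end IsKernelPair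

end VerticalAverage

namespace IsKernelPair

variable {φ h : ℝ → ℝ} (hK : IsKernelPair φ h) {L : ℝ} (hL : 0 < L)

/-- The contribution of a simple pole to the smoothed explicit formula. -/
noncomputable def poleTerm (φ : ℝ → ℝ) (L : ℝ) (z : ℂ) : ℂ :=
  ∫ v in (0 : ℝ)..L, (φ (v / L) : ℂ) * cexp (-z * v)

include hK in
theorem integral_mul_exp (L v : ℝ) :
    ∫ y : ℝ, (h y : ℂ) * cexp (-(2 * π / L * y * v : ℝ) * I) = φ (v / L) := by
  simp_rw [← hK.fourier, show ∀ y, 2 * π / L * y * v = 2 * π * y * (v / L) from fun y => by ring]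

include hK in
theorem poleTerm_differentiable : Differentiable ℂ (poleTerm φ L) := by
  intro z
  have hφ := hK.contDiff.continuous
  have hc : ∀ z : ℂ, Continuous fun v : ℝ => (φ (v / L) : ℂ) * cexp (-z * v) := by
    intro z; fun_prop
  refine (intervalIntegral.hasDerivAt_integral_of_dominated_loc_of_deriv_le
    (F := fun (z : ℂ) (v : ℝ) => (φ (v / L) : ℂ) * cexp (-z * v))
    (F' := fun (z : ℂ) (v : ℝ) => (φ (v / L) : ℂ) * (cexp (-z * v) * (-v)))
    (bound := fun v => Real.exp ((‖z‖ + 1) * |v|) * |v|) (Metric.ball_mem_nhds z one_pos)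
    (Eventually.of_forall fun z => (hc z).aestronglyMeasurable) ((hc z).intervalIntegrable _ _)
    ?_ ?_ ?_ ?_).2.differentiableAt
  · exact (by fun_prop : Continuous fun v : ℝ =>
      (φ (v / L) : ℂ) * (cexp (-z * v) * (-v))).aestronglyMeasurable
  · refine Eventually.of_forall fun v _ w hw => ?_
    rw [norm_mul, norm_mul, norm_neg, Complex.norm_real, Complex.norm_real, Real.norm_eq_abs,
      Real.norm_eq_abs, abs_of_nonneg (hK.nonneg _), Complex.norm_exp]
    have h1 : (-w * v).re ≤ (‖z‖ + 1) * |v| := by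
      refine (Complex.re_le_norm _).trans ?_
      rw [norm_mul, norm_neg, Complex.norm_real, Real.norm_eq_abs]
      have h2 := norm_le_norm_add_norm_sub' w z
      rw [Metric.mem_ball, dist_eq_norm] at hw
      gcongr
      linarith
    calc _ ≤ 1 * (Real.exp ((‖z‖ + 1) * |v|) * |v|) := by gcongr; exact hK.le_one _
      _ = _ := one_mul _
  · exact Continuous.intervalIntegrable (by fun_prop) _ _
  · refine Eventually.of_forall fun v _ w _ => ?_
    have h1 : HasDerivAt (fun w : ℂ => -w * v) (-v : ℂ) w := by
      simpa using (hasDerivAt_id w).neg.mul_const (v : ℂ)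
    exact h1.cexp.const_mul _

include hK in
theorem exists_norm_poleTerm_le : ∃ C : ℝ, 0 ≤ C ∧ ∀ L : ℝ, 0 < L → ∀ z : ℂ, z ≠ 0 →
    -(1 / 2) ≤ z.re → ‖poleTerm φ L z‖ ≤ C * Real.exp (L / 2) / ‖z‖ := by
  have hdc : Continuous (deriv φ) := hK.contDiff.continuous_deriv le_rfl
  obtain ⟨B, hB⟩ := (isCompact_Icc (a := (0 : ℝ)) (b := 1)).exists_bound_of_continuousOn
    hdc.continuousOn
  have hB0 : 0 ≤ B := (norm_nonneg _).trans (hB 0 (by simp))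
  refine ⟨1 + B, by positivity, fun L hL z hz hre => ?_⟩
  have hφL : φ (L / L) = 0 := hK.support _ (by rw [div_self hL.ne']; simp)
  have hd1 : ∀ v : ℝ, HasDerivAt (fun v : ℝ => (φ (v / L) : ℂ)) ((deriv φ (v / L) / L : ℝ) : ℂ) v := by
    intro v
    have h1 := ((hK.contDiff.differentiable (by norm_num)) (v / L)).hasDerivAt
    have h2 : HasDerivAt (fun v : ℝ => v / L) (1 / L) v := (hasDerivAt_id v).div_const L
    exact ((h1.comp v h2).ofReal_comp).congr_deriv (by push_cast; ring)
  have hd2 : ∀ v : ℝ, HasDerivAt (fun v : ℝ => cexp (-z * v) / -z) (cexp (-z * v)) v := by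
    intro v
    have h1 : HasDerivAt (fun v : ℝ => -z * (v : ℂ)) (-z) v := by
      simpa using (hasDerivAt_id v).ofReal_comp.const_mul (-z)
    exact (h1.cexp.div_const (-z)).congr_deriv (by field_simp)
  have hi : IntervalIntegrable (fun v : ℝ => ((deriv φ (v / L) / L : ℝ) : ℂ)) volume 0 L :=
    Continuous.intervalIntegrable (by fun_prop) _ _
  have hparts := intervalIntegral.integral_mul_deriv_eq_deriv_mul (a := 0) (b := L)
    (fun v _ => hd1 v) (fun v _ => hd2 v) hi (Continuous.intervalIntegrable (by fun_prop) _ _)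
  rw [poleTerm, hparts, hφL]
  have hexp : ∀ v ∈ Set.Icc (0 : ℝ) L, ‖cexp (-z * v)‖ ≤ Real.exp (L / 2) := by
    intro v hv
    rw [Complex.norm_exp]
    gcongr
    simp only [Complex.mul_re, Complex.neg_re, Complex.ofReal_re, Complex.ofReal_im, mul_zero,
      sub_zero]
    nlinarith [hv.1, hv.2]
  have hbound : ‖∫ v in (0 : ℝ)..L, ((deriv φ (v / L) / L : ℝ) : ℂ) * (cexp (-z * v) / -z)‖
      ≤ B * Real.exp (L / 2) / ‖z‖ := by
    have := intervalIntegral.norm_integral_le_of_norm_le_const (a := 0) (b := L)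
      (f := fun v : ℝ => ((deriv φ (v / L) / L : ℝ) : ℂ) * (cexp (-z * v) / -z))
      (C := B / L * (Real.exp (L / 2) / ‖z‖)) (fun v hv => by
        rw [Set.uIoc_of_le hL.le] at hv
        rw [norm_mul, norm_div, norm_neg, Complex.norm_real, norm_div, Real.norm_of_nonneg hL.le]
        have h1 := hB (v / L) ⟨by have := hv.1; positivity, (div_le_one hL).2 hv.2⟩
        have h2 := hexp v ⟨hv.1.le, hv.2⟩
        gcongr)
    refine this.trans (le_of_eq ?_)
    rw [sub_zero, abs_of_pos hL]
    field_simp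
  have h1 : (1 : ℝ) ≤ Real.exp (L / 2) := Real.one_le_exp (by positivity)
  simp only [zero_div, hK.zero, Complex.ofReal_one, Complex.ofReal_zero, mul_zero,
    Complex.exp_zero, zero_mul, one_mul, zero_sub]
  refine (norm_sub_le _ _).trans ?_
  rw [norm_neg, norm_div, norm_one, norm_neg]
  calc 1 / ‖z‖ + _ ≤ Real.exp (L / 2) / ‖z‖ + B * Real.exp (L / 2) / ‖z‖ := by gcongr
    _ = _ := by ring

include hK hL in
theorem integral_div_eq_poleTerm {z : ℂ} (hz : 0 < z.re) :
    ∫ y : ℝ, (h y : ℂ) * (1 / (z + (2 * π / L * y : ℝ) * I)) = poleTerm φ L z := by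
  have h1 : ∀ y : ℝ, (h y : ℂ) * (1 / (z + (2 * π / L * y : ℝ) * I))
      = ∫ v in Set.Ioi (0 : ℝ), (h y : ℂ) * cexp (-(z + (2 * π / L * y : ℝ) * I) * v) := by
    intro y
    rw [integral_const_mul, integral_exp_mul_complex_Ioi (by simpa using hz)]
    simp only [Complex.ofReal_zero, mul_zero, Complex.exp_zero]
    rw [neg_div_neg_eq]
  simp_rw [h1]
  have hI1 : Integrable (fun y => (h y : ℂ)) := hK.integrable.ofReal
  have hI2 : Integrable (fun v : ℝ => cexp (-z * v)) (volume.restrict (Set.Ioi (0 : ℝ))) :=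
    integrableOn_exp_mul_complex_Ioi (by simpa using hz) 0
  have hI := hI1.mul_prod hI2
  have hsplit : ∀ y v : ℝ, cexp (-(z + (2 * π / L * y : ℝ) * I) * v)
      = cexp (-z * v) * cexp (-(2 * π / L * y * v : ℝ) * I) := by
    intro y v
    rw [← Complex.exp_add]
    congr 1
    push_cast
    ring
  rw [integral_integral_swap]
  · have h2 : ∀ v : ℝ, ∫ y : ℝ, (h y : ℂ) * cexp (-(z + (2 * π / L * y : ℝ) * I) * v)
        = (φ (v / L) : ℂ) * cexp (-z * v) := by
      intro v
      rw [← hK.integral_mul_exp L v, ← integral_mul_const]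
      refine integral_congr_ae (Eventually.of_forall fun y => ?_)
      simp only [hsplit]
      ring
    simp_rw [h2]
    rw [poleTerm, intervalIntegral.integral_of_le hL.le]
    refine setIntegral_eq_of_subset_of_forall_sdiff_eq_zero measurableSet_Ioi
      Set.Ioc_subset_Ioi_self fun v hv => ?_
    have h3 : 0 < v := hv.1
    have h4 : L < v := by
      by_contra! h5
      exact hv.2 ⟨h3, h5⟩
    rw [hK.support (v / L) (by rw [abs_of_pos (by positivity), le_div_iff₀ hL]; linarith)]
    simp
  · refine hI.mono ?_ (Eventually.of_forall fun p => ?_)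
    · have := hK.continuous
      exact (by fun_prop : Continuous (Function.uncurry fun y v : ℝ =>
        (h y : ℂ) * cexp (-(z + (2 * π / L * y : ℝ) * I) * v))).aestronglyMeasurable
    · simp only [Function.uncurry, hsplit, norm_mul]
      rw [← Complex.ofReal_neg, Complex.norm_exp_ofReal_mul_I, mul_one]

end IsKernelPair

section LogDeriv

theorem differentiableOn_log_add_ten :
    DifferentiableOn ℂ (fun w : ℂ => Complex.log (w + 10)) {z | 0 < z.re} := by
  intro w hw
  have hw : 0 < w.re := hw
  refine (DifferentiableAt.clog (by fun_prop) (Or.inl ?_)).differentiableWithinAt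
  simp
  linarith

theorem re_log_add_ten_pos {w : ℂ} (hw : 0 < w.re) : 0 < (Complex.log (w + 10)).re := by
  rw [Complex.log_re]
  refine Real.log_pos ?_
  have := Complex.re_le_norm (w + 10)
  simp at this
  linarith

variable {q : ℕ} [NeZero q] (χ : DirichletCharacter ℂ q)

theorem differentiableOn_logDeriv_regL (hGRH : GRHmod q) :
    DifferentiableOn ℂ (fun w => deriv (regL χ) (1 / 2 + w) / regL χ (1 / 2 + w))
      {z | 0 < z.re} := by
  have hd := regL_differentiable χ
  have hd' : Differentiable ℂ (deriv (regL χ)) := by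
    have := (hd.differentiableOn (s := Set.univ)).deriv isOpen_univ
    exact differentiableOn_univ.1 this
  intro w hw
  have hw : 0 < w.re := hw
  have h0 := regL_ne_zero χ hGRH (s := 1 / 2 + w) (by simpa using hw)
  exact (DifferentiableAt.div ((hd' _).comp w (by fun_prop)) ((hd _).comp w (by fun_prop))
    h0).differentiableWithinAt

theorem logDeriv_regL_of_one_lt_re {s : ℂ} (hs : 1 < s.re) :
    deriv (regL χ) s / regL χ s = (if χ = 1 then 1 / (s - 1) else 0) +
      deriv (DirichletCharacter.LFunction χ) s / DirichletCharacter.LFunction χ s := by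
  have hs1 : s ≠ 1 := by rintro rfl; simp at hs
  have hL0 := DirichletCharacter.LFunction_ne_zero_of_one_le_re χ (Or.inr hs1) hs.le
  have hLd := DirichletCharacter.differentiableAt_LFunction χ s (Or.inl hs1)
  have heq : regL χ =ᶠ[nhds s] fun s =>
      (if χ = 1 then s - 1 else 1) * DirichletCharacter.LFunction χ s := by
    filter_upwards [isOpen_ne.mem_nhds hs1] with z hz
    exact regL_eq χ hz
  rw [heq.deriv_eq, heq.eq_of_nhds]
  have hs0 : s - 1 ≠ 0 := sub_ne_zero.2 hs1
  have := logDeriv_mul (f := fun s => if χ = 1 then s - 1 else 1)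
    (g := DirichletCharacter.LFunction χ) s (by split_ifs <;> simp [hs0]) hL0
    (by split_ifs <;> fun_prop) hLd
  simp only [logDeriv_apply] at this
  rw [this]
  congr 1
  split_ifs
  · simp
  · simp

end LogDeriv

section ExplicitFormula

variable {q : ℕ} [NeZero q] (χ : DirichletCharacter ℂ q) {φ h : ℝ → ℝ} (hK : IsKernelPair φ h)
  {L : ℝ} (hL : 0 < L)

include hK hL

theorem integral_logDeriv_LFunction {N : ℕ} (hN : Real.exp L ≤ N) {s : ℂ} (hs : 1 < s.re) :
    ∫ y : ℝ, (h y : ℂ) * (deriv (DirichletCharacter.LFunction χ) (s + (2 * π / L * y : ℝ) * I)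
      / DirichletCharacter.LFunction χ (s + (2 * π / L * y : ℝ) * I))
    = -∑ n ∈ range N, (Λ n : ℂ) * χ (n : ZMod q) * φ (Real.log n / L) * (n : ℂ) ^ (-s) := by
  set f : ℕ → ℂ := (fun n : ℕ => χ (n : ZMod q)) * fun n : ℕ => (Λ n : ℂ) with hf
  have hsum := DirichletCharacter.LSeriesSummable_twist_vonMangoldt χ hs
  have hre : ∀ y : ℝ, (s + (2 * π / L * y : ℝ) * I).re = s.re := by intro y; simp
  have hterm : ∀ (y : ℝ) (n : ℕ), LSeries.term f (s + (2 * π / L * y : ℝ) * I) n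
      = LSeries.term f s n * cexp (-(2 * π / L * y * Real.log n : ℝ) * I) := by
    intro y n
    rcases eq_or_ne n 0 with rfl | hn
    · simp
    · have hn0 : (n : ℂ) ≠ 0 := by exact_mod_cast hn
      rw [LSeries.term_of_ne_zero hn, LSeries.term_of_ne_zero hn, Complex.cpow_add _ _ hn0,
        Complex.cpow_def_of_ne_zero hn0 ((2 * π / L * y : ℝ) * I), ← Complex.natCast_log,
        neg_mul, Complex.exp_neg, div_mul_eq_div_div, ← div_eq_mul_inv]
      congr 2
      push_cast
      ring
  have h1 : ∀ y : ℝ, (h y : ℂ) *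
      (deriv (DirichletCharacter.LFunction χ) (s + (2 * π / L * y : ℝ) * I)
      / DirichletCharacter.LFunction χ (s + (2 * π / L * y : ℝ) * I))
      = -∑' n, (h y : ℂ) *
        (LSeries.term f s n * cexp (-(2 * π / L * y * Real.log n : ℝ) * I)) := by
    intro y
    have hs' : 1 < (s + (2 * π / L * y : ℝ) * I).re := by rwa [hre]
    rw [DirichletCharacter.deriv_LFunction_eq_deriv_LSeries χ hs',
      DirichletCharacter.LFunction_eq_LSeries χ hs', tsum_mul_left, ← mul_neg]
    congr 1
    have := DirichletCharacter.LSeries_twist_vonMangoldt_eq χ hs'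
    rw [neg_div] at this
    rw [← neg_eq_iff_eq_neg, ← this, LSeries]
    exact tsum_congr fun n => hterm y n
  simp_rw [h1]
  have hunit : ∀ (y : ℝ) (n : ℕ), ‖cexp (-(2 * π / L * y * Real.log n : ℝ) * I)‖ = 1 := by
    intro y n
    rw [← Complex.ofReal_neg, Complex.norm_exp_ofReal_mul_I]
  have h_int : ∀ n : ℕ, Integrable fun y : ℝ => (h y : ℂ) *
      (LSeries.term f s n * cexp (-(2 * π / L * y * Real.log n : ℝ) * I)) := by
    intro n
    refine hK.integrable_mul (by fun_prop) (C := ‖LSeries.term f s n‖) (n := 0) fun y => ?_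
    rw [norm_mul, hunit]
    simp
  rw [integral_neg, ← integral_tsum_of_summable_integral_norm h_int]
  · congr 1
    rw [tsum_eq_sum (s := range N)]
    · refine Finset.sum_congr rfl fun n _ => ?_
      have : ∀ y : ℝ, (h y : ℂ) *
          (LSeries.term f s n * cexp (-(2 * π / L * y * Real.log n : ℝ) * I))
          = LSeries.term f s n *
            ((h y : ℂ) * cexp (-(2 * π / L * y * Real.log n : ℝ) * I)) := fun y => by ring
      simp_rw [this]
      rw [integral_const_mul, hK.integral_mul_exp]
      rcases eq_or_ne n 0 with rfl | hn
      · simp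
      · rw [LSeries.term_of_ne_zero hn, hf, Complex.cpow_neg]
        simp only [Pi.mul_apply]
        ring
    · intro n hn
      have hn' : N ≤ n := by simpa using hn
      have hn0 : (0 : ℝ) < N := (Real.exp_pos L).trans_le hN
      have hlog : L ≤ Real.log n := by
        rw [Real.le_log_iff_exp_le (by exact_mod_cast (by exact_mod_cast hn0 : 0 < N).trans_le hn')]
        exact hN.trans (by exact_mod_cast hn')
      have : ∀ y : ℝ, (h y : ℂ) *
          (LSeries.term f s n * cexp (-(2 * π / L * y * Real.log n : ℝ) * I))
          = LSeries.term f s n *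
            ((h y : ℂ) * cexp (-(2 * π / L * y * Real.log n : ℝ) * I)) := fun y => by ring
      simp_rw [this]
      rw [integral_const_mul, hK.integral_mul_exp, hK.support]
      · simp
      · rw [abs_of_pos (by have := hL.trans_le hlog; positivity), le_div_iff₀ hL]
        linarith
  · have : (fun n : ℕ => ∫ y : ℝ, ‖(h y : ℂ) *
        (LSeries.term f s n * cexp (-(2 * π / L * y * Real.log n : ℝ) * I))‖)
        = fun n => (∫ y : ℝ, ‖(h y : ℂ)‖) * ‖LSeries.term f s n‖ := by
      ext n
      rw [← integral_mul_const]
      refine integral_congr_ae (Eventually.of_forall fun y => ?_)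
      simp only [norm_mul, hunit, mul_one]
    rw [this]
    exact hsum.norm.mul_left _

/-- Smoothed explicit formula. -/
theorem integral_logDeriv_regL (hGRH : GRHmod q) {N : ℕ} (hN : Real.exp L ≤ N) {w : ℂ}
    (hw : 0 < w.re) :
    ∫ y : ℝ, (h y : ℂ) * (deriv (regL χ) (1 / 2 + (w.re + (w.im + 2 * π / L * y : ℝ) * I))
      / regL χ (1 / 2 + (w.re + (w.im + 2 * π / L * y : ℝ) * I)))
    = -∑ n ∈ range N, (Λ n : ℂ) * χ (n : ZMod q) * φ (Real.log n / L) * (n : ℂ) ^ (-(1 / 2 + w))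
      + if χ = 1 then IsKernelPair.poleTerm φ L (w - 1 / 2) else 0 := by
  have hopen : IsOpen {z : ℂ | 0 < z.re} := isOpen_lt continuous_const Complex.continuous_re
  have hpre : IsPreconnected {z : ℂ | 0 < z.re} := (convex_halfSpace_re_gt 0).isPreconnected
  obtain ⟨C₀, hC₀, hpos⟩ := exists_re_logDeriv_regL_pos χ hGRH
  have hκ : 0 < 2 * π / L := by positivity
  have hD1 := differentiableOn_logDeriv_regL χ hGRH
  have hD2 := differentiableOn_log_add_ten
  have hD : DifferentiableOn ℂ (fun w => deriv (regL χ) (1 / 2 + w) / regL χ (1 / 2 + w)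
      + C₀ * Complex.log (w + 10)) {z | 0 < z.re} := hD1.add (hD2.const_mul _)
  have hV : ∀ z : ℂ, 0 < z.re → 0 < (deriv (regL χ) (1 / 2 + z) / regL χ (1 / 2 + z)
      + C₀ * Complex.log (z + 10)).re := fun z hz => by
    simpa [Complex.log_re] using hpos z hz
  have hA1 := hK.differentiableOn_average hD hV hκ
  have hA2 := hK.differentiableOn_average hD2 (fun z hz => re_log_add_ten_pos hz) hκ
  have htot : ∀ w : ℂ, 0 < w.re → Integrable fun y : ℝ => (h y : ℂ) *
      (deriv (regL χ) (1 / 2 + (w.re + (w.im + 2 * π / L * y : ℝ) * I))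
      / regL χ (1 / 2 + (w.re + (w.im + 2 * π / L * y : ℝ) * I))) := by
    intro w hw
    have i1 := hK.integrable_vertical hD hV hκ hw
    have i2 := hK.integrable_vertical hD2 (fun z hz => re_log_add_ten_pos hz) hκ hw
    refine (i1.sub (i2.const_mul C₀)).congr (Eventually.of_forall fun y => ?_)
    simp only [Pi.sub_apply]
    ring
  have hmain : Set.EqOn (fun w : ℂ => ∫ y : ℝ, (h y : ℂ) *
      (deriv (regL χ) (1 / 2 + (w.re + (w.im + 2 * π / L * y : ℝ) * I))
      / regL χ (1 / 2 + (w.re + (w.im + 2 * π / L * y : ℝ) * I))))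
      (fun w => -∑ n ∈ range N, (Λ n : ℂ) * χ (n : ZMod q) * φ (Real.log n / L)
        * (n : ℂ) ^ (-(1 / 2 + w)) +
        if χ = 1 then IsKernelPair.poleTerm φ L (w - 1 / 2) else 0) {z | 0 < z.re} := by
    refine AnalyticOnNhd.eqOn_of_preconnected_of_eventuallyEq (z₀ := 1)
      (DifferentiableOn.analyticOnNhd ?_ hopen) (DifferentiableOn.analyticOnNhd ?_ hopen) hpre
      (by simp) ?_
    · refine (hA1.sub (hA2.const_mul (C₀ : ℂ))).congr fun w hw => ?_
      have i1 := hK.integrable_vertical hD hV hκ hw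
      have i2 := hK.integrable_vertical hD2 (fun z hz => re_log_add_ten_pos hz) hκ hw
      rw [Pi.sub_apply, ← integral_const_mul, ← integral_sub i1 (i2.const_mul _)]
      congr 1
      ext y
      ring
    · refine DifferentiableOn.add (DifferentiableOn.neg (DifferentiableOn.fun_sum fun n _ => ?_)) ?_
      · rcases eq_or_ne n 0 with rfl | hn
        · simp
        · refine DifferentiableOn.const_mul (fun w _ => ?_) _
          have hn0 : (n : ℂ) ≠ 0 := by exact_mod_cast hn
          exact ((by fun_prop : DifferentiableAt ℂ (fun w : ℂ => -(1 / 2 + w)) w).const_cpow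
            (Or.inl hn0)).differentiableWithinAt
      · split_ifs
        · exact (hK.poleTerm_differentiable.comp (differentiable_id.sub_const _)).differentiableOn
        · exact differentiableOn_const _
    · have : {z : ℂ | 1 / 2 < z.re} ∈ nhds (1 : ℂ) :=
        (isOpen_lt continuous_const Complex.continuous_re).mem_nhds (by norm_num)
      filter_upwards [this] with w hw
      have hw : 1 / 2 < w.re := hw
      have hs : 1 < (1 / 2 + w).re := by simp; linarith
      rw [← integral_logDeriv_LFunction χ hK hL hN hs]
      have e : ∀ y : ℝ, 1 / 2 + ((w.re : ℂ) + (w.im + 2 * π / L * y : ℝ) * I)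
          = 1 / 2 + w + (2 * π / L * y : ℝ) * I := by
        intro y
        conv_rhs => rw [← Complex.re_add_im w]
        push_cast
        ring
      simp_rw [e]
      have hre : ∀ y : ℝ, 1 < (1 / 2 + w + (2 * π / L * y : ℝ) * I).re := by
        intro y
        simpa using hs
      simp_rw [fun y : ℝ => logDeriv_regL_of_one_lt_re χ (hre y)]
      split_ifs with hχ
      · rw [← hK.integral_div_eq_poleTerm hL (z := w - 1 / 2) (by simp; linarith)]
        simp_rw [mul_add]
        have e2 : ∀ y : ℝ, 1 / 2 + w + (2 * π / L * y : ℝ) * I - 1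
          = w - 1 / 2 + (2 * π / L * y : ℝ) * I := fun y => by ring
        simp_rw [e2]
        have hz : 0 < (w - 1 / 2).re := by simp; linarith
        have hz0 : ∀ y : ℝ, w - 1 / 2 + (2 * π / L * y : ℝ) * I ≠ 0 := by
          intro y h0
          have := congrArg Complex.re h0
          simp at this
          linarith
        have i1 : Integrable fun y : ℝ =>
            (h y : ℂ) * (1 / (w - 1 / 2 + (2 * π / L * y : ℝ) * I)) := by
          refine hK.integrable_mul (C := 1 / (w - 1 / 2).re) (n := 0)
            (continuous_const.div (by fun_prop) hz0) fun y => ?_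
          rw [norm_div, norm_one, pow_zero, mul_one]
          have : (w - 1 / 2 + (2 * π / L * y : ℝ) * I).re = (w - 1 / 2).re := by simp
          gcongr
          rw [← this]
          exact Complex.re_le_norm _
        have i2 := htot w (by show 0 < w.re; linarith)
        simp_rw [e, fun y : ℝ => logDeriv_regL_of_one_lt_re χ (hre y), if_pos hχ, e2, mul_add] at i2
        rw [integral_add i1 ((i2.sub i1).congr (Eventually.of_forall fun y => ?_)), add_comm]
        simp only [Pi.sub_apply]
        ring
      · simp
  exact hmain hw

end ExplicitFormula

section Potentials

theorem hasDerivAt_log_norm {γ : ℝ → ℂ} {γ' : ℂ} {x : ℝ} (hγ : HasDerivAt γ γ' x) (h0 : γ x ≠ 0) :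
    HasDerivAt (fun x => Real.log ‖γ x‖) (γ' / γ x).re x := by
  have h1 : HasDerivAt (fun y => Complex.log (γ y / γ x)) (γ' / γ x / (γ x / γ x)) x :=
    (hγ.div_const (γ x)).clog_real (by rw [div_self h0]; exact one_mem_slitPlane)
  rw [div_self h0, div_one] at h1
  have h2 := (Complex.reCLM.hasFDerivAt.comp_hasDerivAt x h1).const_add (Real.log ‖γ x‖)
  refine HasDerivAt.congr_of_eventuallyEq (h2.congr_deriv (by simp)) ?_
  filter_upwards [hγ.continuousAt.eventually_ne h0] with y hy
  simp only [Function.comp_apply, Complex.reCLM_apply, Complex.log_re, norm_div]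
  rw [Real.log_div (norm_ne_zero_iff.2 hy) (norm_ne_zero_iff.2 h0)]
  ring

theorem hasDerivAt_horizontal_line (t x : ℝ) : HasDerivAt (fun x : ℝ => (x : ℂ) + t * I) 1 x := by
  simpa using (hasDerivAt_id x).ofReal_comp.add_const (t * I)

theorem hasDerivAt_vertical_line (x t y : ℝ) :
    HasDerivAt (fun y : ℝ => (x : ℂ) + (t + y : ℝ) * I) I y := by
  simpa using ((((hasDerivAt_id y).const_add t).ofReal_comp).mul_const I).const_add (x : ℂ)

/-- A harmonic function on the half-plane `Re w > -10` of size `O(|w| log |w|)`. -/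
noncomputable def logPotential (w : ℂ) : ℝ := ((w + 10) * Complex.log (w + 10) - (w + 10)).re

theorem hasDerivAt_logPotential_aux {γ : ℝ → ℂ} {γ' : ℂ} {x : ℝ} (hγ : HasDerivAt γ γ' x)
    (h0 : 0 ≤ (γ x).re) :
    HasDerivAt (fun x => logPotential (γ x)) (γ' * Complex.log (γ x + 10)).re x := by
  have hs : 0 < (γ x + 10).re := by simp; linarith
  have hne : γ x + 10 ≠ 0 := by
    intro h; rw [h] at hs; simp at hs
  have h1 : HasDerivAt (fun w : ℂ => (w + 10) * Complex.log (w + 10) - (w + 10))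
      (Complex.log (γ x + 10)) (γ x) := by
    have h2 : HasDerivAt (fun w : ℂ => w + 10) 1 (γ x) := (hasDerivAt_id _).add_const _
    exact ((h2.fun_mul (h2.clog (Or.inl hs))).fun_sub h2).congr_deriv (by field_simp; ring)
  have h3 := h1.comp x hγ
  exact (Complex.reCLM.hasFDerivAt.comp_hasDerivAt x h3).congr_deriv (by simp [mul_comm])

theorem hasDerivAt_logPotential_horizontal (t : ℝ) {x : ℝ} (hx : 0 ≤ x) :
    HasDerivAt (fun x : ℝ => logPotential (x + t * I)) (Complex.log (x + t * I + 10)).re x :=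
  (hasDerivAt_logPotential_aux (hasDerivAt_horizontal_line t x) (by simpa using hx)).congr_deriv
    (by simp)

theorem hasDerivAt_logPotential_vertical {x : ℝ} (hx : 0 ≤ x) (t y : ℝ) :
    HasDerivAt (fun y : ℝ => logPotential (x + (t + y : ℝ) * I))
      (-(Complex.log (x + (t + y : ℝ) * I + 10)).im) y :=
  (hasDerivAt_logPotential_aux (hasDerivAt_vertical_line x t y) (by simpa using hx)).congr_deriv
    (by simp)

theorem abs_logPotential_vertical_sub_le {x : ℝ} (hx : 0 ≤ x) (t y : ℝ) :
    |logPotential (x + (t + y : ℝ) * I) - logPotential (x + t * I)| ≤ π * |y| := by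
  have := convex_univ.norm_image_sub_le_of_norm_hasDerivWithin_le
    (f := fun y : ℝ => logPotential (x + (t + y : ℝ) * I)) (C := π) (x := 0) (y := y)
    (fun v _ => (hasDerivAt_logPotential_vertical hx t v).hasDerivWithinAt) (fun v _ => by
      rw [norm_neg, Real.norm_eq_abs, Complex.log_im]
      exact Complex.abs_arg_le_pi _) (Set.mem_univ _) (Set.mem_univ _)
  simpa using this

theorem abs_logPotential_horizontal_sub_le {x t : ℝ} (hx : 0 ≤ x) (ht : 0 ≤ t) :
    |logPotential (x + t * I) - logPotential (t * I)| ≤ x * Real.log (x + t + 10) := by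
  have := (convex_Icc 0 x).norm_image_sub_le_of_norm_hasDerivWithin_le
    (f := fun x : ℝ => logPotential (x + t * I)) (C := Real.log (x + t + 10)) (x := 0) (y := x)
    (fun v hv => (hasDerivAt_logPotential_horizontal t hv.1).hasDerivWithinAt) (fun v hv => by
      have h1 : 10 ≤ ‖(v : ℂ) + t * I + 10‖ := by
        have := Complex.re_le_norm ((v : ℂ) + t * I + 10)
        simp at this
        linarith [hv.1]
      have h2 : ‖(v : ℂ) + t * I + 10‖ ≤ x + t + 10 := by
        refine (norm_add_le _ _).trans (add_le_add ((norm_add_le _ _).trans (add_le_add ?_ ?_)) ?_)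
        · rw [Complex.norm_real, Real.norm_of_nonneg hv.1]; exact hv.2
        · simp [abs_of_nonneg ht]
        · simp
      rw [Complex.log_re, Real.norm_of_nonneg (Real.log_nonneg (by linarith))]
      exact Real.log_le_log (by linarith) h2) ⟨le_rfl, hx⟩ ⟨hx, le_rfl⟩
  simpa [abs_of_nonneg hx, mul_comm] using this

variable {q : ℕ} [NeZero q] (χ : DirichletCharacter ℂ q)

theorem hasDerivAt_log_norm_regL_aux (hGRH : GRHmod q) {γ : ℝ → ℂ} {γ' : ℂ} {x : ℝ}
    (hγ : HasDerivAt γ γ' x) (h0 : 0 < (γ x).re) :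
    HasDerivAt (fun x => Real.log ‖regL χ (1 / 2 + γ x)‖)
      (γ' * (deriv (regL χ) (1 / 2 + γ x) / regL χ (1 / 2 + γ x))).re x := by
  have h1 := ((regL_differentiable χ) (1 / 2 + γ x)).hasDerivAt.comp x (hγ.const_add (1 / 2))
  refine (hasDerivAt_log_norm h1 (regL_ne_zero χ hGRH (by simpa using h0))).congr_deriv ?_
  simp only [Function.comp_apply]
  congr 1
  ring

theorem hasDerivAt_log_norm_regL_horizontal (hGRH : GRHmod q) (t : ℝ) {x : ℝ} (hx : 0 < x) :
    HasDerivAt (fun x : ℝ => Real.log ‖regL χ (1 / 2 + (x + t * I))‖)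
      (deriv (regL χ) (1 / 2 + (x + t * I)) / regL χ (1 / 2 + (x + t * I))).re x :=
  (hasDerivAt_log_norm_regL_aux χ hGRH (hasDerivAt_horizontal_line t x)
    (by simpa using hx)).congr_deriv (by rw [one_mul])

theorem hasDerivAt_log_norm_regL_vertical (hGRH : GRHmod q) {x : ℝ} (hx : 0 < x) (t y : ℝ) :
    HasDerivAt (fun y : ℝ => Real.log ‖regL χ (1 / 2 + (x + (t + y : ℝ) * I))‖)
      (-(deriv (regL χ) (1 / 2 + (x + (t + y : ℝ) * I))
        / regL χ (1 / 2 + (x + (t + y : ℝ) * I))).im) y :=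
  (hasDerivAt_log_norm_regL_aux χ hGRH (hasDerivAt_vertical_line x t y)
    (by simpa using hx)).congr_deriv (by rw [Complex.mul_re, I_re, I_im]; ring)

theorem exists_abs_log_norm_regL_le {X₀ κ₀ : ℝ} (hκ₀ : 0 ≤ κ₀) : ∃ C : ℝ, ∀ X t κ y : ℝ, 2 ≤ X →
    X ≤ X₀ → 1 ≤ t → 0 ≤ κ → κ ≤ κ₀ →
    |Real.log ‖regL χ (1 / 2 + (X + (t + κ * y : ℝ) * I))‖ - (if χ = 1 then Real.log t else 0)|
      ≤ C * (1 + |y|) := by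
  obtain ⟨B, hB1, hB⟩ := exists_LFunction_bounds (q := q)
  refine ⟨Real.log B + (X₀ + 1 + κ₀), fun X t κ y hX hX₀ ht hκ hκκ => ?_⟩
  set s : ℂ := 1 / 2 + (X + (t + κ * y : ℝ) * I) with hs
  have hsre : s.re = 1 / 2 + X := by simp [hs]
  have hsim : s.im = t + κ * y := by simp [hs]
  have hs1 : s ≠ 1 := by
    intro h; rw [h] at hsre; simp at hsre; linarith
  obtain ⟨hL1, hL2⟩ := hB χ s (by linarith)
  have hB0 : 0 < B⁻¹ := by positivity
  have hLpos : 0 < ‖DirichletCharacter.LFunction χ s‖ := hB0.trans_le hL2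
  have h1 : |Real.log ‖DirichletCharacter.LFunction χ s‖| ≤ Real.log B := by
    rw [abs_le, ← Real.log_inv]
    exact ⟨Real.log_le_log hB0 hL2, Real.log_le_log hLpos hL1⟩
  have hy := abs_nonneg y
  have hlogB := Real.log_nonneg hB1
  have hky : κ * |y| ≤ κ₀ * |y| := by gcongr
  have hky0 : 0 ≤ κ₀ * |y| := by positivity
  rw [regL_eq χ hs1]
  split_ifs with hχ
  · set z := s - 1 with hz
    have hzre : z.re = X - 1 / 2 := by simp [hz, hsre]; ring
    have hzim : z.im = t + κ * y := by simp [hz, hsim]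
    have hz1 : 1 ≤ ‖z‖ := by
      have := Complex.re_le_norm z
      linarith
    have hup : ‖z‖ ≤ t * (X₀ + 1 + κ₀ * |y|) := by
      refine (Complex.norm_le_abs_re_add_abs_im z).trans ?_
      rw [hzre, hzim, abs_of_nonneg (by linarith)]
      have h2 := abs_add_le t (κ * y)
      rw [abs_mul, abs_of_nonneg hκ, abs_of_nonneg (by linarith : 0 ≤ t)] at h2
      nlinarith
    have hlow : t ≤ ‖z‖ * (1 + κ₀ * |y|) := by
      have h2 := Complex.abs_im_le_norm z
      rw [hzim] at h2
      have h3 := abs_sub (t + κ * y) (κ * y)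
      rw [abs_mul, abs_of_nonneg hκ, add_sub_cancel_right, abs_of_nonneg (by linarith : 0 ≤ t)] at h3
      nlinarith
    have hl1 : Real.log ‖z‖ - Real.log t ≤ (X₀ + 1 + κ₀) * (1 + |y|) := by
      have h2 := Real.log_le_log (by linarith) hup
      rw [Real.log_mul (by linarith) (by nlinarith)] at h2
      have h3 := Real.log_le_sub_one_of_pos (x := X₀ + 1 + κ₀ * |y|) (by linarith)
      nlinarith
    have hl2 : Real.log t - Real.log ‖z‖ ≤ (X₀ + 1 + κ₀) * (1 + |y|) := by
      have h2 := Real.log_le_log (by linarith) hlow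
      rw [Real.log_mul (by linarith) (by linarith)] at h2
      have h3 := Real.log_le_sub_one_of_pos (x := 1 + κ₀ * |y|) (by linarith)
      nlinarith
    rw [norm_mul, Real.log_mul (by linarith) hLpos.ne']
    obtain ⟨h2, h3⟩ := abs_le.1 h1
    rw [abs_le]
    constructor <;> nlinarith
  · rw [one_mul, sub_zero]
    refine h1.trans ?_
    nlinarith [mul_nonneg hlogB hy]

end Potentials

section PointwiseBound

/-- The smoothed Dirichlet polynomial approximating `log L(s, χ)`. -/
noncomputable def logPoly {q : ℕ} (χ : DirichletCharacter ℂ q) (φ : ℝ → ℝ) (L : ℝ) (N : ℕ) (s : ℂ) :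
    ℂ :=
  ∑ n ∈ range N, (Λ n / Real.log n * φ (Real.log n / L) : ℝ) * χ (n : ZMod q) * (n : ℂ) ^ (-s)

variable {q : ℕ} (χ : DirichletCharacter ℂ q) {φ h : ℝ → ℝ} (hK : IsKernelPair φ h)

theorem vonMangoldt_div_log_mul_log (n : ℕ) : Λ n / Real.log n * Real.log n = Λ n := by
  rcases lt_or_ge n 2 with hn | hn
  · interval_cases n <;> simp
  · exact div_mul_cancel₀ _ (Real.log_pos (by exact_mod_cast hn)).ne'

theorem hasDerivAt_logPoly (L : ℝ) (N : ℕ) (t : ℝ) (x : ℝ) :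
    HasDerivAt (fun x : ℝ => logPoly χ φ L N (1 / 2 + (x + t * I)))
      (-∑ n ∈ range N, (Λ n : ℂ) * χ (n : ZMod q) * φ (Real.log n / L)
        * (n : ℂ) ^ (-(1 / 2 + (x + t * I)))) x := by
  have h0 : HasDerivAt (fun x : ℝ => -(1 / 2 + ((x : ℂ) + t * I))) (-1) x :=
    ((hasDerivAt_horizontal_line t x).const_add (1 / 2)).fun_neg
  unfold logPoly
  rw [← Finset.sum_neg_distrib]
  refine HasDerivAt.fun_sum fun n _ => ?_
  rcases eq_or_ne n 0 with rfl | hn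
  · simpa using hasDerivAt_const x (0 : ℂ)
  · have hn0 : (n : ℂ) ≠ 0 := by exact_mod_cast hn
    have h1 := ((((hasDerivAt_id (-(1 / 2 + ((x : ℂ) + t * I)))).const_cpow (c := n)
      (Or.inl hn0)).comp x h0)).const_mul
      (((Λ n / Real.log n * φ (Real.log n / L) : ℝ) : ℂ) * χ (n : ZMod q))
    refine h1.congr_deriv ?_
    rw [← Complex.natCast_log]
    have h2 : ((Λ n : ℝ) : ℂ) = (Λ n / Real.log n : ℝ) * (Real.log n : ℝ) := by
      rw [← Complex.ofReal_mul, vonMangoldt_div_log_mul_log]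
    rw [h2, id_eq]
    push_cast
    ring

include hK in
theorem exists_norm_logPoly_le : ∃ C : ℝ, ∀ (L : ℝ) (N : ℕ) (s : ℂ), 2 ≤ s.re →
    ‖logPoly χ φ L N s‖ ≤ C := by
  have hsum : Summable fun n : ℕ => 1 / (n : ℝ) ^ 2 := Real.summable_one_div_nat_pow.2 (by norm_num)
  refine ⟨∑' n : ℕ, 1 / (n : ℝ) ^ 2, fun L N s hs => ?_⟩
  refine (norm_sum_le _ _).trans ((Finset.sum_le_sum fun n _ => ?_).trans
    (hsum.sum_le_tsum _ fun n _ => by positivity))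
  rcases eq_or_ne n 0 with rfl | hn
  · simp
  have hn1 : (1 : ℝ) ≤ n := by exact_mod_cast Nat.one_le_iff_ne_zero.2 hn
  have h1 : |Λ n / Real.log n * φ (Real.log n / L)| ≤ 1 := by
    have h2 := Real.log_nonneg hn1
    have h3 : 0 ≤ Λ n / Real.log n := div_nonneg ArithmeticFunction.vonMangoldt_nonneg h2
    rw [abs_of_nonneg (mul_nonneg h3 (hK.nonneg _))]
    exact mul_le_one₀ (div_le_one_of_le₀ ArithmeticFunction.vonMangoldt_le_log h2) (hK.nonneg _)
      (hK.le_one _)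
  rw [norm_mul, norm_mul, Complex.norm_real, Real.norm_eq_abs, Complex.norm_natCast_cpow_of_pos (by omega)]
  have h2 : (n : ℝ) ^ (-s).re ≤ 1 / (n : ℝ) ^ 2 := by
    rw [Complex.neg_re, Real.rpow_neg (by positivity), ← one_div]
    have : (n : ℝ) ^ 2 ≤ (n : ℝ) ^ s.re := by
      rw [← Real.rpow_natCast]
      exact Real.rpow_le_rpow_of_exponent_le hn1 (by exact_mod_cast hs)
    gcongr
  calc _ ≤ 1 * 1 * (1 / (n : ℝ) ^ 2) := by gcongr; exact χ.norm_le_one _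
    _ = _ := by ring

variable [NeZero q]

include hK in
set_option maxHeartbeats 2000000 in
/-- Upper bound for `log |L(1/2 + it, χ)|` under GRH by a short Dirichlet polynomial. -/
theorem exists_log_norm_LFunction_le (hGRH : GRHmod q) : ∃ A : ℝ, 0 < A ∧
    ∀ χ : DirichletCharacter ℂ q, ∃ C : ℝ, ∀ (t L : ℝ) (N : ℕ), 2 ≤ t → Real.log 2 ≤ L →
      L ≤ Real.log t → Real.exp L ≤ N → DirichletCharacter.LFunction χ (1 / 2 + t * I) ≠ 0 →
      Real.log ‖DirichletCharacter.LFunction χ (1 / 2 + t * I)‖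
        ≤ (logPoly χ φ L N (1 / 2 + ((A / L : ℝ) + t * I))).re + C * (Real.log t / L) := by
  obtain ⟨A, hA1, hA⟩ := hK.exists_smoothing
  refine ⟨A * (2 * π), by positivity, fun χ => ?_⟩
  obtain ⟨C₀, hC₀, hpos⟩ := exists_re_logDeriv_regL_pos χ hGRH
  have hl2 : 0 < Real.log 2 := Real.log_pos (by norm_num)
  set κ₀ := 2 * π / Real.log 2 with hκ₀
  have hκ₀0 : 0 < κ₀ := by positivity
  obtain ⟨C₁, hC₁⟩ := exists_abs_log_norm_regL_le χ (X₀ := A * κ₀ + 2) hκ₀0.le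
  obtain ⟨C₂, hC₂⟩ := exists_norm_logPoly_le χ hK
  obtain ⟨C₃, hC₃0, hC₃⟩ := hK.exists_norm_poleTerm_le
  set J := ∫ y, (1 + |y|) ^ 1 * |h y| with hJ
  have hJ0 : 0 ≤ J := integral_nonneg fun y => by positivity
  set K := |C₁| * J + |C₂| + 2 * C₃ + C₀ * (A * κ₀ * Real.log (A * κ₀ + 11) + π * κ₀ * J) with hKdef
  have hlogK : 0 ≤ Real.log (A * κ₀ + 11) := Real.log_nonneg (by have : 0 ≤ A * κ₀ := by positivity
                                                                 linarith)
  have hK0 : 0 ≤ K := by positivity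
  refine ⟨K + C₀ * (A * (2 * π)), fun t L N ht hL hLt hN hne => ?_⟩
  have hL0 : 0 < L := hl2.trans_le hL
  set κ := 2 * π / L with hκ
  have hκ0 : 0 < κ := by positivity
  have hκκ : κ ≤ κ₀ := by rw [hκ, hκ₀]; gcongr
  set σ := A * κ with hσ
  have hσ0 : 0 < σ := by positivity
  have hσσ : σ ≤ A * κ₀ := by rw [hσ]; gcongr
  have hσL : A * (2 * π) / L = σ := by rw [hσ, hκ]; ring
  rw [hσL]
  have ht1 : 1 ≤ t := by linarith
  have hD1 := differentiableOn_logDeriv_regL χ hGRH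
  have hD2 := differentiableOn_log_add_ten
  set D : ℂ → ℂ := fun w => deriv (regL χ) (1 / 2 + w) / regL χ (1 / 2 + w)
      + C₀ * Complex.log (w + 10) with hDdef
  have hD : DifferentiableOn ℂ D {z | 0 < z.re} := hD1.add (hD2.const_mul _)
  have hV : ∀ z : ℂ, 0 < z.re → 0 < (D z).re := fun z hz => by
    simpa [hDdef, Complex.log_re] using hpos z hz
  set U : ℂ → ℝ := fun w => Real.log ‖regL χ (1 / 2 + w)‖ + C₀ * logPotential w with hU
  have hUv : ∀ x t : ℝ, 0 < x → ∀ y : ℝ,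
      HasDerivAt (fun y : ℝ => U (x + (t + y : ℝ) * I)) (-(D (x + (t + y : ℝ) * I)).im) y := by
    intro x t hx y
    refine ((hasDerivAt_log_norm_regL_vertical χ hGRH hx t y).fun_add
      ((hasDerivAt_logPotential_vertical hx.le t y).const_mul C₀)).congr_deriv ?_
    rw [hDdef, Complex.add_im, Complex.im_ofReal_mul]
    ring
  have hUh : ∀ t x : ℝ, 0 < x → HasDerivAt (fun x : ℝ => U (x + t * I)) (D (x + t * I)).re x := by
    intro t x hx
    refine ((hasDerivAt_log_norm_regL_horizontal χ hGRH t hx).fun_add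
      ((hasDerivAt_logPotential_horizontal t hx.le).const_mul C₀)).congr_deriv ?_
    rw [hDdef, Complex.add_re, Complex.re_ofReal_mul]
  have hs1 : (1 / 2 + t * I : ℂ) ≠ 1 := by
    intro h
    have := congrArg Complex.re h
    norm_num at this
  have hf0 : regL χ (1 / 2 + t * I) ≠ 0 := by
    rw [regL_eq χ hs1]
    refine mul_ne_zero ?_ hne
    split_ifs
    · exact sub_ne_zero.2 hs1
    · exact one_ne_zero
  have hUc : ContinuousWithinAt (fun x : ℝ => U (x + t * I)) (Set.Ici 0) 0 := by
    refine ContinuousAt.continuousWithinAt (ContinuousAt.add (ContinuousAt.log ?_ ?_) ?_)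
    · have := (regL_differentiable χ).continuous
      exact (by fun_prop : Continuous fun x : ℝ => ‖regL χ (1 / 2 + (x + t * I))‖).continuousAt
    · simpa using hf0
    · exact (hasDerivAt_logPotential_horizontal t le_rfl).continuousAt.const_mul C₀
  obtain ⟨h_int, hmain⟩ := hA D U t κ hκ0 hD hV hUv (fun x hx => hUh t x hx) hUc
  rw [← hσ] at h_int hmain
  set HU : ℝ → ℝ := fun x => ∫ y, h y * U (x + (t + κ * y : ℝ) * I) with hHU
  set HE : ℝ → ℝ := fun x => ∫ y, h y * logPotential (x + (t + κ * y : ℝ) * I) with hHE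
  have hE2 : ∀ z : ℂ, 0 < z.re → 0 < (Complex.log (z + 10)).re := fun z hz => re_log_add_ten_pos hz
  have hEv : ∀ x t : ℝ, 0 < x → ∀ y : ℝ, HasDerivAt (fun y : ℝ => logPotential (x + (t + y : ℝ) * I))
      (-(Complex.log (x + (t + y : ℝ) * I + 10)).im) y :=
    fun x t hx y => hasDerivAt_logPotential_vertical hx.le t y
  have hintU : ∀ x : ℝ, 0 < x → Integrable fun y => h y * U (x + (t + κ * y : ℝ) * I) :=
    fun x hx => hK.integrable_potential hD hV hκ0 hUv hx t
  have hintE : ∀ x : ℝ, 0 < x → Integrable fun y => h y * logPotential (x + (t + κ * y : ℝ) * I) :=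
    fun x hx => hK.integrable_potential hD2 hE2 hκ0 hEv hx t
  have hderiv : ∀ x : ℝ, 0 < x → HasDerivAt
      (fun x : ℝ => HU x - C₀ * HE x - (logPoly χ φ L N (1 / 2 + (x + t * I))).re)
      (if χ = 1 then IsKernelPair.poleTerm φ L (x + t * I - 1 / 2) else 0).re x := by
    intro x hx
    have d1 := hK.hasDerivAt_average_potential hD hV hκ0 hUv hUh hx t
    have d2 := hK.hasDerivAt_average_potential hD2 hE2 hκ0 hEv
      (fun t x hx => hasDerivAt_logPotential_horizontal t hx.le) hx t
    have d3 := Complex.reCLM.hasFDerivAt.comp_hasDerivAt x (hasDerivAt_logPoly (φ := φ) χ L N t x)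
    refine ((d1.fun_sub (d2.const_mul C₀)).fun_sub d3).congr_deriv ?_
    have hx' : 0 < ((x : ℂ) + t * I).re := by simpa using hx
    have i1 := hK.integrable_vertical hD hV hκ0 hx'
    have i2 := hK.integrable_vertical hD2 hE2 hκ0 hx'
    have key := integral_logDeriv_regL χ hK hL0 hGRH hN hx'
    simp only [Complex.add_re, Complex.ofReal_re, Complex.mul_re, Complex.I_re, mul_zero,
      Complex.ofReal_im, Complex.I_im, mul_one, sub_self, add_zero, Complex.add_im, Complex.mul_im,
      zero_add] at i1 i2 key
    rw [← hκ] at key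
    rw [Complex.reCLM_apply, ← Complex.re_ofReal_mul, ← Complex.sub_re, ← Complex.sub_re,
      ← integral_const_mul, ← integral_sub i1 (i2.const_mul _)]
    congr 1
    rw [sub_eq_iff_eq_add', ← key]
    refine integral_congr_ae (Eventually.of_forall fun y => ?_)
    simp only [hDdef]
    ring
  set X := σ + 2 with hX
  have hmv := (convex_Icc σ X).norm_image_sub_le_of_norm_hasDerivWithin_le
    (f := fun x : ℝ => HU x - C₀ * HE x - (logPoly χ φ L N (1 / 2 + (x + t * I))).re)
    (C := C₃) (x := σ) (y := X)
    (fun x hx => (hderiv x (hσ0.trans_le hx.1)).hasDerivWithinAt) (fun x hx => by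
      refine (Complex.abs_re_le_norm _).trans ?_
      split_ifs
      · have hx0 : 0 < x := hσ0.trans_le hx.1
        have him : t ≤ ‖(x : ℂ) + t * I - 1 / 2‖ := by
          have := Complex.im_le_norm ((x : ℂ) + t * I - 1 / 2)
          simpa using this
        have hz0 : (x : ℂ) + t * I - 1 / 2 ≠ 0 := norm_pos_iff.1 (by linarith)
        refine (hC₃ L hL0 _ hz0 (by simp; linarith)).trans ?_
        rw [div_le_iff₀ (by linarith)]
        have : Real.exp (L / 2) ≤ t := by
          rw [← Real.le_log_iff_exp_le (by linarith)]
          linarith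
        gcongr
        linarith
      · simpa using hC₃0) ⟨le_rfl, by linarith⟩ ⟨by linarith, le_rfl⟩
  have hXσ : X - σ = 2 := by rw [hX]; ring
  rw [hXσ, Real.norm_eq_abs, Real.norm_eq_abs, abs_of_pos (two_pos : (0 : ℝ) < 2)] at hmv
  have hmv := (abs_le.1 hmv).1
  set δt := if χ = 1 then Real.log t else 0 with hδt
  have hfar : HU X - C₀ * HE X ≤ δt + |C₁| * J := by
    have hX0 : 0 < X := by linarith
    have i1 := hintU X hX0
    have i2 := hintE X hX0
    have hb : ∀ y : ℝ, |Real.log ‖regL χ (1 / 2 + (X + (t + κ * y : ℝ) * I))‖ - δt|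
        ≤ |C₁| * (1 + |y|) ^ 1 := by
      intro y
      rw [pow_one]
      refine (hC₁ X t κ y (by linarith) (by linarith) ht1 hκ0.le hκκ).trans ?_
      gcongr
      exact le_abs_self _
    have h1 := (abs_le.1 (hK.abs_integral_mul_le hb)).2
    have h2 : ∫ y, h y * (Real.log ‖regL χ (1 / 2 + (X + (t + κ * y : ℝ) * I))‖ - δt)
        = HU X - C₀ * HE X - δt := by
      have h3 : ∀ y : ℝ, h y * (Real.log ‖regL χ (1 / 2 + (X + (t + κ * y : ℝ) * I))‖ - δt)
          = h y * U (X + (t + κ * y : ℝ) * I)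
            - C₀ * (h y * logPotential (X + (t + κ * y : ℝ) * I)) - h y * δt := by
        intro y
        simp only [hU]
        ring
      simp_rw [h3]
      have i3 : Integrable fun y => h y * U (X + (t + κ * y : ℝ) * I)
          - C₀ * (h y * logPotential (X + (t + κ * y : ℝ) * I)) := i1.sub (i2.const_mul C₀)
      rw [integral_sub i3 (hK.integrable.mul_const δt),
        integral_sub i1 (i2.const_mul C₀), integral_const_mul, integral_mul_const,
        hK.integral_eq_one, one_mul]
    rw [h2] at h1
    linarith
  have hpotv : HE σ - logPotential (σ + t * I) ≤ π * κ₀ * J := by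
    have hb : ∀ y : ℝ, |logPotential (σ + (t + κ * y : ℝ) * I) - logPotential (σ + t * I)|
        ≤ π * κ₀ * (1 + |y|) ^ 1 := by
      intro y
      refine (abs_logPotential_vertical_sub_le hσ0.le t (κ * y)).trans ?_
      rw [abs_mul, abs_of_pos hκ0, pow_one, mul_assoc]
      gcongr
      linarith
    have h1 := (abs_le.1 (hK.abs_integral_mul_le hb)).2
    simp_rw [mul_sub] at h1
    rw [integral_sub (hintE σ hσ0) (hK.integrable.mul_const _), integral_mul_const,
      hK.integral_eq_one, one_mul] at h1
    exact h1
  have hlog2t : Real.log 2 ≤ Real.log t := hL.trans hLt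
  have hlogt : 0 < Real.log t := hl2.trans_le hlog2t
  have hpoth : logPotential (σ + t * I) - logPotential (t * I)
      ≤ A * κ₀ * Real.log (A * κ₀ + 11) + σ * Real.log t := by
    refine (le_abs_self _).trans ((abs_logPotential_horizontal_sub_le hσ0.le (by linarith)).trans ?_)
    have h1 : Real.log (σ + t + 10) ≤ Real.log ((A * κ₀ + 11) * t) :=
      Real.log_le_log (by linarith) (by nlinarith)
    rw [Real.log_mul (by linarith) (by linarith)] at h1
    calc σ * Real.log (σ + t + 10) ≤ σ * (Real.log (A * κ₀ + 11) + Real.log t) := by gcongr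
      _ = σ * Real.log (A * κ₀ + 11) + σ * Real.log t := by ring
      _ ≤ _ := by gcongr
  have hSX : -C₂ ≤ (logPoly χ φ L N (1 / 2 + (X + t * I))).re := by
    have h1 := Complex.abs_re_le_norm (logPoly χ φ L N (1 / 2 + (X + t * I)))
    have h2 := hC₂ L N (1 / 2 + (X + t * I)) (by simp; linarith)
    linarith [(abs_le.1 (h1.trans h2)).1]
  have hleft : δt + Real.log ‖DirichletCharacter.LFunction χ (1 / 2 + t * I)‖
      ≤ U (t * I) - C₀ * logPotential (t * I) := by
    simp only [hU]
    rw [add_sub_cancel_right, regL_eq χ hs1, norm_mul, hδt]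
    have hLp : 0 < ‖DirichletCharacter.LFunction χ (1 / 2 + t * I)‖ := norm_pos_iff.2 hne
    split_ifs
    · have him : t ≤ ‖(1 / 2 + t * I : ℂ) - 1‖ := by
        have := Complex.im_le_norm ((1 / 2 + t * I : ℂ) - 1)
        simpa using this
      rw [Real.log_mul (by linarith) hLp.ne']
      have := Real.log_le_log (by linarith) him
      linarith
    · simp
  have hσt : σ * Real.log t = A * (2 * π) * (Real.log t / L) := by
    rw [hσ, hκ]; ring
  have hKt : K ≤ K * (Real.log t / L) :=
    le_mul_of_one_le_right hK0 ((one_le_div hL0).2 hLt)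
  have hfin : U (t * I) ≤ HU σ := hmain
  have hC₀v := mul_le_mul_of_nonneg_left hpotv hC₀.le
  have hC₀h := mul_le_mul_of_nonneg_left hpoth hC₀.le
  rw [hσt] at hC₀h
  have habs := le_abs_self C₂
  rw [add_mul]
  have hKexp : K = |C₁| * J + |C₂| + 2 * C₃
    + (C₀ * (A * κ₀ * Real.log (A * κ₀ + 11)) + C₀ * (π * κ₀ * J)) := by rw [hKdef]; ring
  rw [hKexp] at hKt ⊢
  have e1 : C₀ * (A * κ₀ * Real.log (A * κ₀ + 11) + A * (2 * π) * (Real.log t / L))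
    = C₀ * (A * κ₀ * Real.log (A * κ₀ + 11)) + C₀ * (A * (2 * π)) * (Real.log t / L) := by ring
  rw [e1] at hC₀h
  linarith

end PointwiseBound

section PrimePowers

theorem sum_range_of_isPrimePow {E : Type*} [AddCommMonoid E] {f : ℕ → E}
    (hf : ∀ n, ¬ IsPrimePow n → f n = 0) (N : ℕ) :
    ∑ n ∈ range N, f n = ∑ k ∈ Icc 1 N, ∑ p ∈ (Nat.primesBelow N).filter (· ^ k < N), f (p ^ k) := by
  simp_rw [Finset.sum_filter]
  rw [← Finset.sum_product', ← Finset.sum_filter]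
  have h1 : ∑ n ∈ range N, f n = ∑ n ∈ (range N).filter IsPrimePow, f n := by
    rw [Finset.sum_filter]
    refine Finset.sum_congr rfl fun n _ => ?_
    split_ifs with h
    · rfl
    · exact hf n h
  rw [h1]
  symm
  refine Finset.sum_bij (fun x _ => x.2 ^ x.1) ?_ ?_ ?_ fun _ _ => rfl
  · rintro ⟨k, p⟩ hx
    simp only [mem_filter, mem_product, mem_Icc, Nat.mem_primesBelow, mem_range] at hx ⊢
    exact ⟨hx.2, hx.1.2.2.isPrimePow.pow (by omega)⟩
  · rintro ⟨k, p⟩ hx ⟨k', p'⟩ hx' h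
    simp only [mem_filter, mem_product, mem_Icc, Nat.mem_primesBelow] at hx hx' h
    obtain ⟨h1, h2⟩ := Nat.Prime.pow_inj' hx.1.2.2 hx'.1.2.2 (by omega) (by omega) h
    simp [h1, h2]
  · intro n hn
    simp only [mem_filter, mem_range] at hn
    obtain ⟨p, k, hp, hk, rfl⟩ := (isPrimePow_nat_iff _).1 hn.2
    have h2 : k < p ^ k := Nat.lt_pow_self hp.one_lt
    have h3 : p ≤ p ^ k := Nat.le_self_pow hk.ne' p
    refine ⟨⟨k, p⟩, ?_, rfl⟩
    simp only [mem_filter, mem_product, mem_Icc, Nat.mem_primesBelow]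
    exact ⟨⟨⟨hk, by omega⟩, by omega, hp⟩, hn.1⟩

variable {q : ℕ} {φ h : ℝ → ℝ} (hK : IsKernelPair φ h)

theorem vonMangoldt_div_log_prime_pow {p k : ℕ} (hp : p.Prime) (hk : k ≠ 0) :
    Λ (p ^ k) / Real.log ((p ^ k : ℕ) : ℝ) = 1 / k := by
  have h0 : Real.log p ≠ 0 := (Real.log_pos (by exact_mod_cast hp.one_lt)).ne'
  rw [ArithmeticFunction.vonMangoldt_apply_pow hk, ArithmeticFunction.vonMangoldt_apply_prime hp]
  push_cast
  rw [Real.log_pow]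
  field_simp

include hK in
theorem exists_norm_logPoly_sub_le : ∃ C : ℝ, ∀ (χ : DirichletCharacter ℂ q) (L : ℝ) (N : ℕ) (s : ℂ),
    2 ≤ N → 1 / 2 ≤ s.re →
    ‖logPoly χ φ L N s - ∑ p ∈ Nat.primesBelow N, (φ (Real.log p / L) : ℂ) * χ p * (p : ℂ) ^ (-s)
      - ∑ p ∈ (Nat.primesBelow N).filter (· ^ 2 < N),
        ((1 / 2 * φ (2 * Real.log p / L) : ℝ) : ℂ) * χ p ^ 2 * (p : ℂ) ^ (-(2 * s))‖ ≤ C := by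
  have hsum : Summable fun n : ℕ => ((√(n : ℝ))⁻¹) ^ 3 := by
    have := Real.summable_nat_rpow_inv.2 (show (1 : ℝ) < 3 / 2 by norm_num)
    refine this.congr fun n => ?_
    rw [Real.sqrt_eq_rpow, inv_pow, ← Real.rpow_natCast, ← Real.rpow_mul (by positivity)]
    norm_num
  set r₀ : ℝ := (√(2 : ℝ))⁻¹ with hr₀
  have hr₀1 : r₀ < 1 := inv_lt_one_of_one_lt₀ (by rw [Real.lt_sqrt] <;> norm_num)
  refine ⟨(∑' n : ℕ, ((√(n : ℝ))⁻¹) ^ 3) / (1 - r₀), fun χ L N s hN hs => ?_⟩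
  set f : ℕ → ℂ := fun n => (Λ n / Real.log n * φ (Real.log n / L) : ℝ) * χ (n : ZMod q)
    * (n : ℂ) ^ (-s) with hf
  have hf0 : ∀ n, ¬ IsPrimePow n → f n = 0 := fun n hn => by
    simp [hf, ArithmeticFunction.vonMangoldt_eq_zero_iff.2 hn]
  have hval : ∀ p k : ℕ, p.Prime → k ≠ 0 → f (p ^ k) = ((1 / k * φ (k * Real.log p / L) : ℝ) : ℂ)
      * χ p ^ k * (p : ℂ) ^ (-(k * s)) := by
    intro p k hp hk
    simp only [hf]
    rw [vonMangoldt_div_log_prime_pow hp hk]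
    congr 1
    · push_cast
      rw [map_pow, Real.log_pow]
    · push_cast
      rw [← mul_neg, Complex.cpow_nat_mul, ← Complex.cpow_nat_mul', Complex.cpow_nat_mul]
      · rw [Complex.natCast_arg, mul_zero]
        exact neg_lt_zero.2 Real.pi_pos
      · rw [Complex.natCast_arg, mul_zero]
        exact Real.pi_pos.le
  have hb : ∀ p k : ℕ, p.Prime → k ≠ 0 → ‖f (p ^ k)‖ ≤ ((√(p : ℝ))⁻¹) ^ k := by
    intro p k hp hk
    have hp1 : (1 : ℝ) ≤ p := by exact_mod_cast hp.one_le
    have hk1 : (1 : ℝ) ≤ k := by exact_mod_cast Nat.one_le_iff_ne_zero.2 hk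
    rw [hval p k hp hk, norm_mul, norm_mul, norm_pow, Complex.norm_real, Real.norm_eq_abs,
      Complex.norm_natCast_cpow_of_pos hp.pos, abs_of_nonneg (mul_nonneg (by positivity) (hK.nonneg _))]
    have h1 : 1 / (k : ℝ) * φ (k * Real.log p / L) ≤ 1 :=
      mul_le_one₀ ((div_le_one (by linarith)).2 hk1) (hK.nonneg _) (hK.le_one _)
    have h2 : ‖χ p‖ ^ k ≤ 1 := pow_le_one₀ (norm_nonneg _) (χ.norm_le_one _)
    have h3 : (p : ℝ) ^ (-(k * s)).re ≤ ((√(p : ℝ))⁻¹) ^ k := by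
      rw [Real.sqrt_eq_rpow, ← Real.rpow_neg (by linarith), ← Real.rpow_natCast,
        ← Real.rpow_mul (by linarith)]
      refine Real.rpow_le_rpow_of_exponent_le hp1 ?_
      simp
      nlinarith
    calc _ ≤ 1 * 1 * ((√(p : ℝ))⁻¹) ^ k := by gcongr
      _ = _ := by ring
  have hsplit : logPoly χ φ L N s = ∑ k ∈ Icc 1 N, ∑ p ∈ (Nat.primesBelow N).filter (· ^ k < N),
      f (p ^ k) := by
    rw [← sum_range_of_isPrimePow hf0]
    rfl
  have hIcc : Icc 1 N = insert 1 (insert 2 (Ico 3 (N + 1))) := by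
    ext k
    simp only [mem_Icc, mem_insert, mem_Ico]
    omega
  rw [hsplit, hIcc, Finset.sum_insert (by simp), Finset.sum_insert (by simp)]
  have e1 : ∑ p ∈ (Nat.primesBelow N).filter (· ^ 1 < N), f (p ^ 1)
      = ∑ p ∈ Nat.primesBelow N, (φ (Real.log p / L) : ℂ) * χ p * (p : ℂ) ^ (-s) := by
    rw [Finset.filter_true_of_mem fun p hp => by
      rw [pow_one]; exact (Nat.mem_primesBelow.1 hp).1]
    refine Finset.sum_congr rfl fun p hp => ?_
    rw [hval p 1 (Nat.mem_primesBelow.1 hp).2 one_ne_zero]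
    simp
  have e2 : ∑ p ∈ (Nat.primesBelow N).filter (· ^ 2 < N), f (p ^ 2)
      = ∑ p ∈ (Nat.primesBelow N).filter (· ^ 2 < N),
        ((1 / 2 * φ (2 * Real.log p / L) : ℝ) : ℂ) * χ p ^ 2 * (p : ℂ) ^ (-(2 * s)) := by
    refine Finset.sum_congr rfl fun p hp => ?_
    rw [hval p 2 (Nat.mem_primesBelow.1 (mem_filter.1 hp).1).2 two_ne_zero]
    simp
  rw [e1, e2, add_sub_cancel_left, add_sub_cancel_left]
  refine (norm_sum_le _ _).trans ?_
  calc ∑ k ∈ Ico 3 (N + 1), ‖∑ p ∈ (Nat.primesBelow N).filter (· ^ k < N), f (p ^ k)‖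
      ≤ ∑ k ∈ Ico 3 (N + 1), ∑ p ∈ Nat.primesBelow N, ((√(p : ℝ))⁻¹) ^ k := by
        refine Finset.sum_le_sum fun k hk => (norm_sum_le _ _).trans ?_
        refine (Finset.sum_le_sum fun p hp => hb p k (Nat.mem_primesBelow.1 (mem_filter.1 hp).1).2
          (by have := (mem_Ico.1 hk).1; omega)).trans ?_
        exact Finset.sum_le_sum_of_subset_of_nonneg (filter_subset _ _) fun _ _ _ => by positivity
    _ = ∑ p ∈ Nat.primesBelow N, ∑ k ∈ Ico 3 (N + 1), ((√(p : ℝ))⁻¹) ^ k := Finset.sum_comm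
    _ ≤ ∑ p ∈ Nat.primesBelow N, ((√(p : ℝ))⁻¹) ^ 3 / (1 - r₀) := by
        refine Finset.sum_le_sum fun p hp => ?_
        have hp2 : (2 : ℝ) ≤ p := by exact_mod_cast (Nat.mem_primesBelow.1 hp).2.two_le
        have hr : (√(p : ℝ))⁻¹ ≤ r₀ := by rw [hr₀]; gcongr
        refine (geom_sum_Ico_le_of_lt_one (by positivity) (hr.trans_lt hr₀1)).trans ?_
        have : 0 < 1 - r₀ := by linarith
        gcongr
    _ = (∑ p ∈ Nat.primesBelow N, ((√(p : ℝ))⁻¹) ^ 3) / (1 - r₀) := by rw [Finset.sum_div]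
    _ ≤ _ := by
        have : 0 < 1 - r₀ := by linarith
        gcongr
        exact hsum.sum_le_tsum _ fun n _ => by positivity

end PrimePowers

section ProductBound

/-- The Dirichlet polynomial `∑ p ∈ S, a p * p ^ (-it)`. -/
noncomputable def dirPoly (S : Finset ℕ) (a : ℕ → ℂ) (t : ℝ) : ℂ :=
  ∑ n ∈ S, a n * (n : ℂ) ^ (-(t * I))

variable {q : ℕ} [NeZero q]

/-- Upper bound for the product of two L-functions on the critical line under GRH. -/
theorem exists_log_mul_norm_LFunction_le (hGRH : GRHmod q) (χ ν : DirichletCharacter ℂ q) :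
    ∃ C : ℝ, 0 < C ∧ ∀ L : ℝ, Real.log 2 ≤ L → ∃ a b : ℕ → ℂ,
      (∀ p : ℕ, p.Prime → ‖a p‖ ^ 2 ≤ ‖χ p + ν p‖ ^ 2 / p) ∧
      (∀ p : ℕ, p.Prime → ‖b p‖ ≤ 1 / p) ∧
      ∀ (N : ℕ) (t : ℝ), Real.exp L ≤ N → 2 ≤ t → L ≤ Real.log t →
        DirichletCharacter.LFunction χ (1 / 2 + t * I) ≠ 0 →
        DirichletCharacter.LFunction ν (1 / 2 + t * I) ≠ 0 →
        Real.log (‖DirichletCharacter.LFunction χ (1 / 2 + t * I)‖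
          * ‖DirichletCharacter.LFunction ν (1 / 2 + t * I)‖)
        ≤ ‖dirPoly (Nat.primesBelow N) a t‖
          + ‖dirPoly ((Nat.primesBelow N).filter (· ^ 2 < N)) b (2 * t)‖ + C * (Real.log t / L) := by
  obtain ⟨φ, h, hK⟩ := exists_isKernelPair
  obtain ⟨A, hA0, hA⟩ := exists_log_norm_LFunction_le hK hGRH
  obtain ⟨C₁, hC₁⟩ := hA χ
  obtain ⟨C₂, hC₂⟩ := hA ν
  obtain ⟨C₃, hC₃⟩ := exists_norm_logPoly_sub_le (q := q) hK
  refine ⟨|C₁| + |C₂| + 2 * |C₃| + 1, by positivity, fun L hL => ?_⟩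
  have hl2 : 0 < Real.log 2 := Real.log_pos (by norm_num)
  have hL0 : 0 < L := hl2.trans_le hL
  set w : ℂ := 1 / 2 + (A / L : ℝ) with hw
  have hwre : w.re = 1 / 2 + A / L := by rw [hw, Complex.add_re, Complex.ofReal_re]; norm_num
  have hAL : 0 ≤ A / L := by positivity
  refine ⟨fun p => (φ (Real.log p / L) : ℂ) * (χ p + ν p) * (p : ℂ) ^ (-w),
    fun p => ((1 / 2 * φ (2 * Real.log p / L) : ℝ) : ℂ) * (χ p ^ 2 + ν p ^ 2) * (p : ℂ) ^ (-(2 * w)),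
    fun p hp => ?_, fun p hp => ?_, fun N t hN ht hLt hχ hν => ?_⟩
  · have hp1 : (1 : ℝ) ≤ p := by exact_mod_cast hp.one_le
    rw [norm_mul, norm_mul, Complex.norm_real, Real.norm_eq_abs, abs_of_nonneg (hK.nonneg _),
      Complex.norm_natCast_cpow_of_pos hp.pos, mul_pow, mul_pow]
    have h1 : φ (Real.log p / L) ^ 2 ≤ 1 := pow_le_one₀ (hK.nonneg _) (hK.le_one _)
    have h2 : ((p : ℝ) ^ (-w).re) ^ 2 ≤ 1 / p := by
      rw [← Real.rpow_natCast, ← Real.rpow_mul (by linarith), one_div, ← Real.rpow_neg_one]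
      refine Real.rpow_le_rpow_of_exponent_le hp1 ?_
      rw [Complex.neg_re, hwre]
      push_cast
      linarith
    calc _ ≤ 1 * ‖χ p + ν p‖ ^ 2 * (1 / p) := by gcongr
      _ = _ := by ring
  · have hp1 : (1 : ℝ) ≤ p := by exact_mod_cast hp.one_le
    rw [norm_mul, norm_mul, Complex.norm_real, Real.norm_eq_abs,
      abs_of_nonneg (mul_nonneg (by norm_num) (hK.nonneg _)), Complex.norm_natCast_cpow_of_pos hp.pos]
    have h1 : 1 / 2 * φ (2 * Real.log p / L) ≤ 1 / 2 :=
      mul_le_of_le_one_right (by norm_num) (hK.le_one _)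
    have h2 : (p : ℝ) ^ (-(2 * w)).re ≤ 1 / p := by
      rw [one_div, ← Real.rpow_neg_one]
      refine Real.rpow_le_rpow_of_exponent_le hp1 ?_
      have e : (-(2 * w)).re = -(2 * w.re) := by simp
      rw [e, hwre]
      linarith
    have h3 : ‖χ p ^ 2 + ν p ^ 2‖ ≤ 2 := by
      refine (norm_add_le _ _).trans ?_
      rw [norm_pow, norm_pow]
      have e1 := pow_le_one₀ (n := 2) (norm_nonneg _) (χ.norm_le_one p)
      have e2 := pow_le_one₀ (n := 2) (norm_nonneg _) (ν.norm_le_one p)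
      linarith
    calc _ ≤ 1 / 2 * 2 * (1 / (p : ℝ)) := by
          have := hK.nonneg (2 * Real.log p / L)
          gcongr
      _ = _ := by ring
  · have hN2 : 2 ≤ N := by
      have : (2 : ℝ) ≤ N := by
        refine le_trans ?_ hN
        rwa [← Real.log_le_iff_le_exp (by norm_num)]
      exact_mod_cast this
    have hs : (1 / 2 + ((A / L : ℝ) + t * I) : ℂ) = w + t * I := by rw [hw]; ring
    have hsre : 1 / 2 ≤ (w + t * I).re := by simp [hwre]; exact hAL
    have b1 := hC₁ t L N ht hL hLt hN hχ
    have b2 := hC₂ t L N ht hL hLt hN hν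
    rw [hs] at b1 b2
    have d1 := hC₃ χ L N (w + t * I) hN2 hsre
    have d2 := hC₃ ν L N (w + t * I) hN2 hsre
    rw [Real.log_mul (norm_ne_zero_iff.2 hχ) (norm_ne_zero_iff.2 hν)]
    set P1 := ∑ p ∈ Nat.primesBelow N, (φ (Real.log p / L) : ℂ) * χ p * (p : ℂ) ^ (-(w + t * I))
    set P2 := ∑ p ∈ Nat.primesBelow N, (φ (Real.log p / L) : ℂ) * ν p * (p : ℂ) ^ (-(w + t * I))
    set Q1 := ∑ p ∈ (Nat.primesBelow N).filter (· ^ 2 < N),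
        ((1 / 2 * φ (2 * Real.log p / L) : ℝ) : ℂ) * χ p ^ 2 * (p : ℂ) ^ (-(2 * (w + t * I)))
    set Q2 := ∑ p ∈ (Nat.primesBelow N).filter (· ^ 2 < N),
        ((1 / 2 * φ (2 * Real.log p / L) : ℝ) : ℂ) * ν p ^ 2 * (p : ℂ) ^ (-(2 * (w + t * I)))
    have hP : dirPoly (Nat.primesBelow N)
        (fun p => (φ (Real.log p / L) : ℂ) * (χ p + ν p) * (p : ℂ) ^ (-w)) t = P1 + P2 := by
      rw [dirPoly, ← Finset.sum_add_distrib]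
      refine Finset.sum_congr rfl fun p hp => ?_
      have hp0 : (p : ℂ) ≠ 0 := by exact_mod_cast (Nat.mem_primesBelow.1 hp).2.ne_zero
      have e : -(w + t * I) = -w + -(t * I) := by ring
      rw [e, Complex.cpow_add _ _ hp0]
      ring
    have hQ : dirPoly ((Nat.primesBelow N).filter (· ^ 2 < N))
        (fun p => ((1 / 2 * φ (2 * Real.log p / L) : ℝ) : ℂ) * (χ p ^ 2 + ν p ^ 2)
          * (p : ℂ) ^ (-(2 * w))) (2 * t) = Q1 + Q2 := by
      rw [dirPoly, ← Finset.sum_add_distrib]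
      refine Finset.sum_congr rfl fun p hp => ?_
      have hp0 : (p : ℂ) ≠ 0 := by
        exact_mod_cast (Nat.mem_primesBelow.1 (mem_filter.1 hp).1).2.ne_zero
      have e : -(2 * (w + t * I)) = -(2 * w) + -(((2 * t : ℝ) : ℂ) * I) := by push_cast; ring
      rw [e, Complex.cpow_add _ _ hp0]
      ring
    rw [hP, hQ]
    have n1 := (Complex.re_le_norm _).trans d1
    have n2 := (Complex.re_le_norm _).trans d2
    simp only [Complex.sub_re] at n1 n2
    have r1 := Complex.re_le_norm (P1 + P2)
    have r2 := Complex.re_le_norm (Q1 + Q2)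
    simp only [Complex.add_re] at r1 r2
    have hr : 1 ≤ Real.log t / L := (one_le_div hL0).2 hLt
    have k1 : C₁ * (Real.log t / L) ≤ |C₁| * (Real.log t / L) := by
      gcongr
      exact le_abs_self _
    have k2 : C₂ * (Real.log t / L) ≤ |C₂| * (Real.log t / L) := by
      gcongr
      exact le_abs_self _
    have k3 : C₃ ≤ |C₃| * (Real.log t / L) :=
      (le_abs_self _).trans (le_mul_of_one_le_right (abs_nonneg _) hr)
    have e : (|C₁| + |C₂| + 2 * |C₃| + 1) * (Real.log t / L) = |C₁| * (Real.log t / L)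
      + |C₂| * (Real.log t / L) + 2 * (|C₃| * (Real.log t / L)) + Real.log t / L := by ring
    rw [e]
    linarith

end ProductBound

section Moments

theorem continuous_dirPoly {S : Finset ℕ} (hS : ∀ n ∈ S, 0 < n) (a : ℕ → ℂ) :
    Continuous (dirPoly S a) := by
  unfold dirPoly
  refine continuous_finsetSum _ fun n hn => ?_
  have : (n : ℂ) ≠ 0 := by exact_mod_cast (hS n hn).ne'
  refine continuous_const.mul (Continuous.const_cpow (by fun_prop) (Or.inl this))

theorem inv_le_abs_log_sub_log {m n X : ℕ} (hm : 0 < m) (hn : 0 < n) (hmX : m ≤ X) (hnX : n ≤ X)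
    (hmn : m ≠ n) : (X : ℝ)⁻¹ ≤ |Real.log m - Real.log n| := by
  wlog h : m < n generalizing m n
  · rw [abs_sub_comm]
    exact this hn hm hnX hmX hmn.symm (by omega)
  have hm' : (0 : ℝ) < m := by exact_mod_cast hm
  have hn' : (0 : ℝ) < n := by exact_mod_cast hn
  have h1 : (m : ℝ) + 1 ≤ n := by exact_mod_cast h
  have h2 : (n : ℝ) ≤ X := by exact_mod_cast hnX
  have h3 := Real.log_le_sub_one_of_pos (div_pos hm' hn')
  rw [Real.log_div hm'.ne' hn'.ne'] at h3
  have h4 : (m : ℝ) / n - 1 ≤ -(n : ℝ)⁻¹ := by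
    rw [div_sub_one hn'.ne', ← one_div, ← neg_div]
    gcongr
    linarith
  have h5 : (X : ℝ)⁻¹ ≤ (n : ℝ)⁻¹ := by gcongr
  have h6 := neg_le_abs (Real.log m - Real.log n)
  linarith

theorem norm_integral_exp_le {u : ℝ} (hu : u ≠ 0) (a b : ℝ) :
    ‖∫ t in a..b, Complex.exp (u * I * t)‖ ≤ 2 / |u| := by
  have hc : (u * I : ℂ) ≠ 0 := mul_ne_zero (by exact_mod_cast hu) I_ne_zero
  rw [integral_exp_mul_complex hc, norm_div, norm_mul, Complex.norm_real, Complex.norm_I, mul_one,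
    Real.norm_eq_abs]
  gcongr
  refine (norm_sub_le _ _).trans ?_
  have e : ∀ t : ℝ, ‖Complex.exp (u * I * t)‖ = 1 := fun t => by
    rw [show (u * I * t : ℂ) = ((u * t : ℝ) : ℂ) * I by push_cast; ring, Complex.norm_exp_ofReal_mul_I]
  rw [e, e]
  norm_num

/-- Mean value theorem for Dirichlet polynomials. -/
theorem integral_norm_dirPoly_sq_le {S : Finset ℕ} {X : ℕ} (hS : ∀ n ∈ S, 0 < n ∧ n ≤ X) (a : ℕ → ℂ)
    {T : ℝ} (hT : (X : ℝ) ^ 2 ≤ T) :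
    ∫ t in T..(2 * T), ‖dirPoly S a t‖ ^ 2 ≤ 3 * T * ∑ n ∈ S, ‖a n‖ ^ 2 := by
  have hT0 : 0 ≤ T := (sq_nonneg _).trans hT
  have hprod : ∀ t : ℝ, ((‖dirPoly S a t‖ ^ 2 : ℝ) : ℂ) = ∑ m ∈ S, ∑ n ∈ S,
      (starRingEnd ℂ (a m) * a n) * Complex.exp (((Real.log m - Real.log n : ℝ) : ℂ) * I * t) := by
    intro t
    push_cast
    rw [← Complex.conj_mul', dirPoly, map_sum, Finset.sum_mul_sum]
    refine Finset.sum_congr rfl fun m hm => Finset.sum_congr rfl fun n hn => ?_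
    have hm0 : (m : ℂ) ≠ 0 := by exact_mod_cast (hS m hm).1.ne'
    have hn0 : (n : ℂ) ≠ 0 := by exact_mod_cast (hS n hn).1.ne'
    rw [Complex.cpow_def_of_ne_zero hm0, Complex.cpow_def_of_ne_zero hn0, map_mul, ← Complex.exp_conj,
      mul_mul_mul_comm, ← Complex.exp_add]
    congr 2
    rw [← Complex.natCast_log, ← Complex.natCast_log]
    simp only [map_mul, map_neg, Complex.conj_ofReal, Complex.conj_I]
    push_cast
    ring
  have h_int : ((∫ t in T..(2 * T), ‖dirPoly S a t‖ ^ 2 : ℝ) : ℂ) = ∑ m ∈ S, ∑ n ∈ S,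
      (starRingEnd ℂ (a m) * a n)
        * ∫ t in T..(2 * T), Complex.exp (((Real.log m - Real.log n : ℝ) : ℂ) * I * t) := by
    rw [← intervalIntegral.integral_ofReal]
    simp_rw [hprod]
    rw [intervalIntegral.integral_finsetSum fun m _ => ?_]
    · refine Finset.sum_congr rfl fun m _ => ?_
      rw [intervalIntegral.integral_finsetSum fun n _ => ?_]
      · simp_rw [intervalIntegral.integral_const_mul]
      · exact (by fun_prop : Continuous _).intervalIntegrable _ _
    · exact (by fun_prop : Continuous _).intervalIntegrable _ _
  have hkey : ∀ m ∈ S, ∀ n ∈ S,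
      ‖∫ t in T..(2 * T), Complex.exp (((Real.log m - Real.log n : ℝ) : ℂ) * I * t)‖
        ≤ (if m = n then T else 0) + 2 * X := by
    intro m hm n hn
    split_ifs with h
    · subst h
      simp only [sub_self, Complex.ofReal_zero, zero_mul, Complex.exp_zero,
        intervalIntegral.integral_const]
      rw [norm_smul, norm_one, mul_one, Real.norm_eq_abs, abs_of_nonneg (by linarith)]
      have : (0 : ℝ) ≤ X := by positivity
      linarith
    · have h1 := inv_le_abs_log_sub_log (hS m hm).1 (hS n hn).1 (hS m hm).2 (hS n hn).2 h
      have hX0 : (0 : ℝ) < X := by exact_mod_cast (hS m hm).1.trans_le (hS m hm).2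
      have h2 : 0 < |Real.log m - Real.log n| := (inv_pos.2 hX0).trans_le h1
      refine (norm_integral_exp_le (abs_pos.1 h2) _ _).trans ?_
      rw [zero_add, div_eq_mul_inv]
      gcongr
      exact inv_le_of_inv_le₀ hX0 h1
  have hcard : (S.card : ℝ) ≤ X := by
    have h1 : S ⊆ Icc 1 X := fun n hn => mem_Icc.2 (hS n hn)
    have h2 := Finset.card_le_card h1
    rw [Nat.card_Icc] at h2
    exact_mod_cast (by omega : S.card ≤ X)
  have hCS : (∑ n ∈ S, ‖a n‖) ^ 2 ≤ X * ∑ n ∈ S, ‖a n‖ ^ 2 :=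
    sq_sum_le_card_mul_sum_sq.trans (by gcongr)
  have hint0 : 0 ≤ ∫ t in T..(2 * T), ‖dirPoly S a t‖ ^ 2 :=
    intervalIntegral.integral_nonneg (by linarith) fun t _ => by positivity
  calc ∫ t in T..(2 * T), ‖dirPoly S a t‖ ^ 2
      = ‖((∫ t in T..(2 * T), ‖dirPoly S a t‖ ^ 2 : ℝ) : ℂ)‖ := by
        rw [Complex.norm_real, Real.norm_eq_abs, abs_of_nonneg hint0]
    _ ≤ ∑ m ∈ S, ∑ n ∈ S, (‖a m‖ * ‖a n‖) * ((if m = n then T else 0) + 2 * X) := by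
        rw [h_int]
        refine (norm_sum_le _ _).trans (Finset.sum_le_sum fun m hm => (norm_sum_le _ _).trans
          (Finset.sum_le_sum fun n hn => ?_))
        rw [norm_mul, norm_mul, RCLike.norm_conj]
        gcongr
        exact hkey m hm n hn
    _ = T * ∑ n ∈ S, ‖a n‖ ^ 2 + 2 * X * (∑ n ∈ S, ‖a n‖) ^ 2 := by
        simp_rw [mul_add, Finset.sum_add_distrib]
        congr 1
        · rw [Finset.mul_sum]
          refine Finset.sum_congr rfl fun m hm => ?_
          simp only [mul_ite, mul_zero, Finset.sum_ite_eq, hm, if_true]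
          ring
        · rw [sq, Finset.sum_mul_sum, Finset.mul_sum]
          refine Finset.sum_congr rfl fun m _ => ?_
          rw [Finset.mul_sum]
          refine Finset.sum_congr rfl fun n _ => ?_
          ring
    _ ≤ T * ∑ n ∈ S, ‖a n‖ ^ 2 + 2 * X * (X * ∑ n ∈ S, ‖a n‖ ^ 2) := by gcongr
    _ = (T + 2 * (X : ℝ) ^ 2) * ∑ n ∈ S, ‖a n‖ ^ 2 := by ring
    _ ≤ _ := by
        have : 0 ≤ ∑ n ∈ S, ‖a n‖ ^ 2 := Finset.sum_nonneg fun _ _ => by positivity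
        gcongr
        linarith

/-- There are at most `m!` ways of writing an integer as an ordered product of `m` primes. -/
theorem card_filter_prod_eq_le_factorial {S : Finset ℕ} (hS : ∀ p ∈ S, p.Prime) (m n : ℕ) :
    ((Fintype.piFinset fun _ : Fin m => S).filter fun f => ∏ i, f i = n).card ≤ m.factorial := by
  set Fib := (Fintype.piFinset fun _ : Fin m => S).filter fun f => ∏ i, f i = n with hFib
  rcases Fib.eq_empty_or_nonempty with h0 | ⟨f₀, hf₀⟩
  · simp [h0]
  have hperm : ∀ f ∈ Fib, (List.ofFn f).Perm n.primeFactorsList := by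
    intro f hf
    rw [hFib, mem_filter, Fintype.mem_piFinset] at hf
    refine Nat.primeFactorsList_unique (by rw [List.prod_ofFn, hf.2]) fun p hp => ?_
    obtain ⟨i, rfl⟩ := (List.mem_ofFn' _ _).1 hp
    exact hS _ (hf.1 i)
  have hlen : n.primeFactorsList.length = m := by
    rw [← (hperm f₀ hf₀).length_eq, List.length_ofFn]
  calc Fib.card ≤ n.primeFactorsList.permutations.toFinset.card := by
        refine Finset.card_le_card_of_injOn List.ofFn (fun f hf => ?_) List.ofFn_injective.injOn
        rw [Finset.mem_coe, List.mem_toFinset, List.mem_permutations]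
        exact hperm f hf
    _ ≤ n.primeFactorsList.permutations.length := List.toFinset_card_le _
    _ = m.factorial := by rw [List.length_permutations, hlen]

theorem prod_natCast_cpow {ι : Type*} (s : Finset ι) (f : ι → ℕ) (z : ℂ) :
    ∏ i ∈ s, (f i : ℂ) ^ z = ((∏ i ∈ s, f i : ℕ) : ℂ) ^ z := by
  induction s using Finset.induction_on with
  | empty => simp
  | insert i s hi ih =>
    rw [Finset.prod_insert hi, Finset.prod_insert hi, ih, Nat.cast_mul,
      Complex.natCast_mul_natCast_cpow]

/-- High moments of Dirichlet polynomials supported on primes. -/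
theorem integral_norm_dirPoly_pow_le {S : Finset ℕ} (hS : ∀ p ∈ S, p.Prime) {x : ℕ}
    (hx : ∀ p ∈ S, p ≤ x) (a : ℕ → ℂ) (m : ℕ) {T : ℝ} (hT : (x : ℝ) ^ (2 * m) ≤ T) :
    ∫ t in T..(2 * T), ‖dirPoly S a t‖ ^ (2 * m)
      ≤ 3 * T * (m.factorial * (∑ p ∈ S, ‖a p‖ ^ 2) ^ m) := by
  set F := Fintype.piFinset fun _ : Fin m => S with hF
  set R := F.image fun f => ∏ i, f i with hR
  set b : ℕ → ℂ := fun n => ∑ f ∈ F.filter fun f => ∏ i, f i = n, ∏ i, a (f i) with hb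
  have hmaps : ∀ f ∈ F, (fun f : Fin m → ℕ => ∏ i, f i) f ∈ R := fun f hf =>
    Finset.mem_image_of_mem _ hf
  have hpow : ∀ t : ℝ, dirPoly S a t ^ m = dirPoly R b t := by
    intro t
    have h1 : dirPoly S a t ^ m = ∏ _i : Fin m, dirPoly S a t := by simp
    rw [h1]
    unfold dirPoly
    rw [Finset.prod_univ_sum, ← hF, ← Finset.sum_fiberwise_of_maps_to hmaps]
    refine Finset.sum_congr rfl fun n _ => ?_
    rw [hb, Finset.sum_mul]
    refine Finset.sum_congr rfl fun f hf => ?_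
    rw [Finset.prod_mul_distrib, ← (mem_filter.1 hf).2]
    congr 1
    exact prod_natCast_cpow _ _ _
  have hRX : ∀ n ∈ R, 0 < n ∧ n ≤ x ^ m := by
    intro n hn
    obtain ⟨f, hf, rfl⟩ := Finset.mem_image.1 hn
    have hf' := Fintype.mem_piFinset.1 hf
    refine ⟨Finset.prod_pos fun i _ => (hS _ (hf' i)).pos, ?_⟩
    refine (Finset.prod_le_pow_card _ _ x fun i _ => hx _ (hf' i)).trans_eq ?_
    simp
  have hmv := integral_norm_dirPoly_sq_le (X := x ^ m) hRX b (T := T) (by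
    push_cast
    rwa [← pow_mul, mul_comm])
  have hsq : ∀ t : ℝ, ‖dirPoly S a t‖ ^ (2 * m) = ‖dirPoly R b t‖ ^ 2 := fun t => by
    rw [← hpow, norm_pow, ← pow_mul, mul_comm]
  simp_rw [hsq]
  refine hmv.trans ?_
  have hT0 : 0 ≤ T := le_trans (by positivity) hT
  gcongr
  calc ∑ n ∈ R, ‖b n‖ ^ 2
      ≤ ∑ n ∈ R, (m.factorial : ℝ) * ∑ f ∈ F.filter fun f => ∏ i, f i = n, ∏ i, ‖a (f i)‖ ^ 2 := by
        refine Finset.sum_le_sum fun n _ => ?_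
        have h1 : ‖b n‖ ≤ ∑ f ∈ F.filter fun f => ∏ i, f i = n, ∏ i, ‖a (f i)‖ := by
          refine (norm_sum_le _ _).trans_eq (Finset.sum_congr rfl fun f _ => norm_prod _ _)
        calc ‖b n‖ ^ 2 ≤ (∑ f ∈ F.filter fun f => ∏ i, f i = n, ∏ i, ‖a (f i)‖) ^ 2 := by gcongr
          _ ≤ _ := sq_sum_le_card_mul_sum_sq
          _ ≤ _ := by
            simp_rw [← Finset.prod_pow]
            gcongr
            exact card_filter_prod_eq_le_factorial hS m n
    _ = (m.factorial : ℝ) * ∑ f ∈ F, ∏ i, ‖a (f i)‖ ^ 2 := by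
        rw [← Finset.mul_sum, Finset.sum_fiberwise_of_maps_to hmaps]
    _ = _ := by
        rw [hF, ← Finset.prod_univ_sum (fun _ => S) fun _ p => ‖a p‖ ^ 2]
        simp

end Moments

section PrimeSums

/-- The coefficients of the Dirichlet series of `log ζ(σ)`. -/
noncomputable def logZetaTerm (σ : ℝ) (n : ℕ) : ℝ := Λ n / Real.log n * (n : ℝ) ^ (-σ)

theorem vonMangoldt_div_log_nonneg (n : ℕ) : 0 ≤ Λ n / Real.log n :=
  div_nonneg ArithmeticFunction.vonMangoldt_nonneg (Real.log_natCast_nonneg n)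

theorem logZetaTerm_nonneg (σ : ℝ) (n : ℕ) : 0 ≤ logZetaTerm σ n :=
  mul_nonneg (vonMangoldt_div_log_nonneg n) (by positivity)

theorem logZetaTerm_prime (σ : ℝ) {p : ℕ} (hp : p.Prime) : logZetaTerm σ p = (p : ℝ) ^ (-σ) := by
  have := vonMangoldt_div_log_prime_pow hp one_ne_zero
  simp only [pow_one, Nat.cast_one, div_one] at this
  rw [logZetaTerm, this, one_mul]

theorem logZetaTerm_antitone {σ τ : ℝ} (h : σ ≤ τ) (n : ℕ) : logZetaTerm τ n ≤ logZetaTerm σ n := by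
  rcases eq_or_ne n 0 with rfl | hn
  · simp [logZetaTerm]
  have hn1 : (1 : ℝ) ≤ n := by exact_mod_cast Nat.one_le_iff_ne_zero.2 hn
  exact mul_le_mul_of_nonneg_left (Real.rpow_le_rpow_of_exponent_le hn1 (by linarith))
    (vonMangoldt_div_log_nonneg n)

theorem exists_hasSum_logZetaTerm {q : ℕ} [NeZero q] (ψ : DirichletCharacter ℂ q) {σ : ℝ}
    (hσ : 1 < σ) : ∃ S : ℝ, HasSum (fun n : ℕ => (ψ n).re * logZetaTerm σ n) S ∧
      Real.exp S = ‖DirichletCharacter.LFunction ψ σ‖ := by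
  have hs : 1 < (σ : ℂ).re := hσ
  have hsum : LSeriesSummable (fun n : ℕ => ψ n * Λ n / Real.log n) σ := by
    refine LSeriesSummable_of_bounded_of_one_lt_re (m := 1) (fun n _ => ?_) hs
    rw [mul_div_assoc, ← Complex.ofReal_div, norm_mul, Complex.norm_real, Real.norm_eq_abs,
      abs_of_nonneg (vonMangoldt_div_log_nonneg n)]
    exact mul_le_one₀ (ψ.norm_le_one _) (vonMangoldt_div_log_nonneg n)
      (div_le_one_of_le₀ ArithmeticFunction.vonMangoldt_le_log (Real.log_natCast_nonneg n))
  refine ⟨(LSeries (fun n : ℕ => ψ n * Λ n / Real.log n) σ).re, ?_, ?_⟩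
  · have e : (fun n : ℕ => (ψ n).re * logZetaTerm σ n) = fun n : ℕ => Complex.reCLM
        (LSeries.term (fun n : ℕ => ψ n * Λ n / Real.log n) σ n) := ?_
    · rw [e]
      exact Complex.reCLM.hasSum hsum.hasSum
    funext n
    rcases eq_or_ne n 0 with rfl | hn
    · simp [logZetaTerm]
    have h1 : (n : ℂ) ^ (-(σ : ℂ)) = ((n : ℝ) ^ (-σ) : ℝ) := by
      rw [Complex.ofReal_cpow (by positivity)]
      push_cast
      rfl
    rw [Complex.reCLM_apply, LSeries.term_of_ne_zero hn, div_eq_mul_inv _ (_ ^ _),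
      ← Complex.cpow_neg, h1, mul_div_assoc, ← Complex.ofReal_div, mul_assoc, ← Complex.ofReal_mul,
      Complex.re_mul_ofReal, logZetaTerm]
  · rw [← Complex.norm_exp, DirichletCharacter.LSeries_eq_exp_LSeries ψ hs,
      DirichletCharacter.LFunction_eq_LSeries ψ hs]

theorem exists_hasSum_logZetaTerm_one {δ : ℝ} (hδ : 0 < δ) : ∃ S : ℝ,
    HasSum (logZetaTerm (1 + δ)) S ∧ S ≤ Real.log (4 + 1 / δ) ∧
      (δ ≤ 1 / 4 → Real.log (1 / (2 * δ)) ≤ S) := by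
  obtain ⟨S, h1, h2⟩ := exists_hasSum_logZetaTerm (1 : DirichletCharacter ℂ 1)
    (show (1 : ℝ) < 1 + δ by linarith)
  have hre : (1 : ℝ) < ((1 + δ : ℝ) : ℂ).re := by rw [Complex.ofReal_re]; linarith
  have hre0 : (0 : ℝ) < ((1 + δ : ℝ) : ℂ).re := by linarith
  have h3 := LSeries_eq_charInt (1 : DirichletCharacter ℂ 1) hre
  have h4 := norm_charInt_le (1 : DirichletCharacter ℂ 1) hre0
  have hm : charMean (1 : DirichletCharacter ℂ 1) = 1 := by
    simp [charMean, MulChar.one_apply (isUnit_of_subsingleton _)]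
  set c := charInt (1 : DirichletCharacter ℂ 1) ((1 + δ : ℝ) : ℂ) with hc
  have hδ' : (δ : ℂ) ≠ 0 := by exact_mod_cast hδ.ne'
  have h5 : DirichletCharacter.LFunction (1 : DirichletCharacter ℂ 1) ((1 + δ : ℝ) : ℂ)
      = ((1 + δ : ℝ) : ℂ) * c + ((1 / δ + 1 : ℝ) : ℂ) := by
    rw [h3, hm]
    push_cast
    rw [add_sub_cancel_left]
    field_simp
  have h6 : ‖((1 + δ : ℝ) : ℂ) * c‖ ≤ 3 := by
    rw [norm_mul, Complex.norm_real, Real.norm_eq_abs, abs_of_pos (by linarith)]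
    rw [Complex.ofReal_re, le_div_iff₀ (by linarith)] at h4
    push_cast at h4
    linarith
  have h7 : ‖((1 / δ + 1 : ℝ) : ℂ)‖ = 1 / δ + 1 := by
    rw [Complex.norm_real, Real.norm_eq_abs, abs_of_pos (by positivity)]
  rw [h5] at h2
  refine ⟨S, ?_, ?_, fun hδ4 => ?_⟩
  · simpa [MulChar.one_apply (isUnit_of_subsingleton _)] using h1
  · rw [Real.le_log_iff_exp_le (by positivity), h2]
    exact (norm_add_le _ _).trans (by rw [h7]; linarith)
  · rw [Real.log_le_iff_le_exp (by positivity), h2]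
    have h8 := norm_sub_norm_le ((1 / δ + 1 : ℝ) : ℂ) (-(((1 + δ : ℝ) : ℂ) * c))
    rw [norm_neg, h7, sub_neg_eq_add, add_comm ((1 / δ + 1 : ℝ) : ℂ)] at h8
    have h9 : 4 ≤ 1 / δ := by rw [le_div_iff₀ hδ]; linarith
    have h10 : 1 / (2 * δ) = 1 / δ / 2 := by field_simp
    rw [h10]
    linarith

variable {q : ℕ} [NeZero q]

omit [NeZero q] in
theorem norm_add_sq_le (χ ν : DirichletCharacter ℂ q) (a : ZMod q) :
    ‖χ a + ν a‖ ^ 2 ≤ 2 + 2 * ((χ * ν⁻¹) a).re := by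
  have h1 : ‖χ a + ν a‖ ^ 2 = ‖χ a‖ ^ 2 + ‖ν a‖ ^ 2 + 2 * (χ a * starRingEnd ℂ (ν a)).re := by
    rw [← Complex.normSq_eq_norm_sq, ← Complex.normSq_eq_norm_sq, ← Complex.normSq_eq_norm_sq,
      Complex.normSq_add]
  have h2 := pow_le_one₀ (n := 2) (norm_nonneg _) (χ.norm_le_one a)
  have h3 := pow_le_one₀ (n := 2) (norm_nonneg _) (ν.norm_le_one a)
  have h4 : starRingEnd ℂ (ν a) = ν⁻¹ a := MulChar.star_apply' ν a
  rw [h1, MulChar.mul_apply, ← h4]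
  linarith

theorem exp_neg_mul_inv_le_logZetaTerm {p N : ℕ} (hp : p.Prime) (hpN : p ≤ N) {η : ℝ} (hη : 0 ≤ η) :
    Real.exp (-η) * (1 / p) ≤ logZetaTerm (1 + η / Real.log N) p := by
  have hp0 : (0 : ℝ) < p := by exact_mod_cast hp.pos
  have hlp : 0 < Real.log p := Real.log_pos (by exact_mod_cast hp.one_lt)
  have hl : Real.log p ≤ Real.log N := Real.log_le_log hp0 (by exact_mod_cast hpN)
  rw [logZetaTerm_prime _ hp, neg_add, Real.rpow_add hp0, Real.rpow_neg_one, mul_comm, one_div]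
  gcongr
  rw [Real.rpow_def_of_pos hp0, Real.exp_le_exp]
  have : Real.log p * (η / Real.log N) ≤ η := by
    rw [← mul_div_assoc, div_le_iff₀ (hlp.trans_le hl), mul_comm]
    gcongr
  linarith

/-- Upper bound for `∑ |χ(p) + ν(p)|² / p` for distinct characters. -/
theorem exists_sum_norm_add_sq_div_le {χ ν : DirichletCharacter ℂ q} (hne : χ ≠ ν) {ε : ℝ}
    (hε : 0 < ε) : ∃ C : ℝ, 0 ≤ C ∧ ∀ N : ℕ, 3 ≤ N →
      ∑ p ∈ Nat.primesBelow N, ‖χ p + ν p‖ ^ 2 / p ≤ (2 + ε) * Real.log (Real.log N) + C := by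
  set η := Real.log (1 + ε / 2) with hη
  have hη0 : 0 < η := Real.log_pos (by linarith)
  have hexp : Real.exp η = 1 + ε / 2 := Real.exp_log (by linarith)
  have hψ : χ * ν⁻¹ ≠ 1 := fun h => hne (mul_inv_eq_one.1 h)
  refine ⟨(2 + ε) * (|Real.log (4 + 1 / η)| + Real.log (2 * q + 1)), ?_, fun N hN => ?_⟩
  · have : 0 ≤ Real.log (2 * q + 1) := Real.log_nonneg (by linarith [(Nat.cast_nonneg q : (0 : ℝ) ≤ q)])
    positivity
  have hlN : 1 ≤ Real.log N := by
    rw [Real.le_log_iff_exp_le (by positivity)]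
    have : (3 : ℝ) ≤ N := by exact_mod_cast hN
    linarith [Real.exp_one_lt_three]
  set δ := η / Real.log N with hδ
  have hδ0 : 0 < δ := by positivity
  obtain ⟨S, hS, hS1, -⟩ := exists_hasSum_logZetaTerm_one hδ0
  obtain ⟨S', hS', hS'1⟩ := exists_hasSum_logZetaTerm (χ * ν⁻¹) (show (1 : ℝ) < 1 + δ by linarith)
  have hre : (1 : ℝ) < ((1 + δ : ℝ) : ℂ).re := by rw [Complex.ofReal_re]; linarith
  have hS'2 : S' ≤ Real.log (2 * q + 1) := by
    rw [Real.le_log_iff_exp_le (by positivity), hS'1, LSeries_eq_charInt _ hre,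
      charMean_eq_zero _ hψ, zero_div, add_zero, norm_mul, Complex.norm_real, Real.norm_eq_abs,
      abs_of_pos (by linarith)]
    have := norm_charInt_le (χ * ν⁻¹) (by linarith : (0 : ℝ) < ((1 + δ : ℝ) : ℂ).re)
    rw [Complex.ofReal_re, le_div_iff₀ (by linarith)] at this
    linarith
  have hS2 : S ≤ |Real.log (4 + 1 / η)| + Real.log (Real.log N) := by
    refine hS1.trans ?_
    have h1 : 4 + 1 / δ ≤ (4 + 1 / η) * Real.log N := by
      rw [hδ, one_div_div, add_mul, div_mul_eq_mul_div, one_mul]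
      linarith
    have h2 := Real.log_le_log (by positivity) h1
    rw [Real.log_mul (by positivity) (by linarith)] at h2
    linarith [le_abs_self (Real.log (4 + 1 / η))]
  have hT : HasSum (fun n : ℕ => (2 + 2 * ((χ * ν⁻¹) n).re) * logZetaTerm (1 + δ) n)
      (2 * S + 2 * S') := by
    have e : (fun n : ℕ => (2 + 2 * ((χ * ν⁻¹) n).re) * logZetaTerm (1 + δ) n) = fun n : ℕ =>
        2 * logZetaTerm (1 + δ) n + 2 * (((χ * ν⁻¹) n).re * logZetaTerm (1 + δ) n) := by
      funext n
      ring
    rw [e]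
    exact (hS.mul_left 2).add (hS'.mul_left 2)
  have hnn : ∀ n : ℕ, 0 ≤ 2 + 2 * ((χ * ν⁻¹) n).re := fun n =>
    (sq_nonneg _).trans (norm_add_sq_le χ ν n)
  have hmain : Real.exp (-η) * ∑ p ∈ Nat.primesBelow N, ‖χ p + ν p‖ ^ 2 / p ≤ 2 * S + 2 * S' := by
    rw [Finset.mul_sum]
    refine le_trans (Finset.sum_le_sum fun p hp => ?_) (sum_le_hasSum (Nat.primesBelow N)
      (fun n _ => mul_nonneg (hnn n) (logZetaTerm_nonneg _ n)) hT)
    have hp' := Nat.mem_primesBelow.1 hp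
    calc Real.exp (-η) * (‖χ p + ν p‖ ^ 2 / p) = ‖χ p + ν p‖ ^ 2 * (Real.exp (-η) * (1 / p)) := by ring
      _ ≤ _ := mul_le_mul (norm_add_sq_le χ ν p)
        (exp_neg_mul_inv_le_logZetaTerm hp'.2 hp'.1.le hη0.le) (by positivity) (hnn p)
  rw [Real.exp_neg, hexp, inv_mul_le_iff₀ (by linarith)] at hmain
  calc _ ≤ _ := hmain
    _ ≤ (1 + ε / 2) * (2 * (|Real.log (4 + 1 / η)| + Real.log (Real.log N))
        + 2 * Real.log (2 * q + 1)) := by gcongr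
    _ = _ := by ring

omit [NeZero q] in
theorem norm_add_sq_le_four (χ ν : DirichletCharacter ℂ q) (a : ZMod q) : ‖χ a + ν a‖ ^ 2 ≤ 4 := by
  have := norm_add_le (χ a) (ν a)
  nlinarith [χ.norm_le_one a, ν.norm_le_one a, norm_nonneg (χ a + ν a)]

/-- Upper bound for the sum of `1 / p` over primes in a long interval. -/
theorem exists_sum_inv_primes_le : ∃ C : ℝ, 0 < C ∧ ∀ z N : ℕ, 8 ≤ Real.log z → z ≤ N →
    ∑ p ∈ (Nat.primesBelow N).filter (z ≤ ·), (1 / p : ℝ)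
      ≤ C * Real.log (8 * (Real.log N / Real.log z)) := by
  have hc : 0 < Real.exp (-1) - Real.exp (-2) := sub_pos.2 (Real.exp_lt_exp.2 (by norm_num))
  refine ⟨(Real.exp (-1) - Real.exp (-2))⁻¹, inv_pos.2 hc, fun z N hz hzN => ?_⟩
  have hz0 : (0 : ℝ) < z := by
    rcases Nat.eq_zero_or_pos z with rfl | h
    · norm_num at hz
    · exact_mod_cast h
  have hl : Real.log z ≤ Real.log N := Real.log_le_log hz0 (by exact_mod_cast hzN)
  have hlN : 0 < Real.log N := by linarith
  have hδ1 : 0 < 1 / Real.log N := by positivity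
  have hδ2 : 0 < 2 / Real.log z := by
    have : 0 < Real.log z := by linarith
    positivity
  have hδ : 1 / Real.log N ≤ 2 / Real.log z := by
    rw [div_le_div_iff₀ hlN (by linarith)]
    linarith
  obtain ⟨S₁, h1, h1', -⟩ := exists_hasSum_logZetaTerm_one hδ1
  obtain ⟨S₂, h2, -, h2'⟩ := exists_hasSum_logZetaTerm_one hδ2
  have h2'' := h2' (by rw [div_le_iff₀ (by linarith)]; linarith)
  have hsub := h1.sub h2
  have hmain : (Real.exp (-1) - Real.exp (-2)) * ∑ p ∈ (Nat.primesBelow N).filter (z ≤ ·), (1 / p : ℝ)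
      ≤ S₁ - S₂ := by
    rw [Finset.mul_sum]
    refine le_trans (Finset.sum_le_sum fun p hp => ?_)
      (sum_le_hasSum ((Nat.primesBelow N).filter (z ≤ ·)) (fun n _ => ?_) hsub)
    · rw [mem_filter, Nat.mem_primesBelow] at hp
      have hp0 : (0 : ℝ) < p := by exact_mod_cast hp.1.2.pos
      have e1 := exp_neg_mul_inv_le_logZetaTerm hp.1.2 hp.1.1.le zero_le_one
      have e2 : logZetaTerm (1 + 2 / Real.log z) p ≤ Real.exp (-2) * (1 / p) := by
        rw [logZetaTerm_prime _ hp.1.2, neg_add, Real.rpow_add hp0, Real.rpow_neg_one, mul_comm,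
          one_div]
        gcongr
        rw [Real.rpow_def_of_pos hp0, Real.exp_le_exp]
        have hzp : Real.log z ≤ Real.log p := Real.log_le_log hz0 (by exact_mod_cast hp.2)
        have : 2 ≤ Real.log p * (2 / Real.log z) := by
          rw [← mul_div_assoc, le_div_iff₀ (by linarith)]
          linarith
        linarith
      rw [sub_mul]
      linarith
    · exact sub_nonneg.2 (logZetaTerm_antitone (by linarith) n)
  rw [le_inv_mul_iff₀ hc]
  refine hmain.trans ((sub_le_sub h1' h2'').trans ?_)
  have hlz : 0 < Real.log z := by linarith
  rw [← Real.log_div (by positivity) (by positivity)]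
  refine Real.log_le_log (by positivity) ?_
  have e : (4 + 1 / (1 / Real.log N)) / (1 / (2 * (2 / Real.log z))) = 4 * (4 + Real.log N) / Real.log z := by
    field_simp
    ring
  rw [e, ← mul_div_assoc]
  exact div_le_div_of_nonneg_right (by linarith) hlz.le

end PrimeSums

section MomentBounds

theorem integral_norm_dirPoly_pow_le_of_exp {S : Finset ℕ} (hS : ∀ p ∈ S, p.Prime) {X : ℝ}
    (hX : ∀ p ∈ S, (p : ℝ) ≤ Real.exp X) (a : ℕ → ℂ) (m : ℕ) {T : ℝ} (hT0 : 0 < T)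
    (hT : 2 * m * X ≤ Real.log T) {W : ℝ} (hW : ∑ p ∈ S, ‖a p‖ ^ 2 ≤ W) :
    ∫ t in T..(2 * T), ‖dirPoly S a t‖ ^ (2 * m) ≤ 3 * T * (m.factorial * W ^ m) := by
  have h1 : ((⌊Real.exp X⌋₊ : ℕ) : ℝ) ^ (2 * m) ≤ T := by
    calc ((⌊Real.exp X⌋₊ : ℕ) : ℝ) ^ (2 * m) ≤ (Real.exp X) ^ (2 * m) := by
          gcongr
          exact Nat.floor_le (Real.exp_pos _).le
      _ = Real.exp (2 * m * X) := by
          rw [← Real.exp_nat_mul]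
          push_cast
          rfl
      _ ≤ T := by rwa [← Real.le_log_iff_exp_le hT0]
  refine (integral_norm_dirPoly_pow_le hS (fun p hp => Nat.le_floor (hX p hp)) a m h1).trans ?_
  have : 0 ≤ ∑ p ∈ S, ‖a p‖ ^ 2 := Finset.sum_nonneg fun _ _ => by positivity
  gcongr

theorem integral_norm_dirPoly_div_pow_le {S : Finset ℕ} (hS : ∀ p ∈ S, p.Prime) {X : ℝ}
    (hX : ∀ p ∈ S, (p : ℝ) ≤ Real.exp X) (a : ℕ → ℂ) (m : ℕ) {T : ℝ} (hT0 : 0 < T)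
    (hT : 2 * m * X ≤ Real.log T) {W : ℝ} (hW : ∑ p ∈ S, ‖a p‖ ^ 2 ≤ W) (V : ℝ) :
    ∫ t in T..(2 * T), (‖dirPoly S a t‖ / V) ^ (2 * m) ≤ 3 * T * (m * W / V ^ 2) ^ m := by
  have hW0 : 0 ≤ W := le_trans (Finset.sum_nonneg fun _ _ => by positivity) hW
  simp_rw [div_pow]
  rw [intervalIntegral.integral_div]
  have h1 := integral_norm_dirPoly_pow_le_of_exp hS hX a m hT0 hT hW
  have h2 : (m.factorial : ℝ) ≤ (m : ℝ) ^ m := by exact_mod_cast Nat.factorial_le_pow m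
  calc _ ≤ 3 * T * (m.factorial * W ^ m) / V ^ (2 * m) := by
        have : 0 ≤ V ^ (2 * m) := (even_two_mul m).pow_nonneg V
        gcongr
    _ ≤ 3 * T * ((m : ℝ) ^ m * W ^ m) / V ^ (2 * m) := by
        have : 0 ≤ V ^ (2 * m) := (even_two_mul m).pow_nonneg V
        gcongr
    _ = _ := by
        rw [mul_pow, ← pow_mul, mul_div_assoc]

theorem integral_norm_dirPoly_two_mul_div_pow_le {S : Finset ℕ} (hS : ∀ p ∈ S, p.Prime) {X : ℝ}
    (hX : ∀ p ∈ S, (p : ℝ) ≤ Real.exp X) (a : ℕ → ℂ) (m : ℕ) {T : ℝ} (hT0 : 0 < T)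
    (hT : 2 * m * X ≤ Real.log T) {W : ℝ} (hW : ∑ p ∈ S, ‖a p‖ ^ 2 ≤ W) (V : ℝ) :
    ∫ t in T..(2 * T), (‖dirPoly S a (2 * t)‖ / V) ^ (2 * m) ≤ 3 * T * (m * W / V ^ 2) ^ m := by
  have h1 := intervalIntegral.integral_comp_mul_left (a := T) (b := 2 * T)
    (fun t => (‖dirPoly S a t‖ / V) ^ (2 * m)) (two_ne_zero : (2 : ℝ) ≠ 0)
  rw [h1]
  have h2 := integral_norm_dirPoly_div_pow_le hS hX a m (T := 2 * T) (by linarith)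
    (hT.trans (Real.log_le_log hT0 (by linarith))) hW V
  rw [smul_eq_mul]
  linarith

theorem exp_le_four_mul_sum {y : ℝ} (hy : 0 ≤ y) {n : ℕ} (hn : y ≤ n) :
    Real.exp y ≤ 4 * ∑ m ∈ range (n + 1), y ^ (2 * m) / ((2 * m).factorial : ℝ) := by
  have hb : ∀ x : ℝ, |x| = y → Real.exp x ≤ ∑ j ∈ range (2 * n), x ^ j / (j.factorial : ℝ)
      + y ^ (2 * n) / ((2 * n).factorial : ℝ) * 2 := by
    intro x hx
    have hxn : ‖(x : ℂ)‖ = y := by rw [Complex.norm_real, Real.norm_eq_abs, hx]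
    have h1 := Complex.exp_bound' (x := x) (n := 2 * n) (by
      rw [hxn, div_le_iff₀ (by positivity)]
      push_cast
      linarith)
    have h2 : Complex.exp x - ∑ j ∈ range (2 * n), (x : ℂ) ^ j / (j.factorial : ℂ)
        = ((Real.exp x - ∑ j ∈ range (2 * n), x ^ j / (j.factorial : ℝ) : ℝ) : ℂ) := by
      push_cast
      rfl
    rw [h2, hxn, Complex.norm_real, Real.norm_eq_abs] at h1
    linarith [le_abs_self (Real.exp x - ∑ j ∈ range (2 * n), x ^ j / (j.factorial : ℝ))]
  have h1 := hb y (abs_of_nonneg hy)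
  have h2 := hb (-y) (by rw [abs_neg, abs_of_nonneg hy])
  have h3 : ∑ j ∈ range (2 * n), y ^ j / (j.factorial : ℝ)
      + ∑ j ∈ range (2 * n), (-y) ^ j / (j.factorial : ℝ)
      = 2 * ∑ m ∈ range n, y ^ (2 * m) / ((2 * m).factorial : ℝ) := by
    clear h1 h2 hb hn
    induction n with
    | zero => simp
    | succ n ih =>
      rw [show 2 * (n + 1) = 2 * n + 1 + 1 by ring, Finset.sum_range_succ, Finset.sum_range_succ,
        Finset.sum_range_succ (fun j => (-y) ^ j / (j.factorial : ℝ)),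
        Finset.sum_range_succ (fun j => (-y) ^ j / (j.factorial : ℝ)),
        Finset.sum_range_succ _ n, mul_add, ← ih, (even_two_mul n).neg_pow,
        (even_two_mul n).add_one.neg_pow]
      ring
  rw [Finset.sum_range_succ]
  have h4 : 0 ≤ ∑ m ∈ range n, y ^ (2 * m) / ((2 * m).factorial : ℝ) :=
    Finset.sum_nonneg fun _ _ => by positivity
  have h5 := Real.exp_pos (-y)
  linarith

theorem factorial_div_factorial_two_mul_le (m : ℕ) :
    (m.factorial : ℝ) / (2 * m).factorial ≤ (2 * m + 1) * ((1 / 4) ^ m / m.factorial) := by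
  have h1 : 4 ^ m ≤ (2 * m + 1) * m.centralBinom := by
    rcases Nat.eq_zero_or_pos m with rfl | hm
    · simp
    · have := Nat.four_pow_le_two_mul_self_mul_centralBinom m hm
      nlinarith
  have h2 : m.centralBinom * m.factorial * m.factorial = (2 * m).factorial := by
    have := Nat.choose_mul_factorial_mul_factorial (show m ≤ 2 * m by omega)
    rwa [show 2 * m - m = m by omega] at this
  have h1' : (4 : ℝ) ^ m ≤ (2 * m + 1) * m.centralBinom := by exact_mod_cast h1
  have h2' : (m.centralBinom : ℝ) * m.factorial * m.factorial = (2 * m).factorial := by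
    exact_mod_cast h2
  have hf : (0 : ℝ) < m.factorial := by exact_mod_cast m.factorial_pos
  have hc : (0 : ℝ) < m.centralBinom := by exact_mod_cast m.centralBinom_pos
  rw [← h2', div_le_iff₀ (by positivity), one_div_pow]
  have e : (2 * m + 1) * (1 / (4 : ℝ) ^ m / m.factorial) * (m.centralBinom * m.factorial * m.factorial)
      = ((2 * m + 1) * m.centralBinom) / (4 : ℝ) ^ m * m.factorial := by
    field_simp
  rw [e]
  exact le_mul_of_one_le_left hf.le ((one_le_div (by positivity)).2 h1')

/-- Exponential moments of Dirichlet polynomials, truncated at a finite order. -/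
theorem integral_exp_moment_le {S : Finset ℕ} (hS : ∀ p ∈ S, p.Prime) {X : ℝ} (hX0 : 0 ≤ X)
    (hX : ∀ p ∈ S, (p : ℝ) ≤ Real.exp X) (a : ℕ → ℂ) (n : ℕ) {T : ℝ} (hT0 : 0 < T)
    (hT : 2 * n * X ≤ Real.log T) {W : ℝ} (hW : ∑ p ∈ S, ‖a p‖ ^ 2 ≤ W) (κ : ℝ) :
    ∫ t in T..(2 * T), ∑ m ∈ range (n + 1), (κ * ‖dirPoly S a t‖) ^ (2 * m) / ((2 * m).factorial : ℝ)
      ≤ 3 * T * (2 * n + 1) * Real.exp (κ ^ 2 * W / 4) := by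
  have hW0 : 0 ≤ W := le_trans (Finset.sum_nonneg fun _ _ => by positivity) hW
  have hcont := continuous_dirPoly (fun p hp => (hS p hp).pos) a
  rw [intervalIntegral.integral_finsetSum fun m _ =>
    (by fun_prop : Continuous fun t => (κ * ‖dirPoly S a t‖) ^ (2 * m)
      / ((2 * m).factorial : ℝ)).intervalIntegrable _ _]
  have hterm : ∀ m ∈ range (n + 1),
      ∫ t in T..(2 * T), (κ * ‖dirPoly S a t‖) ^ (2 * m) / ((2 * m).factorial : ℝ)
        ≤ 3 * T * (2 * n + 1) * ((κ ^ 2 * W / 4) ^ m / m.factorial) := by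
    intro m hm
    have hmn : (m : ℝ) ≤ n := by exact_mod_cast Nat.lt_succ_iff.1 (mem_range.1 hm)
    have h1 := integral_norm_dirPoly_pow_le_of_exp hS hX a m hT0 (le_trans (by gcongr) hT) hW
    simp_rw [mul_pow]
    rw [intervalIntegral.integral_div, intervalIntegral.integral_const_mul]
    have hκ : 0 ≤ κ ^ (2 * m) := (even_two_mul m).pow_nonneg κ
    calc _ ≤ κ ^ (2 * m) * (3 * T * (m.factorial * W ^ m)) / ((2 * m).factorial : ℝ) := by gcongr
      _ = 3 * T * κ ^ (2 * m) * W ^ m * ((m.factorial : ℝ) / (2 * m).factorial) := by ring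
      _ ≤ 3 * T * κ ^ (2 * m) * W ^ m * ((2 * n + 1) * ((1 / 4) ^ m / m.factorial)) := by
        refine mul_le_mul_of_nonneg_left ((factorial_div_factorial_two_mul_le m).trans ?_)
          (by positivity)
        gcongr
      _ = _ := by
        rw [div_pow (κ ^ 2 * W), mul_pow (κ ^ 2), ← pow_mul, one_div_pow]
        ring
  refine (Finset.sum_le_sum hterm).trans ?_
  rw [← Finset.mul_sum]
  gcongr
  exact Real.sum_le_exp_of_nonneg (by positivity) _

end MomentBounds

section LogMajorant

theorem sum_inv_primesBelow_le {N : ℕ} (hN : 3 ≤ N) :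
    ∑ p ∈ Nat.primesBelow N, (1 / p : ℝ) ≤ 3 * (Real.log (Real.log N) + 2) := by
  have hN0 : (0 : ℝ) < N := by exact_mod_cast (by omega : 0 < N)
  have hlog : 1 ≤ Real.log N := by
    rw [Real.le_log_iff_exp_le hN0]
    exact Real.exp_one_lt_three.le.trans (by exact_mod_cast hN)
  obtain ⟨S, h1, h2, -⟩ := exists_hasSum_logZetaTerm_one (δ := 1 / Real.log N) (by positivity)
  have h3 : ∑ p ∈ Nat.primesBelow N, Real.exp (-1) * (1 / p : ℝ) ≤ S := by
    refine (Finset.sum_le_sum fun p hp => exp_neg_mul_inv_le_logZetaTerm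
      (Nat.prime_of_mem_primesBelow hp) (Nat.lt_of_mem_primesBelow hp).le zero_le_one).trans ?_
    exact sum_le_hasSum _ (fun p _ => logZetaTerm_nonneg _ p) h1
  rw [← Finset.mul_sum] at h3
  have h4 : S ≤ Real.log (Real.log N) + 2 := by
    refine h2.trans ?_
    have h5 : Real.log 5 ≤ 2 := by
      rw [Real.log_le_iff_le_exp (by norm_num), show (2 : ℝ) = 1 + 1 by norm_num, Real.exp_add]
      nlinarith [Real.exp_one_gt_d9]
    calc Real.log (4 + 1 / (1 / Real.log N)) ≤ Real.log (5 * Real.log N) :=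
          Real.log_le_log (by positivity) (by rw [one_div_one_div]; linarith)
      _ = Real.log 5 + Real.log (Real.log N) := Real.log_mul (by norm_num) (by positivity)
      _ ≤ _ := by linarith
  have h6 : Real.exp 1 * Real.exp (-1) = 1 := by rw [← Real.exp_add]; simp
  have h7 := Real.exp_one_lt_three
  have h8 : 0 ≤ Real.log (Real.log N) := Real.log_nonneg hlog
  have h9 : (0 : ℝ) ≤ ∑ p ∈ Nat.primesBelow N, (1 / p : ℝ) :=
    Finset.sum_nonneg fun _ _ => by positivity
  calc ∑ p ∈ Nat.primesBelow N, (1 / p : ℝ)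
      = Real.exp 1 * (Real.exp (-1) * ∑ p ∈ Nat.primesBelow N, (1 / p : ℝ)) := by
        rw [← mul_assoc, h6, one_mul]
    _ ≤ Real.exp 1 * (Real.log (Real.log N) + 2) := by gcongr; linarith
    _ ≤ _ := by gcongr

theorem two_le_ceil_exp {L : ℝ} (hL : Real.log 2 ≤ L) : 2 ≤ ⌈Real.exp L⌉₊ := by
  have h1 := (Real.log_le_iff_le_exp (by norm_num)).1 hL
  exact_mod_cast h1.trans (Nat.le_ceil _)

theorem log_ceil_exp_le {L : ℝ} (hL : Real.log 2 ≤ L) : Real.log ⌈Real.exp L⌉₊ ≤ 2 * L := by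
  have h1 := (Real.log_le_iff_le_exp (by norm_num)).1 hL
  have h2 : (2 : ℝ) ≤ ⌈Real.exp L⌉₊ := by exact_mod_cast two_le_ceil_exp hL
  rw [Real.log_le_iff_le_exp (by linarith), two_mul, Real.exp_add]
  have := Nat.ceil_lt_add_one (Real.exp_pos L).le
  nlinarith

theorem le_exp_of_mem_primesBelow_ceil {L : ℝ} {p : ℕ} (hp : p ∈ Nat.primesBelow ⌈Real.exp L⌉₊) :
    (p : ℝ) ≤ Real.exp L :=
  (Nat.lt_ceil.1 (Nat.lt_of_mem_primesBelow hp)).le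

theorem primesBelow_two : Nat.primesBelow 2 = ∅ := by decide

theorem log_log_ceil_exp_le {L Y : ℝ} (hL : Real.log 2 ≤ L) (hLY : 2 * L ≤ Y) :
    Real.log (Real.log ⌈Real.exp L⌉₊) ≤ Real.log Y := by
  refine Real.log_le_log (Real.log_pos ?_) ((log_ceil_exp_le hL).trans hLY)
  exact_mod_cast two_le_ceil_exp hL

theorem sum_inv_primesBelow_ceil_le {L Y : ℝ} (hL : Real.log 2 ≤ L) (hLY : 2 * L ≤ Y)
    (hY : 2 ≤ Real.log Y) : ∑ p ∈ Nat.primesBelow ⌈Real.exp L⌉₊, (1 / p : ℝ) ≤ 6 * Real.log Y := by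
  rcases (two_le_ceil_exp hL).eq_or_lt with h | h
  · rw [← h, primesBelow_two, Finset.sum_empty]
    linarith
  · have := sum_inv_primesBelow_le h
    have := log_log_ceil_exp_le hL hLY
    linarith

theorem sum_inv_sq_primesBelow_le (N : ℕ) :
    ∑ p ∈ Nat.primesBelow N, (1 / p : ℝ) ^ 2 ≤ 2 := by
  have h1 := sum_Ioo_inv_sq_le (α := ℝ) 0 N
  refine le_trans (le_trans ?_ h1) (by norm_num)
  calc ∑ p ∈ Nat.primesBelow N, (1 / p : ℝ) ^ 2 = ∑ p ∈ Nat.primesBelow N, ((p : ℝ) ^ 2)⁻¹ :=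
        Finset.sum_congr rfl fun p _ => by rw [one_div, inv_pow]
    _ ≤ _ := Finset.sum_le_sum_of_subset_of_nonneg (fun p hp => mem_Ioo.2
        ⟨(Nat.prime_of_mem_primesBelow hp).pos, Nat.lt_of_mem_primesBelow hp⟩)
        fun _ _ _ => by positivity

/-- The prime-squares part of the majorant of `log F`. -/
noncomputable def sqPoly (b : ℝ → ℕ → ℂ) (L t : ℝ) : ℂ :=
  dirPoly ((Nat.primesBelow ⌈Real.exp L⌉₊).filter (· ^ 2 < ⌈Real.exp L⌉₊)) (b L) (2 * t)

/-- `F` is majorized, at every length `exp L`, by the exponential of short Dirichlet polynomials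
over primes and squares of primes, with coefficients `a L` and `b L`. -/
structure IsLogMajorant (F : ℝ → ℝ) (c : ℝ) (a b : ℝ → ℕ → ℂ) : Prop where
  pos : 0 < c
  norm_sq_le : ∀ L, Real.log 2 ≤ L → ∀ p : ℕ, p.Prime → ‖a L p‖ ^ 2 ≤ 4 / p
  norm_le : ∀ L, Real.log 2 ≤ L → ∀ p : ℕ, p.Prime → ‖b L p‖ ≤ 1 / p
  sum_le : ∀ ε : ℝ, 0 < ε → ∃ C : ℝ, 0 ≤ C ∧ ∀ L Y, Real.log 2 ≤ L → 2 * L ≤ Y → 2 ≤ Real.log Y →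
    ∑ p ∈ Nat.primesBelow ⌈Real.exp L⌉₊, ‖a L p‖ ^ 2 ≤ (2 + ε) * Real.log Y + C
  log_le : ∀ L t, Real.log 2 ≤ L → 2 ≤ t → L ≤ Real.log t → 0 < F t →
    Real.log (F t) ≤ ‖dirPoly (Nat.primesBelow ⌈Real.exp L⌉₊) (a L) t‖ + ‖sqPoly b L t‖
      + c * (Real.log t / L)

theorem exists_isLogMajorant {q : ℕ} [NeZero q] (hGRH : GRHmod q) {χ ν : DirichletCharacter ℂ q}
    (hne : χ ≠ ν) : ∃ c a b, IsLogMajorant (fun t => ‖DirichletCharacter.LFunction χ (1 / 2 + t * I)‖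
      * ‖DirichletCharacter.LFunction ν (1 / 2 + t * I)‖) c a b := by
  obtain ⟨c, hc, h⟩ := exists_log_mul_norm_LFunction_le hGRH χ ν
  choose! a b h using h
  refine ⟨c, a, b, hc, fun L hL p hp => ((h L hL).1 p hp).trans ?_, fun L hL => (h L hL).2.1,
    fun ε hε => ?_, fun L t hL ht hLt hF => ?_⟩
  · have := norm_add_sq_le_four χ ν (p : ZMod q)
    gcongr
  · obtain ⟨C, hC0, hC⟩ := exists_sum_norm_add_sq_div_le hne hε
    refine ⟨C, hC0, fun L Y hL hLY hY => ?_⟩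
    rcases (two_le_ceil_exp hL).eq_or_lt with h2 | h2
    · rw [← h2, primesBelow_two, Finset.sum_empty]
      nlinarith
    · refine (Finset.sum_le_sum fun p hp => (h L hL).1 p (Nat.prime_of_mem_primesBelow hp)).trans
        ((hC _ h2).trans ?_)
      have := log_log_ceil_exp_le hL hLY
      gcongr
  · refine (h L hL).2.2 _ t (Nat.le_ceil _) ht hLt ?_ ?_
    · exact norm_ne_zero_iff.1 (left_ne_zero_of_mul hF.ne')
    · exact norm_ne_zero_iff.1 (right_ne_zero_of_mul hF.ne')

namespace IsLogMajorant

variable {F : ℝ → ℝ} {c : ℝ} {a b : ℝ → ℕ → ℂ}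

theorem norm_sqPoly_le (h : IsLogMajorant F c a b) {L Y : ℝ} (hL : Real.log 2 ≤ L) (hLY : 2 * L ≤ Y)
    (hY : 2 ≤ Real.log Y) (t : ℝ) : ‖sqPoly b L t‖ ≤ 6 * Real.log Y := by
  rw [sqPoly, dirPoly]
  refine le_trans (norm_sum_le _ _) (le_trans (Finset.sum_le_sum_of_subset_of_nonneg
    (Finset.filter_subset _ _) fun _ _ _ => norm_nonneg _) (le_trans (Finset.sum_le_sum fun p hp => ?_)
    (sum_inv_primesBelow_ceil_le hL hLY hY)))
  have hp' := Nat.prime_of_mem_primesBelow hp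
  have h0 : (p : ℂ) ≠ 0 := by exact_mod_cast hp'.ne_zero
  have h1 : ‖(p : ℂ) ^ (-((2 * t : ℝ) * I))‖ = 1 := by
    rw [Complex.norm_natCast_cpow_of_pos hp'.pos]
    simp
  rw [norm_mul]
  rw [h1, mul_one]
  exact h.norm_le L hL p hp'

theorem sqPoly_log_two (t : ℝ) : sqPoly b (Real.log 2) t = 0 := by
  rw [sqPoly, Real.exp_log (by norm_num), Nat.ceil_ofNat, primesBelow_two, Finset.filter_empty]
  simp [dirPoly]

theorem log_le_of_log_two (h : IsLogMajorant F c a b) {t : ℝ} (ht : 2 ≤ t) (hF : 0 < F t) :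
    Real.log (F t) ≤ c * (Real.log t / Real.log 2) := by
  have h1 := h.log_le (Real.log 2) t le_rfl ht (Real.log_le_log (by norm_num) ht) hF
  rw [sqPoly_log_two, Real.exp_log (by norm_num), Nat.ceil_ofNat, primesBelow_two] at h1
  simpa [dirPoly] using h1

end IsLogMajorant

end LogMajorant

section LargeValues

theorem log_mem_Icc_of_mem_Icc {T t : ℝ} (hT : 2 ≤ T) (ht : t ∈ Set.Icc T (2 * T)) :
    Real.log t ∈ Set.Icc (Real.log T) (2 * Real.log T) := by
  have hT0 : 0 < T := by linarith
  refine ⟨Real.log_le_log hT0 ht.1, ?_⟩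
  have h1 : Real.log t ≤ Real.log (T * T) :=
    Real.log_le_log (hT0.trans_le ht.1) (ht.2.trans (by nlinarith))
  rw [Real.log_mul hT0.ne' hT0.ne'] at h1
  linarith

theorem sum_range_exp_neg_le (M : ℕ) : ∑ v ∈ range M, Real.exp (-v) ≤ 2 := by
  have h1 : Real.exp (-1) ≤ 1 / 2 := by
    rw [Real.exp_neg, ← one_div]
    exact one_div_le_one_div_of_le (by norm_num) (by linarith [Real.exp_one_gt_d9])
  calc ∑ v ∈ range M, Real.exp (-v) ≤ ∑ v ∈ range M, (1 / 2 : ℝ) ^ v := by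
        refine Finset.sum_le_sum fun v _ => ?_
        rw [show (-v : ℝ) = v * (-1) by ring, Real.exp_nat_mul]
        exact pow_le_pow_left₀ (Real.exp_pos _).le h1 v
    _ ≤ 2 := sum_geometric_two_le M

namespace IsLogMajorant

variable {F : ℝ → ℝ} {c : ℝ} {a b : ℝ → ℕ → ℂ}

theorem sum_norm_sq_le (h : IsLogMajorant F c a b) {L Y : ℝ} (hL : Real.log 2 ≤ L) (hLY : 2 * L ≤ Y)
    (hY : 2 ≤ Real.log Y) :
    ∑ p ∈ Nat.primesBelow ⌈Real.exp L⌉₊, ‖a L p‖ ^ 2 ≤ 24 * Real.log Y := by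
  calc ∑ p ∈ Nat.primesBelow ⌈Real.exp L⌉₊, ‖a L p‖ ^ 2
      ≤ ∑ p ∈ Nat.primesBelow ⌈Real.exp L⌉₊, 4 * (1 / p : ℝ) := by
        refine Finset.sum_le_sum fun p hp => ?_
        rw [mul_one_div]
        exact h.norm_sq_le L hL p (Nat.prime_of_mem_primesBelow hp)
    _ ≤ 24 * Real.log Y := by
        rw [← Finset.mul_sum]
        linarith [sum_inv_primesBelow_ceil_le hL hLY hY]

theorem half_le_norm_dirPoly (h : IsLogMajorant F c a b) {T v : ℝ} (hT : 2 ≤ T)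
    (hY : 2 ≤ Real.log (Real.log T)) (hv : 24 * Real.log (Real.log T) ≤ v) (hvc : 16 * c ≤ v)
    {t : ℝ} (ht : t ∈ Set.Icc T (2 * T)) (hF : 0 < F t) (hFv : v ≤ Real.log (F t)) :
    Real.log 2 ≤ 8 * c * Real.log T / v ∧ v / 2 ≤ ‖dirPoly (Nat.primesBelow
      ⌈Real.exp (8 * c * Real.log T / v)⌉₊) (a (8 * c * Real.log T / v)) t‖ := by
  have hc := h.pos
  have hlog := log_mem_Icc_of_mem_Icc hT ht
  set Y := Real.log T with hYdef
  have hY0 : 0 < Y := Real.log_pos (by linarith)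
  have hv0 : 0 < v := by linarith
  have hl2 : 0 < Real.log 2 := Real.log_pos (by norm_num)
  have ht2 : 2 ≤ t := hT.trans ht.1
  have hvM : v * Real.log 2 ≤ 2 * c * Y := by
    have h1 := hFv.trans (h.log_le_of_log_two ht2 hF)
    rw [← mul_div_assoc, le_div_iff₀ hl2] at h1
    nlinarith [hlog.2]
  have hL : Real.log 2 ≤ 8 * c * Y / v := by
    rw [le_div_iff₀ hv0]
    nlinarith
  have hLY : 2 * (8 * c * Y / v) ≤ Y := by
    rw [← mul_div_assoc, div_le_iff₀ hv0]
    nlinarith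
  have hLt : 8 * c * Y / v ≤ Real.log t := by linarith [hlog.1]
  have h1 := h.log_le _ t hL ht2 hLt hF
  have h2 := h.norm_sqPoly_le hL hLY hY t
  have h3 : c * (Real.log t / (8 * c * Y / v)) ≤ v / 4 := by
    calc c * (Real.log t / (8 * c * Y / v)) ≤ c * (2 * Y / (8 * c * Y / v)) := by
          gcongr
          exact hlog.2
      _ = v / 4 := by field_simp; norm_num
  exact ⟨hL, by linarith⟩

theorem integral_norm_dirPoly_div_half_pow_le (h : IsLogMajorant F c a b) {T v : ℝ} (hT : 2 ≤ T)
    (hY : 2 ≤ Real.log (Real.log T)) (hv : 24 * Real.log (Real.log T) ≤ v) (hvc : 16 * c ≤ v)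
    (hL : Real.log 2 ≤ 8 * c * Real.log T / v) {B : ℝ} (hB : 0 ≤ B)
    (hvB : 6 * Real.exp (32 * c * B) * Real.log (Real.log T) ≤ c * v) :
    ∫ t in T..(2 * T), (‖dirPoly (Nat.primesBelow ⌈Real.exp (8 * c * Real.log T / v)⌉₊)
      (a (8 * c * Real.log T / v)) t‖ / (v / 2)) ^ (2 * ⌊v / (16 * c)⌋₊)
      ≤ 3 * T * Real.exp (-(B * v)) := by
  have hc := h.pos
  set Y := Real.log T with hYdef
  have hY0 : 0 < Y := Real.log_pos (by linarith)
  have hv0 : 0 < v := by linarith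
  have hLY : 2 * (8 * c * Y / v) ≤ Y := by
    rw [← mul_div_assoc, div_le_iff₀ hv0]
    nlinarith
  set m := ⌊v / (16 * c)⌋₊ with hm
  have hm1 : (m : ℝ) ≤ v / (16 * c) := Nat.floor_le (by positivity)
  have hm2 : v ≤ 32 * c * m := by
    have h1 : 1 ≤ m := Nat.le_floor (by rw [Nat.cast_one, le_div_iff₀ (by positivity)]; linarith)
    have h2 : v / (16 * c) < m + 1 := Nat.lt_floor_add_one _
    have h3 : (1 : ℝ) ≤ m := by exact_mod_cast h1
    rw [div_lt_iff₀ (by positivity)] at h2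
    nlinarith
  have h1 := integral_norm_dirPoly_div_pow_le (fun p hp => Nat.prime_of_mem_primesBelow hp)
    (fun p hp => le_exp_of_mem_primesBelow_ceil hp) (a (8 * c * Y / v)) m (T := T) (by linarith)
    (by
      calc 2 * m * (8 * c * Y / v) ≤ 2 * (v / (16 * c)) * (8 * c * Y / v) := by gcongr
        _ = Y := by field_simp; norm_num)
    (h.sum_norm_sq_le hL hLY hY) (v / 2)
  refine h1.trans ?_
  have hT0 : 0 < T := by linarith
  gcongr
  have h2 : m * (24 * Real.log Y) / (v / 2) ^ 2 ≤ Real.exp (-(32 * c * B)) := by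
    calc m * (24 * Real.log Y) / (v / 2) ^ 2
        ≤ v / (16 * c) * (24 * Real.log Y) / (v / 2) ^ 2 := by gcongr
      _ = 6 * Real.log Y / (c * v) := by field_simp; ring
      _ ≤ Real.exp (-(32 * c * B)) := by
        rw [div_le_iff₀ (by positivity), Real.exp_neg, inv_mul_eq_div, le_div_iff₀ (Real.exp_pos _)]
        linarith
  calc (m * (24 * Real.log Y) / (v / 2) ^ 2) ^ m ≤ Real.exp (-(32 * c * B)) ^ m := by gcongr
    _ = Real.exp (-(32 * c * m * B)) := by rw [← Real.exp_nat_mul]; ring_nf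
    _ ≤ _ := by
      rw [mul_comm B]
      gcongr

theorem exists_large_values (h : IsLogMajorant F c a b) (k : ℕ) : ∃ A C : ℝ, 0 < A ∧
    ∀ T : ℝ, 2 ≤ T → 2 ≤ Real.log (Real.log T) → ∃ G : ℝ → ℝ, Continuous G ∧ (∀ t, 0 ≤ G t) ∧
      (∀ t ∈ Set.Icc T (2 * T), 0 < F t → A * Real.log (Real.log T) + 1 ≤ Real.log (F t) →
        F t ^ k ≤ G t) ∧ ∫ t in T..(2 * T), G t ≤ C * T := by
  have hc := h.pos
  have hE : 0 < Real.exp (32 * c * (k + 1 : ℕ)) := Real.exp_pos _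
  set A : ℝ := 24 + 8 * c + 6 * Real.exp (32 * c * (k + 1 : ℕ)) / c with hA
  refine ⟨A, 6 * Real.exp k, by positivity, fun T hT hY => ?_⟩
  set ℓ := Real.log (Real.log T) with hl
  set M := ⌊c * (2 * Real.log T / Real.log 2)⌋₊ + 1 with hM
  set S := (range M).filter (fun v : ℕ => A * ℓ ≤ v ∧ Real.log 2 ≤ 8 * c * Real.log T / v) with hS
  have hv24 : ∀ v : ℝ, A * ℓ ≤ v → 24 * ℓ ≤ v := fun v hv => by
    have : 0 ≤ 8 * c + 6 * Real.exp (32 * c * (k + 1 : ℕ)) / c := by positivity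
    nlinarith
  have hv16 : ∀ v : ℝ, A * ℓ ≤ v → 16 * c ≤ v := fun v hv => by
    have : 0 ≤ 24 + 6 * Real.exp (32 * c * (k + 1 : ℕ)) / c := by positivity
    nlinarith
  have hvB : ∀ v : ℝ, A * ℓ ≤ v → 6 * Real.exp (32 * c * (k + 1 : ℕ)) * ℓ ≤ c * v := fun v hv => by
    have h1 : 6 * Real.exp (32 * c * (k + 1 : ℕ)) = c * (6 * Real.exp (32 * c * (k + 1 : ℕ)) / c) := by
      field_simp
    have h2 : 0 ≤ (24 + 8 * c) * ℓ := by positivity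
    rw [h1, mul_assoc]
    gcongr
    nlinarith
  set P : ℕ → ℝ → ℂ := fun v => dirPoly (Nat.primesBelow ⌈Real.exp (8 * c * Real.log T / v)⌉₊)
    (a (8 * c * Real.log T / v)) with hP
  have hPc : ∀ v, Continuous (P v) := fun v =>
    continuous_dirPoly (fun p hp => (Nat.prime_of_mem_primesBelow hp).pos) _
  refine ⟨fun t => ∑ v ∈ S, Real.exp (k * (v + 1)) *
    (‖P v t‖ / ((v : ℝ) / 2)) ^ (2 * ⌊(v : ℝ) / (16 * c)⌋₊), ?_, ?_, ?_, ?_⟩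
  · exact continuous_finsetSum _ fun v _ => by have := hPc v; fun_prop
  · exact fun t => Finset.sum_nonneg fun v _ =>
      mul_nonneg (Real.exp_pos _).le ((even_two_mul _).pow_nonneg _)
  · intro t ht hF hFA
    set v := ⌊Real.log (F t)⌋₊ with hv
    have hA0 : 0 < A * ℓ := by positivity
    have hv1 : (v : ℝ) ≤ Real.log (F t) := Nat.floor_le (by linarith)
    have hv2 : Real.log (F t) < v + 1 := Nat.lt_floor_add_one _
    have hAv : A * ℓ ≤ v := by linarith
    obtain ⟨h1, h2⟩ := h.half_le_norm_dirPoly hT hY (hv24 v hAv) (hv16 v hAv) ht hF hv1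
    have hv0 : (0 : ℝ) < v := by linarith
    have hvS : v ∈ S := by
      refine Finset.mem_filter.2 ⟨mem_range.2 (Nat.lt_succ_of_le (Nat.floor_le_floor ?_)), hAv, h1⟩
      have hl2 : 0 < Real.log 2 := Real.log_pos (by norm_num)
      refine (h.log_le_of_log_two (hT.trans ht.1) hF).trans ?_
      gcongr
      exact (log_mem_Icc_of_mem_Icc hT ht).2
    refine le_trans ?_ (Finset.single_le_sum (f := fun v : ℕ => Real.exp (k * (v + 1)) *
      (‖P v t‖ / ((v : ℝ) / 2)) ^ (2 * ⌊(v : ℝ) / (16 * c)⌋₊)) (fun v _ =>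
      mul_nonneg (Real.exp_pos _).le ((even_two_mul _).pow_nonneg _)) hvS)
    calc F t ^ k = Real.exp (k * Real.log (F t)) := by rw [Real.exp_nat_mul, Real.exp_log hF]
      _ ≤ Real.exp (k * (v + 1)) * 1 := by
        rw [mul_one]
        gcongr
      _ ≤ _ := by
        gcongr
        exact one_le_pow₀ ((one_le_div (by positivity)).2 h2)
  · rw [intervalIntegral.integral_finsetSum fun v _ => by
      have := hPc v
      exact (by fun_prop : Continuous _).intervalIntegrable _ _]
    have hterm : ∀ v ∈ S, ∫ t in T..(2 * T), Real.exp (k * (v + 1)) *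
        (‖P v t‖ / ((v : ℝ) / 2)) ^ (2 * ⌊(v : ℝ) / (16 * c)⌋₊)
        ≤ 3 * Real.exp k * T * Real.exp (-v) := by
      intro v hv
      obtain ⟨-, hAv, hL⟩ := Finset.mem_filter.1 hv
      rw [intervalIntegral.integral_const_mul]
      have h1 := h.integral_norm_dirPoly_div_half_pow_le hT hY (hv24 v hAv) (hv16 v hAv) hL
        (Nat.cast_nonneg (k + 1)) (hvB v hAv)
      calc _ ≤ Real.exp (k * (v + 1)) * (3 * T * Real.exp (-((k + 1 : ℕ) * v))) := by gcongr
        _ = 3 * T * (Real.exp (k * (v + 1)) * Real.exp (-((k + 1 : ℕ) * v))) := by ring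
        _ = 3 * T * (Real.exp k * Real.exp (-v)) := by
          rw [← Real.exp_add, ← Real.exp_add]
          push_cast
          ring_nf
        _ = _ := by ring
    refine (Finset.sum_le_sum hterm).trans ?_
    rw [← Finset.mul_sum]
    have h1 : ∑ v ∈ S, Real.exp (-v) ≤ 2 := (Finset.sum_le_sum_of_subset_of_nonneg
      (Finset.filter_subset _ _) fun _ _ _ => (Real.exp_pos _).le).trans (sum_range_exp_neg_le M)
    have hT0 : 0 < T := by linarith
    calc _ ≤ 3 * Real.exp k * T * 2 := by gcongr
      _ = _ := by ring

end IsLogMajorant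

end LargeValues

section TypicalValues

theorem dirPoly_filter_add (S : Finset ℕ) (z : ℕ) (a : ℕ → ℂ) (t : ℝ) :
    dirPoly (S.filter (z ≤ ·)) a t + dirPoly (S.filter (¬ z ≤ ·)) a t = dirPoly S a t :=
  Finset.sum_filter_add_sum_filter_not _ _ _

theorem mul_pow_le_exp_neg {T x B E : ℝ} {m : ℕ} (hT : 0 < T) (hx : 0 ≤ x)
    (hB : x ≤ Real.exp (-B)) (hE : E ≤ m * B) : 3 * T * x ^ m ≤ 3 * T * Real.exp (-E) := by
  gcongr
  calc x ^ m ≤ Real.exp (-B) ^ m := by gcongr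
    _ = Real.exp (-(m * B)) := by rw [← Real.exp_nat_mul]; ring_nf
    _ ≤ _ := by gcongr

theorem eventually_log_mul_le {α η : ℝ} (hα : 0 < α) (hη : 0 < η) :
    ∀ᶠ x : ℝ in atTop, Real.log (α * x) ≤ η * x := by
  have h1 := Real.isLittleO_log_id_atTop.bound (div_pos hη hα)
  have h2 : Tendsto (fun x : ℝ => α * x) atTop atTop := tendsto_id.const_mul_atTop hα
  filter_upwards [h2.eventually h1, eventually_gt_atTop 0] with x hx hx0
  rw [id, Real.norm_of_nonneg (by positivity : 0 ≤ α * x)] at hx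
  calc Real.log (α * x) ≤ ‖Real.log (α * x)‖ := Real.le_norm_self _
    _ ≤ η / α * (α * x) := hx
    _ = η * x := by field_simp

theorem eventually_mul_sq_le_exp : ∀ᶠ x : ℝ in atTop, 8 * x ^ 2 ≤ Real.exp x := by
  filter_upwards [(Real.tendsto_exp_div_pow_atTop 2).eventually_ge_atTop 8, eventually_gt_atTop 0]
    with x hx hx0
  rwa [le_div_iff₀ (by positivity)] at hx

theorem tendsto_log_log_atTop : Tendsto (fun T => Real.log (Real.log T)) atTop atTop :=
  Real.tendsto_log_atTop.comp Real.tendsto_log_atTop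

namespace IsLogMajorant

variable {F : ℝ → ℝ} {c : ℝ} {a b : ℝ → ℕ → ℂ}

theorem sum_norm_sq_sqPoly_le (h : IsLogMajorant F c a b) {L : ℝ} (hL : Real.log 2 ≤ L) :
    ∑ p ∈ (Nat.primesBelow ⌈Real.exp L⌉₊).filter (· ^ 2 < ⌈Real.exp L⌉₊), ‖b L p‖ ^ 2 ≤ 2 := by
  refine le_trans ?_ (sum_inv_sq_primesBelow_le ⌈Real.exp L⌉₊)
  refine (Finset.sum_le_sum_of_subset_of_nonneg (Finset.filter_subset _ _)
    fun _ _ _ => by positivity).trans (Finset.sum_le_sum fun p hp => ?_)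
  have := h.norm_le L hL p (Nat.prime_of_mem_primesBelow hp)
  gcongr

theorem exists_sum_norm_sq_tail_le (h : IsLogMajorant F c a b) : ∃ C : ℝ, 0 < C ∧
    ∀ L x : ℝ, Real.log 2 ≤ L → 8 ≤ x → x ≤ L →
      ∑ p ∈ (Nat.primesBelow ⌈Real.exp L⌉₊).filter (⌈Real.exp x⌉₊ ≤ ·), ‖a L p‖ ^ 2
        ≤ C * Real.log (16 * (L / x)) := by
  obtain ⟨C, hC0, hC⟩ := exists_sum_inv_primes_le
  refine ⟨4 * C, by positivity, fun L x hL hx hxL => ?_⟩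
  have hz : x ≤ Real.log ⌈Real.exp x⌉₊ := by
    rw [Real.le_log_iff_exp_le (Nat.cast_pos.2 (Nat.ceil_pos.2 (Real.exp_pos x)))]
    exact Nat.le_ceil _
  have h1 := hC ⌈Real.exp x⌉₊ ⌈Real.exp L⌉₊ (hx.trans hz)
    (Nat.ceil_le_ceil (Real.exp_le_exp.2 hxL))
  have h2 : 8 * (Real.log ⌈Real.exp L⌉₊ / Real.log ⌈Real.exp x⌉₊) ≤ 16 * (L / x) := by
    have h3 := log_ceil_exp_le hL
    have h4 : Real.log ⌈Real.exp L⌉₊ / Real.log ⌈Real.exp x⌉₊ ≤ 2 * L / x := by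
      have : 0 < x := by linarith
      have : 0 ≤ L := by linarith
      gcongr
    rw [mul_div_assoc] at h4
    linarith
  have h0 : 0 < Real.log ⌈Real.exp L⌉₊ := Real.log_pos (by exact_mod_cast two_le_ceil_exp hL)
  have h0' : 0 < Real.log ⌈Real.exp x⌉₊ := by linarith
  calc _ ≤ ∑ p ∈ (Nat.primesBelow ⌈Real.exp L⌉₊).filter (⌈Real.exp x⌉₊ ≤ ·), 4 * (1 / p : ℝ) := by
        refine Finset.sum_le_sum fun p hp => ?_
        rw [mul_one_div]
        exact h.norm_sq_le L hL p (Nat.prime_of_mem_primesBelow (Finset.mem_filter.1 hp).1)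
    _ ≤ 4 * (C * Real.log (8 * (Real.log ⌈Real.exp L⌉₊ / Real.log ⌈Real.exp x⌉₊))) := by
        rw [← Finset.mul_sum]
        gcongr
    _ ≤ 4 * (C * Real.log (16 * (L / x))) := by gcongr
    _ = _ := by ring

theorem pow_le_of_log_le (h : IsLogMajorant F c a b) {k n : ℕ} {T t L δ ℓ A K : ℝ} (z l m : ℕ)
    (hT : 2 ≤ T) (ht : t ∈ Set.Icc T (2 * T)) (hL : Real.log 2 ≤ L) (hLT : L ≤ Real.log T)
    (hcL : c * (2 * Real.log T / L) ≤ δ * ℓ) (hδ : 0 < δ * ℓ) (hK : 0 < K * ℓ) (hn : k * (K * ℓ) ≤ n)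
    (hF : 0 < F t) (hFA : Real.log (F t) ≤ A * ℓ) :
    F t ^ k ≤ Real.exp (k * (A * ℓ)) *
        ((‖dirPoly ((Nat.primesBelow ⌈Real.exp L⌉₊).filter (¬ z ≤ ·)) (a L) t‖ / (K * ℓ)) ^ (2 * l)
        + (‖dirPoly ((Nat.primesBelow ⌈Real.exp L⌉₊).filter (z ≤ ·)) (a L) t‖ / (δ * ℓ)) ^ (2 * m)
        + (‖sqPoly b L t‖ / (δ * ℓ)) ^ (2 * m))
      + 4 * Real.exp (k * (3 * (δ * ℓ))) * ∑ j ∈ range (n + 1),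
        (k * ‖dirPoly ((Nat.primesBelow ⌈Real.exp L⌉₊).filter (¬ z ≤ ·)) (a L) t‖) ^ (2 * j)
          / ((2 * j).factorial : ℝ) := by
  have hlog := log_mem_Icc_of_mem_Icc hT ht
  have hl2 : 0 < Real.log 2 := Real.log_pos (by norm_num)
  have h1 := h.log_le L t hL (hT.trans ht.1) (hLT.trans hlog.1) hF
  rw [← dirPoly_filter_add _ z] at h1
  set x := ‖dirPoly ((Nat.primesBelow ⌈Real.exp L⌉₊).filter (¬ z ≤ ·)) (a L) t‖ with hx
  have h2 := norm_add_le (dirPoly ((Nat.primesBelow ⌈Real.exp L⌉₊).filter (z ≤ ·)) (a L) t)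
    (dirPoly ((Nat.primesBelow ⌈Real.exp L⌉₊).filter (¬ z ≤ ·)) (a L) t)
  rw [← hx] at h2
  set y := ‖dirPoly ((Nat.primesBelow ⌈Real.exp L⌉₊).filter (z ≤ ·)) (a L) t‖ with hy
  set w := ‖sqPoly b L t‖ with hw
  have hx0 : 0 ≤ x := norm_nonneg _
  have hy0 : 0 ≤ y := norm_nonneg _
  have hw0 : 0 ≤ w := norm_nonneg _
  have h3 : c * (Real.log t / L) ≤ δ * ℓ := by
    refine le_trans ?_ hcL
    have := h.pos
    have : 0 < L := hl2.trans_le hL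
    gcongr
    exact hlog.2
  have hFk : F t ^ k = Real.exp (k * Real.log (F t)) := by rw [Real.exp_nat_mul, Real.exp_log hF]
  have hu : 0 ≤ (x / (K * ℓ)) ^ (2 * l) := by positivity
  have hv : 0 ≤ (y / (δ * ℓ)) ^ (2 * m) := by positivity
  have hr : 0 ≤ (w / (δ * ℓ)) ^ (2 * m) := by positivity
  have hs : 0 ≤ ∑ j ∈ range (n + 1), (k * x) ^ (2 * j) / ((2 * j).factorial : ℝ) :=
    Finset.sum_nonneg fun _ _ => by positivity
  have hE := Real.exp_pos (k * (A * ℓ))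
  have key : F t ^ k ≤ Real.exp (k * (A * ℓ)) := by rw [hFk]; gcongr
  by_cases hx1 : K * ℓ ≤ x
  · have : 1 ≤ (x / (K * ℓ)) ^ (2 * l) := one_le_pow₀ ((one_le_div hK).2 hx1)
    refine key.trans (le_add_of_le_of_nonneg ?_ (by positivity))
    exact le_mul_of_one_le_right hE.le (by linarith)
  by_cases hy1 : δ * ℓ ≤ y
  · have : 1 ≤ (y / (δ * ℓ)) ^ (2 * m) := one_le_pow₀ ((one_le_div hδ).2 hy1)
    refine key.trans (le_add_of_le_of_nonneg ?_ (by positivity))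
    exact le_mul_of_one_le_right hE.le (by linarith)
  by_cases hw1 : δ * ℓ ≤ w
  · have : 1 ≤ (w / (δ * ℓ)) ^ (2 * m) := one_le_pow₀ ((one_le_div hδ).2 hw1)
    refine key.trans (le_add_of_le_of_nonneg ?_ (by positivity))
    exact le_mul_of_one_le_right hE.le (by linarith)
  push Not at hx1 hy1 hw1
  refine le_add_of_nonneg_of_le (by positivity) ?_
  have h4 : (k : ℝ) * x ≤ n := le_trans (by gcongr) hn
  have h5 := exp_le_four_mul_sum (by positivity : 0 ≤ k * x) h4
  calc F t ^ k = Real.exp (k * Real.log (F t)) := hFk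
    _ ≤ Real.exp (k * (x + 3 * (δ * ℓ))) := by
      gcongr
      linarith
    _ = Real.exp (k * (3 * (δ * ℓ))) * Real.exp (k * x) := by
      rw [← Real.exp_add]
      ring_nf
    _ ≤ Real.exp (k * (3 * (δ * ℓ))) * (4 * ∑ j ∈ range (n + 1),
        (k * x) ^ (2 * j) / ((2 * j).factorial : ℝ)) := by gcongr
    _ = _ := by ring

end IsLogMajorant

end TypicalValues

section TypicalMoment

theorem integral_mul_add_add_add_mul {u v w s : ℝ → ℝ} (hu : Continuous u) (hv : Continuous v)
    (hw : Continuous w) (hs : Continuous s) (α β T₁ T₂ : ℝ) :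
    ∫ t in T₁..T₂, (α * (u t + v t + w t) + β * s t)
      = α * ((∫ t in T₁..T₂, u t) + (∫ t in T₁..T₂, v t) + ∫ t in T₁..T₂, w t)
        + β * ∫ t in T₁..T₂, s t := by
  have hi : ∀ {f : ℝ → ℝ}, Continuous f → IntervalIntegrable f volume T₁ T₂ :=
    fun hf => hf.intervalIntegrable _ _
  rw [intervalIntegral.integral_add (hi (by fun_prop)) (hi (by fun_prop)),
    intervalIntegral.integral_const_mul, intervalIntegral.integral_const_mul,
    intervalIntegral.integral_add (hi (by fun_prop)) (hi hw),
    intervalIntegral.integral_add (hi hu) (hi hv)]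

namespace IsLogMajorant

variable {F : ℝ → ℝ} {c : ℝ} {a b : ℝ → ℕ → ℂ}

set_option maxHeartbeats 2000000 in
theorem exists_typical_values (h : IsLogMajorant F c a b) {k : ℕ} (hk : 1 ≤ k) {A : ℝ} (hA : 0 < A)
    {ε : ℝ} (hε : 0 < ε) : ∃ C : ℝ, ∀ᶠ T : ℝ in atTop, ∃ G : ℝ → ℝ, Continuous G ∧ (∀ t, 0 ≤ G t) ∧
      (∀ t ∈ Set.Icc T (2 * T), 0 < F t → Real.log (F t) ≤ A * Real.log (Real.log T) →
        F t ^ k ≤ G t) ∧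
      ∫ t in T..(2 * T), G t
        ≤ C * T * Real.exp (((k : ℝ) ^ 2 / 2 + ε) * Real.log (Real.log T)) := by
  have hc := h.pos
  have hk1 : (1 : ℝ) ≤ k := by exact_mod_cast hk
  obtain ⟨δ, hδ0, hδ⟩ : ∃ δ : ℝ, 0 < δ ∧ (3 * k + (k : ℝ) ^ 2 / 4 + 1) * δ = ε :=
    ⟨ε / (3 * k + (k : ℝ) ^ 2 / 4 + 1), by positivity, by field_simp⟩
  obtain ⟨D, hD0, hD⟩ : ∃ D : ℝ, 0 < D ∧ 2 * c / D = δ :=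
    ⟨2 * c / δ, by positivity, by field_simp⟩
  obtain ⟨C₁, hC₁0, hC₁⟩ := h.sum_le δ hδ0
  obtain ⟨C₂, hC₂0, hC₂⟩ := h.exists_sum_norm_sq_tail_le
  obtain ⟨K, hK⟩ : ∃ K : ℝ, K = A + 144 * k := ⟨_, rfl⟩
  have hK0 : 0 < K := by rw [hK]; positivity
  obtain ⟨η, hη0, hη⟩ : ∃ η : ℝ, 0 < η ∧ η = 2 * D * δ ^ 2 * Real.exp (-(4 * D * (k * A))) :=
    ⟨_, by positivity, rfl⟩
  refine ⟨9 + 12 * (4 * k * K / δ + 1) * Real.exp ((k : ℝ) ^ 2 * C₁ / 4), ?_⟩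
  have hlarge := tendsto_log_log_atTop.eventually (((eventually_mul_sq_le_exp.and
    (eventually_log_mul_le (show 0 < 16 * D by positivity)
      (show 0 < η / C₂ by positivity))).and ((eventually_ge_atTop (2 * D + 1 / D + 2)).and
    (eventually_ge_atTop (4 * k * K + 2 / η)))))
  filter_upwards [hlarge, eventually_ge_atTop 2, Real.tendsto_log_atTop.eventually_gt_atTop 0]
    with T hT hT2 hY0
  obtain ⟨⟨hYl, hlog⟩, hl1, hl2⟩ := hT
  rw [Real.exp_log hY0] at hYl
  set Y := Real.log T with hY
  set ℓ := Real.log Y with hl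
  have hT0 : 0 < T := by linarith
  have hDi : 0 < 1 / D := by positivity
  have hηi : 0 < 2 / η := by positivity
  have hkK : 0 < 4 * k * K := by positivity
  have hℓ2 : 2 ≤ ℓ := by linarith
  have hℓ0 : 0 < ℓ := by linarith
  have hℓD : 2 * D ≤ ℓ := by linarith
  have hDℓ : 1 ≤ D * ℓ := by
    have : 1 / D ≤ ℓ := by linarith
    rw [div_le_iff₀ hD0] at this
    linarith
  have hℓK : 4 * k * K ≤ ℓ := by linarith
  have hℓη : 2 ≤ η * ℓ := by
    have : 2 / η ≤ ℓ := by linarith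
    rw [div_le_iff₀ hη0] at this
    linarith
  have hℓY : ℓ ≤ D * Y := by nlinarith
  set L := D * Y / ℓ with hLdef
  have hLone : 1 ≤ L := (one_le_div hℓ0).2 hℓY
  have hL : Real.log 2 ≤ L := by linarith [Real.log_two_lt_d9]
  have hLY : 2 * L ≤ Y := by
    rw [hLdef, ← mul_div_assoc, div_le_iff₀ hℓ0]
    nlinarith
  set x := Y / ℓ ^ 2 with hx
  have hx8 : 8 ≤ x := by rwa [hx, le_div_iff₀ (by positivity)]
  have hxL : x ≤ L := by
    rw [hx, hLdef, div_le_div_iff₀ (by positivity) hℓ0]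
    have : Y * ℓ * 1 ≤ Y * ℓ * (D * ℓ) := by gcongr
    linarith
  set n := ⌈k * (K * ℓ)⌉₊ with hn
  have hn1 : k * (K * ℓ) ≤ n := Nat.le_ceil _
  have hkKℓ : 1 ≤ k * (K * ℓ) := by
    have h1 : 144 ≤ K := by rw [hK]; linarith
    have h2 : 1 ≤ K * ℓ := by nlinarith
    nlinarith
  have hn2 : (n : ℝ) ≤ 2 * (k * (K * ℓ)) := by
    have := Nat.ceil_lt_add_one (show 0 ≤ k * (K * ℓ) by positivity)
    linarith
  set m := ⌊ℓ / (2 * D)⌋₊ with hm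
  have hm1 : (m : ℝ) ≤ ℓ / (2 * D) := Nat.floor_le (by positivity)
  have hm2 : ℓ ≤ 4 * D * m := by
    have h1 : 1 ≤ m := Nat.le_floor (by rw [Nat.cast_one, one_le_div (by positivity)]; exact hℓD)
    have h2 : ℓ / (2 * D) < m + 1 := Nat.lt_floor_add_one _
    have h3 : (1 : ℝ) ≤ m := by exact_mod_cast h1
    rw [div_lt_iff₀ (by positivity)] at h2
    have h4 : (m + 1) * (2 * D) ≤ (m + m) * (2 * D) := by gcongr
    linarith
  have hcL : c * (2 * Y / L) ≤ δ * ℓ := by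
    refine le_of_eq ?_
    rw [hLdef, ← hD]
    field_simp
  set z := ⌈Real.exp x⌉₊ with hz
  set Sa := (Nat.primesBelow ⌈Real.exp L⌉₊).filter (¬ z ≤ ·) with hSa
  set Sb := (Nat.primesBelow ⌈Real.exp L⌉₊).filter (z ≤ ·) with hSb
  set Sq := (Nat.primesBelow ⌈Real.exp L⌉₊).filter (· ^ 2 < ⌈Real.exp L⌉₊) with hSq
  have hpr : ∀ {r : ℕ → Prop} [DecidablePred r],
      ∀ p ∈ (Nat.primesBelow ⌈Real.exp L⌉₊).filter r, p.Prime := fun p hp =>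
    Nat.prime_of_mem_primesBelow (Finset.mem_filter.1 hp).1
  have hle : ∀ {r : ℕ → Prop} [DecidablePred r],
      ∀ p ∈ (Nat.primesBelow ⌈Real.exp L⌉₊).filter r, (p : ℝ) ≤ Real.exp L := fun p hp =>
    le_exp_of_mem_primesBelow_ceil (Finset.mem_filter.1 hp).1
  have hle' : ∀ p ∈ Sa, (p : ℝ) ≤ Real.exp x := fun p hp =>
    (Nat.lt_ceil.1 (not_le.1 (Finset.mem_filter.1 hp).2)).le
  have hsub : ∑ p ∈ Sa, ‖a L p‖ ^ 2 ≤ ∑ p ∈ Nat.primesBelow ⌈Real.exp L⌉₊, ‖a L p‖ ^ 2 :=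
    Finset.sum_le_sum_of_subset_of_nonneg (Finset.filter_subset _ _) fun _ _ _ => by positivity
  have hnx : 2 * n * x ≤ Y := by
    rw [hx, ← mul_div_assoc, div_le_iff₀ (by positivity)]
    have : 2 * (n : ℝ) ≤ ℓ ^ 2 := by
      have : 4 * k * K * ℓ ≤ ℓ * ℓ := by gcongr
      linarith
    rw [mul_comm Y]
    gcongr
  have hmL : 2 * m * L ≤ Y := by
    calc 2 * m * L ≤ 2 * (ℓ / (2 * D)) * L := by gcongr
      _ = Y := by rw [hLdef]; field_simp
  have hδℓ : 0 < δ * ℓ := by positivity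
  have hKℓ : 0 < K * ℓ := by positivity
  have hsmall : ∀ W : ℝ, 0 ≤ W → W ≤ η * ℓ →
      m * W / (δ * ℓ) ^ 2 ≤ Real.exp (-(4 * D * (k * A))) := by
    intro W hW0 hW
    calc m * W / (δ * ℓ) ^ 2 ≤ ℓ / (2 * D) * (η * ℓ) / (δ * ℓ) ^ 2 := by gcongr
      _ = η / (2 * D * δ ^ 2) := by field_simp
      _ = Real.exp (-(4 * D * (k * A))) := by
        rw [hη]
        field_simp
  have hmE : k * (A * ℓ) ≤ m * (4 * D * (k * A)) := by
    calc k * (A * ℓ) = k * A * ℓ := by ring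
      _ ≤ k * A * (4 * D * m) := by gcongr
      _ = _ := by ring
  have hI1 : ∫ t in T..(2 * T), (‖dirPoly Sa (a L) t‖ / (K * ℓ)) ^ (2 * n)
      ≤ 3 * T * Real.exp (-(k * (A * ℓ))) := by
    refine (integral_norm_dirPoly_div_pow_le hpr hle' (a L) n hT0 hnx
      (hsub.trans (h.sum_norm_sq_le hL hLY hℓ2)) (K * ℓ)).trans ?_
    refine mul_pow_le_exp_neg hT0 (by positivity) (B := 1) ?_ ?_
    · calc n * (24 * ℓ) / (K * ℓ) ^ 2 ≤ 2 * (k * (K * ℓ)) * (24 * ℓ) / (K * ℓ) ^ 2 := by gcongr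
        _ = 48 * k / K := by field_simp; ring
        _ ≤ 1 / 3 := by
          rw [div_le_div_iff₀ hK0 (by norm_num), hK]
          linarith
        _ ≤ Real.exp (-1) := by
          rw [Real.exp_neg, ← one_div]
          exact one_div_le_one_div_of_le (Real.exp_pos 1) Real.exp_one_lt_three.le
    · rw [mul_one]
      refine le_trans ?_ hn1
      gcongr
      rw [hK]
      linarith
  have hI2 : ∫ t in T..(2 * T), (‖dirPoly Sb (a L) t‖ / (δ * ℓ)) ^ (2 * m)
      ≤ 3 * T * Real.exp (-(k * (A * ℓ))) := by
    have hW := hC₂ L x hL hx8 hxL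
    refine (integral_norm_dirPoly_div_pow_le hpr hle (a L) m hT0 hmL hW (δ * ℓ)).trans ?_
    have hW0 : 0 ≤ C₂ * Real.log (16 * (L / x)) :=
      le_trans (Finset.sum_nonneg fun _ _ => by positivity) hW
    refine mul_pow_le_exp_neg hT0 (by positivity) (hsmall _ hW0 ?_) hmE
    have hLx : 16 * (L / x) = 16 * D * ℓ := by
      rw [hLdef, hx]
      field_simp
    rw [hLx]
    calc C₂ * Real.log (16 * D * ℓ) ≤ C₂ * (η / C₂ * ℓ) := by gcongr
      _ = η * ℓ := by field_simp
  have hI3 : ∫ t in T..(2 * T), (‖sqPoly b L t‖ / (δ * ℓ)) ^ (2 * m)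
      ≤ 3 * T * Real.exp (-(k * (A * ℓ))) := by
    refine (integral_norm_dirPoly_two_mul_div_pow_le hpr hle (b L) m hT0 hmL
      (h.sum_norm_sq_sqPoly_le hL) (δ * ℓ)).trans ?_
    exact mul_pow_le_exp_neg hT0 (by positivity) (hsmall 2 (by norm_num) hℓη) hmE
  have hI4 := integral_exp_moment_le hpr (by linarith) hle' (a L) n hT0 hnx
    (hsub.trans (hC₁ L Y hL hLY hℓ2)) k
  have hca : Continuous (dirPoly Sa (a L)) := continuous_dirPoly (fun p hp => (hpr p hp).pos) _
  have hcb : Continuous (dirPoly Sb (a L)) := continuous_dirPoly (fun p hp => (hpr p hp).pos) _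
  have hcq : Continuous (sqPoly b L) := (continuous_dirPoly (fun p hp => (hpr p hp).pos) (b L)).comp
    (continuous_const.mul continuous_id)
  have hc1 : Continuous fun t => (‖dirPoly Sa (a L) t‖ / (K * ℓ)) ^ (2 * n) := by fun_prop
  have hc2 : Continuous fun t => (‖dirPoly Sb (a L) t‖ / (δ * ℓ)) ^ (2 * m) := by fun_prop
  have hc3 : Continuous fun t => (‖sqPoly b L t‖ / (δ * ℓ)) ^ (2 * m) := by fun_prop
  have hc4 : Continuous fun t => ∑ j ∈ range (n + 1),
      (k * ‖dirPoly Sa (a L) t‖) ^ (2 * j) / ((2 * j).factorial : ℝ) := by fun_prop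
  refine ⟨fun t => Real.exp (k * (A * ℓ)) * ((‖dirPoly Sa (a L) t‖ / (K * ℓ)) ^ (2 * n)
        + (‖dirPoly Sb (a L) t‖ / (δ * ℓ)) ^ (2 * m) + (‖sqPoly b L t‖ / (δ * ℓ)) ^ (2 * m))
      + 4 * Real.exp (k * (3 * (δ * ℓ))) * ∑ j ∈ range (n + 1),
        (k * ‖dirPoly Sa (a L) t‖) ^ (2 * j) / ((2 * j).factorial : ℝ), ?_, ?_, ?_, ?_⟩
  · exact (continuous_const.mul ((hc1.add hc2).add hc3)).add (continuous_const.mul hc4)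
  · intro t
    have : 0 ≤ ∑ j ∈ range (n + 1), (k * ‖dirPoly Sa (a L) t‖) ^ (2 * j)
      / ((2 * j).factorial : ℝ) := Finset.sum_nonneg fun _ _ => by positivity
    positivity
  · intro t ht hF hFA
    exact h.pow_le_of_log_le z n m hT2 ht hL (by linarith) hcL hδℓ hKℓ hn1 hF hFA
  · refine (integral_mul_add_add_add_mul hc1 hc2 hc3 hc4 _ _ _ _).trans_le ?_
    have hone : 1 ≤ Real.exp (((k : ℝ) ^ 2 / 2 + ε) * ℓ) := Real.one_le_exp (by positivity)
    have hfirst : Real.exp (k * (A * ℓ)) *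
        ((∫ t in T..(2 * T), (‖dirPoly Sa (a L) t‖ / (K * ℓ)) ^ (2 * n))
        + (∫ t in T..(2 * T), (‖dirPoly Sb (a L) t‖ / (δ * ℓ)) ^ (2 * m))
        + ∫ t in T..(2 * T), (‖sqPoly b L t‖ / (δ * ℓ)) ^ (2 * m))
        ≤ 9 * T * Real.exp (((k : ℝ) ^ 2 / 2 + ε) * ℓ) := by
      calc _ ≤ Real.exp (k * (A * ℓ)) * (9 * T * Real.exp (-(k * (A * ℓ)))) := by
            gcongr
            linarith
        _ = 9 * T * (Real.exp (k * (A * ℓ)) * Real.exp (-(k * (A * ℓ)))) := by ring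
        _ = 9 * T * 1 := by rw [← Real.exp_add, add_neg_cancel, Real.exp_zero]
        _ ≤ _ := by gcongr
    have hnexp : 2 * (n : ℝ) + 1 ≤ (4 * k * K / δ + 1) * Real.exp (δ * ℓ) := by
      have h1 : δ * ℓ ≤ Real.exp (δ * ℓ) := by linarith [Real.add_one_le_exp (δ * ℓ)]
      have h2 : 1 ≤ Real.exp (δ * ℓ) := Real.one_le_exp hδℓ.le
      calc 2 * (n : ℝ) + 1 ≤ 4 * k * K / δ * (δ * ℓ) + 1 := by
            have : 4 * k * K / δ * (δ * ℓ) = 2 * (2 * (k * (K * ℓ))) := by field_simp; ring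
            linarith
        _ ≤ 4 * k * K / δ * Real.exp (δ * ℓ) + Real.exp (δ * ℓ) := by gcongr
        _ = _ := by ring
    have hsecond : 4 * Real.exp (k * (3 * (δ * ℓ))) * ∫ t in T..(2 * T), ∑ j ∈ range (n + 1),
        (k * ‖dirPoly Sa (a L) t‖) ^ (2 * j) / ((2 * j).factorial : ℝ)
        ≤ 12 * (4 * k * K / δ + 1) * Real.exp ((k : ℝ) ^ 2 * C₁ / 4) * T
          * Real.exp (((k : ℝ) ^ 2 / 2 + ε) * ℓ) := by
      calc _ ≤ 4 * Real.exp (k * (3 * (δ * ℓ))) * (3 * T * ((4 * k * K / δ + 1) * Real.exp (δ * ℓ))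
            * Real.exp ((k : ℝ) ^ 2 * ((2 + δ) * ℓ + C₁) / 4)) := by
            gcongr
            refine hI4.trans ?_
            gcongr
        _ = 12 * (4 * k * K / δ + 1) * T * (Real.exp (k * (3 * (δ * ℓ))) * Real.exp (δ * ℓ)
            * Real.exp ((k : ℝ) ^ 2 * ((2 + δ) * ℓ + C₁) / 4)) := by ring
        _ = 12 * (4 * k * K / δ + 1) * T * (Real.exp ((k : ℝ) ^ 2 * C₁ / 4)
            * Real.exp (((k : ℝ) ^ 2 / 2 + ε) * ℓ)) := by
          rw [← Real.exp_add, ← Real.exp_add, ← Real.exp_add, ← hδ]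
          congr 2
          ring
        _ = _ := by ring
    refine (add_le_add hfirst hsecond).trans (le_of_eq ?_)
    ring

end IsLogMajorant

end TypicalMoment

section Conclusion

namespace IsLogMajorant

variable {F : ℝ → ℝ} {c : ℝ} {a b : ℝ → ℕ → ℂ}

/-- Upper bound for the moments of a function that has a log majorant. -/
theorem exists_integral_pow_le (h : IsLogMajorant F c a b) (hF : Continuous F) (hF0 : ∀ t, 0 ≤ F t)
    {k : ℕ} (hk : 1 ≤ k) {ε : ℝ} (hε : 0 < ε) : ∃ C : ℝ, 0 ≤ C ∧ ∀ᶠ T : ℝ in atTop,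
      ∫ t in T..(2 * T), F t ^ k ≤ C * T * Real.log T ^ ((k : ℝ) ^ 2 / 2 + ε) := by
  obtain ⟨A, C₁, hA, h1⟩ := h.exists_large_values k
  obtain ⟨C₂, h2⟩ := h.exists_typical_values hk (show 0 < A + 1 by linarith) hε
  refine ⟨|C₁| + |C₂|, by positivity, ?_⟩
  filter_upwards [h2, tendsto_log_log_atTop.eventually_ge_atTop 2, eventually_ge_atTop 2,
    Real.tendsto_log_atTop.eventually_gt_atTop 0] with T hT hℓ hT2 hY
  obtain ⟨G₁, hG₁c, hG₁0, hG₁, hG₁i⟩ := h1 T hT2 hℓ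
  obtain ⟨G₂, hG₂c, hG₂0, hG₂, hG₂i⟩ := hT
  have hrpow : Real.log T ^ ((k : ℝ) ^ 2 / 2 + ε)
      = Real.exp (((k : ℝ) ^ 2 / 2 + ε) * Real.log (Real.log T)) := by
    rw [Real.rpow_def_of_pos hY, mul_comm]
  have hone : 1 ≤ Real.exp (((k : ℝ) ^ 2 / 2 + ε) * Real.log (Real.log T)) :=
    Real.one_le_exp (by positivity)
  rw [hrpow]
  calc ∫ t in T..(2 * T), F t ^ k ≤ ∫ t in T..(2 * T), (G₁ t + G₂ t) := by
        refine intervalIntegral.integral_mono_on (by linarith)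
          ((hF.pow k).intervalIntegrable _ _) ((hG₁c.add hG₂c).intervalIntegrable _ _)
          fun t ht => ?_
        rcases (hF0 t).eq_or_lt with h0 | h0
        · rw [← h0, zero_pow (by omega)]
          exact add_nonneg (hG₁0 t) (hG₂0 t)
        · rcases le_total (A * Real.log (Real.log T) + 1) (Real.log (F t)) with h3 | h3
          · exact le_add_of_le_of_nonneg (hG₁ t ht h0 h3) (hG₂0 t)
          · exact le_add_of_nonneg_of_le (hG₁0 t) (hG₂ t ht h0 (by linarith))
    _ = (∫ t in T..(2 * T), G₁ t) + ∫ t in T..(2 * T), G₂ t :=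
        intervalIntegral.integral_add (hG₁c.intervalIntegrable _ _) (hG₂c.intervalIntegrable _ _)
    _ ≤ C₁ * T + C₂ * T * Real.exp (((k : ℝ) ^ 2 / 2 + ε) * Real.log (Real.log T)) :=
        add_le_add hG₁i hG₂i
    _ ≤ |C₁| * T * Real.exp (((k : ℝ) ^ 2 / 2 + ε) * Real.log (Real.log T))
        + |C₂| * T * Real.exp (((k : ℝ) ^ 2 / 2 + ε) * Real.log (Real.log T)) := by
        refine add_le_add ?_ ?_
        · refine le_trans ?_ (le_mul_of_one_le_right (by positivity) hone)
          gcongr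
          exact le_abs_self _
        · gcongr
          exact le_abs_self _
    _ = _ := by ring

end IsLogMajorant

theorem continuous_norm_LFunction_line {q : ℕ} [NeZero q] (χ : DirichletCharacter ℂ q) :
    Continuous fun t : ℝ => ‖DirichletCharacter.LFunction χ (1 / 2 + t * I)‖ := by
  refine (continuous_iff_continuousAt.2 fun t => ?_).norm
  have h1 : (1 / 2 + t * I : ℂ) ≠ 1 := fun h => by
    have := congrArg Complex.re h
    norm_num at this
  exact ContinuousAt.comp (f := fun t : ℝ => (1 / 2 + t * I : ℂ))
    (DirichletCharacter.differentiableAt_LFunction χ _ (Or.inl h1)).continuousAt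
    (by fun_prop)

end Conclusion

/-- On GRH mod `q`, for `k ≥ 2` and distinct characters `χ, ν` modulo `q`,
`|∫_T^{2T} L(1/2+it,χ)^k conj(L(1/2+it,ν))^k dt| ≪_{q,k,ε} T (log T)^{k²−2k+2+ε}`. -/
theorem major_offdiagonal_bound_GRH (q k : ℕ) [NeZero q] (hGRH : GRHmod q) (hk : 2 ≤ k)
    (χ ν : DirichletCharacter ℂ q) (hne : χ ≠ ν) (ε : ℝ) (hε : 0 < ε) :
    ∃ C T₀ : ℝ, ∀ T : ℝ, T₀ ≤ T →
      ‖∫ t in T..(2*T),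
          (DirichletCharacter.LFunction χ (1/2 + t * Complex.I)) ^ k *
            (starRingEnd ℂ (DirichletCharacter.LFunction ν (1/2 + t * Complex.I))) ^ k‖
        ≤ C * T * Real.log T ^ ((k : ℝ) ^ 2 - 2 * (k : ℝ) + 2 + ε) := by
  obtain ⟨c, a, b, h⟩ := exists_isLogMajorant hGRH hne
  obtain ⟨C, hC0, hC⟩ := h.exists_integral_pow_le
    ((continuous_norm_LFunction_line χ).mul (continuous_norm_LFunction_line ν))
    (fun t => by positivity) (by omega : 1 ≤ k) hε
  obtain ⟨T₀, hT₀⟩ := eventually_atTop.1 (hC.and ((eventually_ge_atTop (0 : ℝ)).and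
    (Real.tendsto_log_atTop.eventually_ge_atTop 1)))
  refine ⟨C, T₀, fun T hT => ?_⟩
  obtain ⟨h1, hT0, hY⟩ := hT₀ T hT
  refine (intervalIntegral.norm_integral_le_integral_norm (by linarith)).trans ?_
  simp_rw [norm_mul, norm_pow, RCLike.norm_conj, ← mul_pow]
  refine h1.trans ?_
  gcongr
  nlinarith [sq_nonneg ((k : ℝ) - 2)]
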